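/- Let f be a smooth positive function on the closed unit disc and j a smooth positive function on the unit circle, and fix smooth initial data u₀ : closure B → ℝ and ρ₀ ∈ (0, π). Then there exist numbers 0 < α₀ ≤ α₁ < ∞ and 0 < β₀ ≤ β₁ < ∞, depending only on f, j, u₀, ρ₀ and not on T, such that for every T ∈ (0, ∞] and every smooth solution (u, ρ) of the prescribed curvature flow on [0, T) with u(·,0) = u₀ and ρ(0) = ρ₀, the coefficients α(t) = 2ρ(t)/∫_B f e^{2u(·,t)} dz and β(t) = 2(π−ρ(t))/∫_{∂B} j e^{u(·,t)} ds₀ satisfy α₀ ≤ α(t) ≤ α₁ and β₀ ≤ β(t) ≤ β₁ for all 0 ≤ t < T. -/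

import Mathlib

open MeasureTheory Metric Set Filter
open scoped Real Topology ENNReal

noncomputable section

/-- The closed unit disc in `ℂ ≅ ℝ²`. -/
def cdisc : Set ℂ := Metric.closedBall 0 1

/-- The open unit disc `B`. -/
def odisc : Set ℂ := Metric.ball 0 1

/-- The unit circle `∂B`. -/
def bdry : Set ℂ := Metric.sphere 0 1

/-- The boundary point with angle `θ`. -/
def bpt (θ : ℝ) : ℂ := Complex.exp ((θ : ℂ) * Complex.I)

/-- Boundary integral with respect to arclength `ds₀`. -/
def circInt (φ : ℂ → ℝ) : ℝ := ∫ θ in (0:ℝ)..(2 * Real.pi), φ (bpt θ)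

/-- Integral over the open unit disc with respect to Lebesgue measure. -/
def ballInt (φ : ℂ → ℝ) : ℝ := ∫ z in odisc, φ z

/-- Outward normal derivative `∂w/∂ν₀(z) = z·∇w(z)` for `z ∈ ∂B`. -/
def nder (w : ℂ → ℝ) (z : ℂ) : ℝ := fderivWithin ℝ w cdisc z z

/-- The Euclidean Laplacian, computed with derivatives within the closed disc. -/
def lapW (w : ℂ → ℝ) (z : ℂ) : ℝ :=
  fderivWithin ℝ (fun x => fderivWithin ℝ w cdisc x 1) cdisc z 1 +
  fderivWithin ℝ (fun x => fderivWithin ℝ w cdisc x Complex.I) cdisc z Complex.I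

/-- The coefficient `α(t) = 2ρ(t)/∫_B f e^{2u(·,t)} dz`. -/
def alphaC (f : ℂ → ℝ) (u : ℂ → ℝ → ℝ) (ρ : ℝ → ℝ) (t : ℝ) : ℝ :=
  2 * ρ t / ballInt fun z => f z * Real.exp (2 * u z t)

/-- The coefficient `β(t) = 2(π − ρ(t))/∫_{∂B} j e^{u(·,t)} ds₀`. -/
def betaC (j : ℂ → ℝ) (u : ℂ → ℝ → ℝ) (ρ : ℝ → ℝ) (t : ℝ) : ℝ :=
  2 * (Real.pi - ρ t) / circInt fun z => j z * Real.exp (u z t)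

/-- The time domain `[0, T)` (with `T ∈ (0, ∞]`). -/
def flowDom (T : ℝ≥0∞) : Set ℝ := {t : ℝ | 0 ≤ t ∧ ENNReal.ofReal t < T}

/-- `(u, ρ)` is a smooth solution of the prescribed curvature flow on `[0, T)`:
`∂u/∂t = α f + e^{−2u} Δu` in `B`, `∂u/∂t = β j − e^{−u}(∂u/∂ν₀ + 1)` on `∂B`,
and `dρ/dt = log (β²/α)`, with `u` smooth on `closure B × [0,T)` and `ρ` C¹ with
values in `(0, π)`. -/
def IsFlow (f j : ℂ → ℝ) (T : ℝ≥0∞) (u : ℂ → ℝ → ℝ) (ρ : ℝ → ℝ) : Prop :=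
  ContDiffOn ℝ (⊤ : ℕ∞) (fun p : ℂ × ℝ => u p.1 p.2) (cdisc ×ˢ flowDom T) ∧
  ContDiffOn ℝ 1 ρ (flowDom T) ∧
  (∀ t ∈ flowDom T, ρ t ∈ Set.Ioo 0 Real.pi) ∧
  (∀ t ∈ flowDom T, 0 < t → ∀ z ∈ odisc,
    deriv (u z) t = alphaC f u ρ t * f z + Real.exp (-(2 * u z t)) * lapW (fun w => u w t) z) ∧
  (∀ t ∈ flowDom T, 0 < t → ∀ z ∈ bdry,
    deriv (u z) t = betaC j u ρ t * j z - Real.exp (-(u z t)) * (nder (fun w => u w t) z + 1)) ∧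
  (∀ t ∈ flowDom T, 0 < t →
    deriv ρ t = Real.log (betaC j u ρ t ^ 2 / alphaC f u ρ t))

/-- The Euclidean inner product on `ℂ ≅ ℝ²`. -/
def dot (a b : ℂ) : ℝ := a.re * b.re + a.im * b.im

/-- The linear form `dot g`. -/
def dotL (g : ℂ) : ℂ →L[ℝ] ℝ := g.re • Complex.reCLM + g.im • Complex.imCLM

@[simp] lemma dotL_apply (g v : ℂ) : dotL g v = dot g v := by simp [dotL, dot]

lemma bpt_eq (θ : ℝ) : bpt θ = ⟨Real.cos θ, Real.sin θ⟩ := by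
  apply Complex.ext <;> simp [bpt, Complex.exp_ofReal_mul_I_re, Complex.exp_ofReal_mul_I_im]

@[simp] lemma bpt_re (θ : ℝ) : (bpt θ).re = Real.cos θ := by simp [bpt_eq]

@[simp] lemma bpt_im (θ : ℝ) : (bpt θ).im = Real.sin θ := by simp [bpt_eq]

@[simp] lemma norm_bpt (θ : ℝ) : ‖bpt θ‖ = 1 := Complex.norm_exp_ofReal_mul_I θ

lemma bpt_mem_cdisc (θ : ℝ) : bpt θ ∈ cdisc := by simp [cdisc]

lemma bpt_mem_bdry (θ : ℝ) : bpt θ ∈ bdry := by simp [bdry]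

@[fun_prop] lemma continuous_bpt : Continuous bpt := by unfold bpt; fun_prop

lemma bdry_subset_cdisc : bdry ⊆ cdisc := sphere_subset_closedBall

lemma odisc_subset_cdisc : odisc ⊆ cdisc := ball_subset_closedBall

lemma isCompact_cdisc : IsCompact cdisc := isCompact_closedBall 0 1

lemma isOpen_odisc : IsOpen odisc := isOpen_ball

lemma measurableSet_odisc : MeasurableSet odisc := isOpen_ball.measurableSet

lemma mem_cdisc {z : ℂ} : z ∈ cdisc ↔ ‖z‖ ≤ 1 := by simp [cdisc]

lemma mem_odisc {z : ℂ} : z ∈ odisc ↔ ‖z‖ < 1 := by simp [odisc]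

lemma mem_bdry {z : ℂ} : z ∈ bdry ↔ ‖z‖ = 1 := by simp [bdry]

lemma polar_mem_cdisc {r : ℝ} (h0 : 0 ≤ r) (h1 : r ≤ 1) (θ : ℝ) : (r : ℂ) * bpt θ ∈ cdisc := by
  simp [mem_cdisc, abs_of_nonneg h0, h1]

lemma polar_mem_odisc {r : ℝ} (h0 : 0 ≤ r) (h1 : r < 1) (θ : ℝ) : (r : ℂ) * bpt θ ∈ odisc := by
  simp [mem_odisc, abs_of_nonneg h0, h1]

/-- Continuous functions on the closed disc are integrable on the open disc. -/
lemma integrableOn_odisc {φ : ℂ → ℝ} (h : ContinuousOn φ cdisc) : IntegrableOn φ odisc :=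
  (h.integrableOn_compact isCompact_cdisc).mono_set odisc_subset_cdisc

lemma continuousOn_polar {E : Type*} [TopologicalSpace E] {φ : ℂ → E} (h : ContinuousOn φ cdisc) :
    ContinuousOn (fun p : ℝ × ℝ => φ (p.1 * bpt p.2)) (Icc 0 1 ×ˢ univ) := by
  refine h.comp (by fun_prop) ?_
  rintro ⟨r, θ⟩ ⟨hr, -⟩
  exact polar_mem_cdisc hr.1 hr.2 θ

/-- Integration in polar coordinates. -/
lemma ballInt_polar {φ : ℂ → ℝ} (h : ContinuousOn φ cdisc) :
    ballInt φ = ∫ r in (0:ℝ)..1, ∫ θ in (-π)..π, r * φ (r * bpt θ) := by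
  have hc : ContinuousOn (fun p : ℝ × ℝ => p.1 * φ (p.1 * bpt p.2)) (Icc 0 1 ×ˢ Icc (-π) π) :=
    continuousOn_fst.mul ((continuousOn_polar h).mono (prod_mono_right (subset_univ _)))
  have hi : IntegrableOn (fun p : ℝ × ℝ => p.1 * φ (p.1 * bpt p.2)) (Ioc 0 1 ×ˢ Ioc (-π) π)
      (volume.prod volume) :=
    (hc.integrableOn_compact (isCompact_Icc.prod isCompact_Icc)).mono_set
      (prod_mono Ioc_subset_Icc_self Ioc_subset_Icc_self)
  have e1 : (∫ r in (0:ℝ)..1, ∫ θ in (-π)..π, r * φ (r * bpt θ)) =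
      ∫ p in Ioo (0:ℝ) 1 ×ˢ Ioo (-π) π, p.1 * φ (p.1 * bpt p.2) := by
    rw [intervalIntegral.integral_of_le zero_le_one]
    simp_rw [intervalIntegral.integral_of_le (neg_le_self Real.pi_pos.le)]
    rw [← setIntegral_prod _ hi]
    exact setIntegral_congr_set (Measure.set_prod_ae_eq Ioo_ae_eq_Ioc.symm Ioo_ae_eq_Ioc.symm)
  rw [e1, ballInt, ← integral_indicator measurableSet_odisc,
    ← Complex.integral_comp_polarCoord_symm]
  have hs : Ioo (0:ℝ) 1 ×ˢ Ioo (-π) π ⊆ polarCoord.target := by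
    rw [polarCoord_target]
    exact prod_mono_left Ioo_subset_Ioi_self
  rw [← integral_indicator (measurableSet_Ioo.prod measurableSet_Ioo),
    ← integral_indicator polarCoord.open_target.measurableSet]
  congr 1
  ext ⟨r, θ⟩
  have hp : Complex.polarCoord.symm (r, θ) = r * bpt θ := by
    rw [Complex.polarCoord_symm_apply, bpt_eq]
    congr 1
    apply Complex.ext <;> simp [Complex.cos_ofReal_re, Complex.sin_ofReal_re]
  by_cases ht : (r, θ) ∈ polarCoord.target
  · rw [indicator_of_mem ht]
    have hr : 0 < r := (by simpa [polarCoord_target] using ht : 0 < r ∧ _).1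
    by_cases hr1 : r < 1
    · have hm : (r, θ) ∈ Ioo (0:ℝ) 1 ×ˢ Ioo (-π) π := by
        simp [polarCoord_target] at ht ⊢
        exact ⟨⟨hr, hr1⟩, ht.2⟩
      rw [indicator_of_mem hm]
      simp only [hp, smul_eq_mul]
      rw [indicator_of_mem (polar_mem_odisc hr.le hr1 θ)]
    · have hm : (r, θ) ∉ Ioo (0:ℝ) 1 ×ˢ Ioo (-π) π := by
        simp; intro _ h; exact absurd h hr1
      rw [indicator_of_notMem hm]
      simp only [hp, smul_eq_mul]
      rw [indicator_of_notMem, mul_zero]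
      simp [mem_odisc, abs_of_pos hr, not_lt.1 hr1]
  · rw [indicator_of_notMem ht, indicator_of_notMem (fun h => ht (hs h))]

/-- `u` has gradient `g` in the open disc, both continuous up to the boundary. -/
structure IsGrad (u : ℂ → ℝ) (g : ℂ → ℂ) : Prop where
  cont : ContinuousOn u cdisc
  contGrad : ContinuousOn g cdisc
  deriv : ∀ z ∈ odisc, HasFDerivAt u (dotL (g z)) z

/-- `V` has divergence `d` in the open disc, both continuous up to the boundary. -/
structure HasDiv (V : ℂ → ℂ) (d : ℂ → ℝ) : Prop where
  cont : ContinuousOn V cdisc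
  contDiv : ContinuousOn d cdisc
  deriv : ∀ z ∈ odisc, ∃ V' : ℂ →L[ℝ] ℂ, HasFDerivAt V V' z ∧ (V' 1).re + (V' Complex.I).im = d z

lemma circInt_eq_neg_pi_pi (φ : ℂ → ℝ) : circInt φ = ∫ θ in (-π)..π, φ (bpt θ) := by
  have hp : Function.Periodic (fun θ => φ (bpt θ)) (2 * π) := by
    intro θ
    simp [bpt_eq]
  have := hp.intervalIntegral_add_eq 0 (-π)
  rw [zero_add, show -π + 2 * π = π by ring] at this
  exact this

lemma hasDerivAt_bpt (θ : ℝ) : HasDerivAt bpt (Complex.I * bpt θ) θ := by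
  have : HasDerivAt (fun x : ℝ => (x : ℂ) * Complex.I) (1 * Complex.I) θ :=
    (Complex.ofRealCLM.hasDerivAt (x := θ)).mul_const _
  have h2 := this.cexp
  rw [one_mul, mul_comm] at h2
  exact h2

/-- The divergence theorem on the unit disc. -/
theorem HasDiv.ballInt_eq {V : ℂ → ℂ} {d : ℂ → ℝ} (h : HasDiv V d) :
    ballInt d = circInt fun z => dot z (V z) := by
  rw [ballInt_polar h.contDiv, circInt_eq_neg_pi_pi]
  choose! V' hV' hd using h.deriv
  let pol : ℝ × ℝ → ℂ := fun p => p.1 * bpt p.2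
  let pol' : ℝ × ℝ → ℝ × ℝ →L[ℝ] ℂ := fun p =>
    (ContinuousLinearMap.fst ℝ ℝ ℝ).smulRight (bpt p.2) +
      (ContinuousLinearMap.snd ℝ ℝ ℝ).smulRight (p.1 * (Complex.I * bpt p.2))
  have hb : ∀ p : ℝ × ℝ, HasFDerivAt (fun p : ℝ × ℝ => bpt p.2)
      ((ContinuousLinearMap.snd ℝ ℝ ℝ).smulRight (Complex.I * bpt p.2)) p := by
    intro p
    have h1 := (hasDerivAt_bpt p.2).hasFDerivAt.comp p (hasFDerivAt_snd (𝕜 := ℝ))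
    refine h1.congr_fderiv ?_
    ext <;> simp
  have hpol : ∀ p, HasFDerivAt pol (pol' p) p := by
    intro p
    have h1 : HasFDerivAt (fun p : ℝ × ℝ => p.1 • bpt p.2) _ p :=
      (hasFDerivAt_fst (𝕜 := ℝ)).smul (hb p)
    refine (h1.congr_fderiv ?_).congr_of_eventuallyEq (Eventually.of_forall fun q => ?_)
    · ext <;> simp [pol']
    · simp [pol]
  have hre : ∀ {F : ℝ × ℝ → ℂ} {F'} {p}, HasFDerivAt F F' p → HasFDerivAt (fun p => (F p).re)
      (Complex.reCLM.comp F') p := fun h => Complex.reCLM.hasFDerivAt.comp _ h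
  have him : ∀ {F : ℝ × ℝ → ℂ} {F'} {p}, HasFDerivAt F F' p → HasFDerivAt (fun p => (F p).im)
      (Complex.imCLM.comp F') p := fun h => Complex.imCLM.hasFDerivAt.comp _ h
  let W : ℝ × ℝ → ℂ := fun p => V (pol p)
  let b : ℝ × ℝ → ℂ := fun p => bpt p.2
  let b' : ℝ × ℝ → ℝ × ℝ →L[ℝ] ℂ := fun p =>
    (ContinuousLinearMap.snd ℝ ℝ ℝ).smulRight (Complex.I * bpt p.2)
  let W' : ℝ × ℝ → ℝ × ℝ →L[ℝ] ℂ := fun p => (V' (pol p)).comp (pol' p)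
  let F : ℝ × ℝ → ℝ := fun p => p.1 * ((b p).re * (W p).re + (b p).im * (W p).im)
  let G : ℝ × ℝ → ℝ := fun p => (b p).re * (W p).im - (b p).im * (W p).re
  let D' : ℝ × ℝ → ℝ × ℝ →L[ℝ] ℝ := fun p =>
    ((b p).re • Complex.reCLM.comp (W' p) + (W p).re • Complex.reCLM.comp (b' p)) +
      ((b p).im • Complex.imCLM.comp (W' p) + (W p).im • Complex.imCLM.comp (b' p))
  let F' : ℝ × ℝ → ℝ × ℝ →L[ℝ] ℝ := fun p =>
    p.1 • D' p + ((b p).re * (W p).re + (b p).im * (W p).im) • ContinuousLinearMap.fst ℝ ℝ ℝ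
  let G' : ℝ × ℝ → ℝ × ℝ →L[ℝ] ℝ := fun p =>
    ((b p).re • Complex.imCLM.comp (W' p) + (W p).im • Complex.reCLM.comp (b' p)) -
      ((b p).im • Complex.reCLM.comp (W' p) + (W p).re • Complex.imCLM.comp (b' p))
  have hW : ∀ p ∈ Ioo (0:ℝ) 1 ×ˢ Ioo (-π) π, HasFDerivAt W (W' p) p := fun p hp =>
    (hV' _ (polar_mem_odisc hp.1.1.le hp.1.2 p.2)).comp p (hpol p)
  have hF : ∀ p ∈ Ioo (0:ℝ) 1 ×ˢ Ioo (-π) π, HasFDerivAt F (F' p) p := fun p hp =>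
    (hasFDerivAt_fst (𝕜 := ℝ)).mul
      (((hre (hb p)).mul (hre (hW p hp))).add ((him (hb p)).mul (him (hW p hp))))
  have hG : ∀ p ∈ Ioo (0:ℝ) 1 ×ˢ Ioo (-π) π, HasFDerivAt G (G' p) p := fun p hp =>
    ((hre (hb p)).mul (him (hW p hp))).sub ((him (hb p)).mul (hre (hW p hp)))
  have hlin : ∀ (A : ℂ →L[ℝ] ℂ) (x y : ℝ) , A (x + y * Complex.I) = x * A 1 + y * A Complex.I := by
    intro A x y
    rw [map_add, show (x:ℂ) = x • (1:ℂ) by simp, show (y:ℂ) * Complex.I = y • Complex.I by simp,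
      map_smul, map_smul]
    simp
  have key : ∀ p ∈ Ioo (0:ℝ) 1 ×ˢ Ioo (-π) π,
      F' p (1, 0) + G' p (0, 1) = p.1 * d (p.1 * bpt p.2) := by
    rintro ⟨r, θ⟩ hp
    rw [← hd _ (polar_mem_odisc hp.1.1.le hp.1.2 θ)]
    set A := V' (r * bpt θ) with hA
    have e1 : A (bpt θ) = Real.cos θ * A 1 + Real.sin θ * A Complex.I := by
      rw [← hlin, bpt_eq]; congr 1; apply Complex.ext <;> simp [Complex.cos_ofReal_re, Complex.sin_ofReal_re]
    have e2 : A (r * (Complex.I * bpt θ)) =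
        (-(r * Real.sin θ) : ℝ) * A 1 + (r * Real.cos θ : ℝ) * A Complex.I := by
      rw [← hlin, bpt_eq]; congr 1; apply Complex.ext <;> simp [Complex.cos_ofReal_re, Complex.sin_ofReal_re]
    have a1 : W' (r, θ) (1, 0) = A (bpt θ) := by simp [W', pol', pol, hA]
    have a2 : W' (r, θ) (0, 1) = A (r * (Complex.I * bpt θ)) := by simp [W', pol', pol, hA]
    have a3 : b' (r, θ) (1, 0) = 0 := by simp [b']
    have a4 : b' (r, θ) (0, 1) = Complex.I * bpt θ := by simp [b']
    simp only [F', G', D', add_apply, sub_apply, smul_apply,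
       ContinuousLinearMap.comp_apply, a1, a2, a3, a4, e1, e2, b]
    simp [Complex.cos_ofReal_re, Complex.sin_ofReal_re]
    linear_combination (r * ((A 1).re + (A Complex.I).im)) * Real.sin_sq_add_cos_sq θ
  have hpi : -π ≤ π := neg_le_self Real.pi_pos.le
  have hWc : ContinuousOn W (Icc 0 1 ×ˢ Icc (-π) π) :=
    (continuousOn_polar h.cont).mono (prod_mono_right (subset_univ _))
  have hbc : Continuous b := by fun_prop
  have hdc : ContinuousOn (fun p : ℝ × ℝ => p.1 * d (p.1 * bpt p.2)) (Icc 0 1 ×ˢ Icc (-π) π) :=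
    continuousOn_fst.mul ((continuousOn_polar h.contDiv).mono (prod_mono_right (subset_univ _)))
  have hae : (Icc (0:ℝ) 1 ×ˢ Icc (-π) π : Set (ℝ × ℝ)) =ᵐ[volume] (Ioo (0:ℝ) 1 ×ˢ Ioo (-π) π) :=
    Measure.set_prod_ae_eq Ioo_ae_eq_Icc.symm Ioo_ae_eq_Icc.symm
  have hmeas : MeasurableSet (Ioo (0:ℝ) 1 ×ˢ Ioo (-π) π) := measurableSet_Ioo.prod measurableSet_Ioo
  have Hi : IntegrableOn (fun p => F' p (1, 0) + G' p (0, 1)) (Icc 0 1 ×ˢ Icc (-π) π) := by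
    rw [integrableOn_congr_set_ae hae]
    refine IntegrableOn.congr_fun ?_ (fun p hp => (key p hp).symm) hmeas
    exact (hdc.integrableOn_compact (isCompact_Icc.prod isCompact_Icc)).mono_set
      (prod_mono Ioo_subset_Icc_self Ioo_subset_Icc_self)
  have main := integral2_divergence_prod_of_hasFDerivAt F G F' G' 0 (-π) 1 π
    (by
      rw [uIcc_of_le zero_le_one, uIcc_of_le hpi]
      exact continuousOn_fst.mul (by fun_prop))
    (by
      rw [uIcc_of_le zero_le_one, uIcc_of_le hpi]
      fun_prop)
    (by simpa [hpi] using hF) (by simpa [hpi] using hG)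
    (by rw [uIcc_of_le zero_le_one, uIcc_of_le hpi]; exact Hi)
  have e3 : (∫ r in (0:ℝ)..1, ∫ θ in (-π)..π, F' (r, θ) (1, 0) + G' (r, θ) (0, 1)) =
      ∫ r in (0:ℝ)..1, ∫ θ in (-π)..π, r * d (r * bpt θ) := by
    simp_rw [intervalIntegral.integral_of_le zero_le_one, intervalIntegral.integral_of_le hpi,
      integral_Ioc_eq_integral_Ioo]
    refine setIntegral_congr_fun measurableSet_Ioo fun r hr => ?_
    refine setIntegral_congr_fun measurableSet_Ioo fun θ hθ => ?_
    exact key (r, θ) ⟨hr, hθ⟩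
  rw [← e3, main]
  have e4 : ∀ r : ℝ, G (r, π) = G (r, -π) := by
    intro r
    have : bpt π = bpt (-π) := by simp [bpt_eq]
    simp [G, b, W, pol, this]
  simp only [e4, sub_self, zero_add]
  simp [F, b, W, pol, dot]

lemma ContinuousOn.dot {s : Set ℂ} {f g : ℂ → ℂ} (hf : ContinuousOn f s) (hg : ContinuousOn g s) :
    ContinuousOn (fun z => dot (f z) (g z)) s := by
  unfold _root_.dot
  exact ((Complex.continuous_re.comp_continuousOn hf).mul
    (Complex.continuous_re.comp_continuousOn hg)).add
    ((Complex.continuous_im.comp_continuousOn hf).mul (Complex.continuous_im.comp_continuousOn hg))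

lemma dot_self (a : ℂ) : dot a a = ‖a‖ ^ 2 := by
  rw [Complex.sq_norm, Complex.normSq_apply]; rfl

lemma dot_comm (a b : ℂ) : dot a b = dot b a := by unfold dot; ring

lemma dot_add_left (a b c : ℂ) : dot (a + b) c = dot a c + dot b c := by simp [dot]; ring

lemma dot_sub_left (a b c : ℂ) : dot (a - b) c = dot a c - dot b c := by simp [dot]; ring

lemma dot_sub_right (a b c : ℂ) : dot a (b - c) = dot a b - dot a c := by simp [dot]; ring

lemma dot_smul_left (r : ℝ) (b c : ℂ) : dot (r * b) c = r * dot b c := by simp [dot]; ring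

lemma dot_smul_right (r : ℝ) (b c : ℂ) : dot b (r * c) = r * dot b c := by simp [dot]; ring

lemma dot_conj (a b : ℂ) : dot a ((starRingEnd ℂ) b) = (a * b).re := by simp [dot]; ring

lemma dotL_add (a b : ℂ) : dotL (a + b) = dotL a + dotL b := by
  ext; simp [dotL]; ring

lemma dotL_smul (r : ℝ) (b : ℂ) : dotL (r * b) = r • dotL b := by
  ext; simp [dotL]; ring

section Integrals

lemma continuous_comp_bpt {φ : ℂ → ℝ} (h : ContinuousOn φ bdry) :
    Continuous fun θ => φ (bpt θ) :=
  h.comp_continuous continuous_bpt bpt_mem_bdry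

lemma circInt_intervalIntegrable {φ : ℂ → ℝ} (h : ContinuousOn φ bdry) (a b : ℝ) :
    IntervalIntegrable (fun θ => φ (bpt θ)) volume a b :=
  (continuous_comp_bpt h).intervalIntegrable a b

lemma circInt_congr {φ ψ : ℂ → ℝ} (h : ∀ z ∈ bdry, φ z = ψ z) : circInt φ = circInt ψ := by
  unfold circInt
  congr 1
  ext θ
  exact h _ (bpt_mem_bdry θ)

lemma circInt_add {φ ψ : ℂ → ℝ} (h : ContinuousOn φ bdry) (h' : ContinuousOn ψ bdry) :
    circInt (fun z => φ z + ψ z) = circInt φ + circInt ψ :=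
  intervalIntegral.integral_add (circInt_intervalIntegrable h _ _)
    (circInt_intervalIntegrable h' _ _)

lemma circInt_sub {φ ψ : ℂ → ℝ} (h : ContinuousOn φ bdry) (h' : ContinuousOn ψ bdry) :
    circInt (fun z => φ z - ψ z) = circInt φ - circInt ψ :=
  intervalIntegral.integral_sub (circInt_intervalIntegrable h _ _)
    (circInt_intervalIntegrable h' _ _)

lemma circInt_const_mul (c : ℝ) (φ : ℂ → ℝ) : circInt (fun z => c * φ z) = c * circInt φ :=
  intervalIntegral.integral_const_mul c _

lemma circInt_const (c : ℝ) : circInt (fun _ => c) = 2 * π * c := by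
  simp [circInt]

lemma circInt_mono {φ ψ : ℂ → ℝ} (h : ContinuousOn φ bdry) (h' : ContinuousOn ψ bdry)
    (hle : ∀ z ∈ bdry, φ z ≤ ψ z) : circInt φ ≤ circInt ψ :=
  intervalIntegral.integral_mono_on (by positivity) (circInt_intervalIntegrable h _ _)
    (circInt_intervalIntegrable h' _ _) fun θ _ => hle _ (bpt_mem_bdry θ)

lemma circInt_nonneg {φ : ℂ → ℝ} (hle : ∀ z ∈ bdry, 0 ≤ φ z) : 0 ≤ circInt φ :=
  intervalIntegral.integral_nonneg (by positivity) fun θ _ => hle _ (bpt_mem_bdry θ)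

lemma circInt_pos {φ : ℂ → ℝ} (h : ContinuousOn φ bdry) (hle : ∀ z ∈ bdry, 0 < φ z) :
    0 < circInt φ :=
  intervalIntegral.intervalIntegral_pos_of_pos (circInt_intervalIntegrable h _ _)
    (fun θ => hle _ (bpt_mem_bdry θ)) (by positivity)

lemma ballInt_congr {φ ψ : ℂ → ℝ} (h : ∀ z ∈ odisc, φ z = ψ z) : ballInt φ = ballInt ψ :=
  setIntegral_congr_fun measurableSet_odisc h

lemma ballInt_add {φ ψ : ℂ → ℝ} (h : ContinuousOn φ cdisc) (h' : ContinuousOn ψ cdisc) :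
    ballInt (fun z => φ z + ψ z) = ballInt φ + ballInt ψ :=
  integral_add (integrableOn_odisc h) (integrableOn_odisc h')

lemma ballInt_sub {φ ψ : ℂ → ℝ} (h : ContinuousOn φ cdisc) (h' : ContinuousOn ψ cdisc) :
    ballInt (fun z => φ z - ψ z) = ballInt φ - ballInt ψ :=
  integral_sub (integrableOn_odisc h) (integrableOn_odisc h')

lemma ballInt_const_mul (c : ℝ) (φ : ℂ → ℝ) : ballInt (fun z => c * φ z) = c * ballInt φ :=
  integral_const_mul c _

lemma ballInt_mono {φ ψ : ℂ → ℝ} (h : ContinuousOn φ cdisc) (h' : ContinuousOn ψ cdisc)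
    (hle : ∀ z ∈ odisc, φ z ≤ ψ z) : ballInt φ ≤ ballInt ψ :=
  setIntegral_mono_on (integrableOn_odisc h) (integrableOn_odisc h') measurableSet_odisc hle

lemma ballInt_nonneg {φ : ℂ → ℝ} (hle : ∀ z ∈ odisc, 0 ≤ φ z) : 0 ≤ ballInt φ :=
  setIntegral_nonneg measurableSet_odisc hle

lemma volume_odisc : volume.real odisc = π := by
  simp [odisc, Measure.real]

lemma ballInt_const (c : ℝ) : ballInt (fun _ => c) = π * c := by
  simp [ballInt, volume_odisc]

lemma ballInt_pos {φ : ℂ → ℝ} (h : ContinuousOn φ cdisc) (hle : ∀ z ∈ cdisc, 0 < φ z) :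
    0 < ballInt φ := by
  obtain ⟨z₀, hz₀, hmin⟩ := isCompact_cdisc.exists_isMinOn ⟨0, by simp [mem_cdisc]⟩ h
  have h1 : ballInt (fun _ => φ z₀) ≤ ballInt φ :=
    ballInt_mono continuousOn_const h fun z hz => hmin (odisc_subset_cdisc hz)
  rw [ballInt_const] at h1
  exact lt_of_lt_of_le (mul_pos Real.pi_pos (hle _ hz₀)) h1

end Integrals

namespace IsGrad

variable {u v : ℂ → ℝ} {g h : ℂ → ℂ}

lemma const (c : ℝ) : IsGrad (fun _ => c) (fun _ => 0) :=
  ⟨continuousOn_const, continuousOn_const, fun z _ => by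
    refine (hasFDerivAt_const c z).congr_fderiv ?_
    ext; simp [dotL]⟩

lemma add (hu : IsGrad u g) (hv : IsGrad v h) :
    IsGrad (fun z => u z + v z) (fun z => g z + h z) :=
  ⟨hu.cont.add hv.cont, hu.contGrad.add hv.contGrad, fun z hz => by
    rw [dotL_add]; exact (hu.deriv z hz).add (hv.deriv z hz)⟩

lemma const_mul (c : ℝ) (hu : IsGrad u g) : IsGrad (fun z => c * u z) (fun z => c * g z) :=
  ⟨continuousOn_const.mul hu.cont, continuousOn_const.mul hu.contGrad, fun z hz => by
    rw [dotL_smul]; exact (hu.deriv z hz).const_mul c⟩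

lemma sub (hu : IsGrad u g) (hv : IsGrad v h) :
    IsGrad (fun z => u z - v z) (fun z => g z - h z) := by
  have := hu.add (hv.const_mul (-1))
  simpa [sub_eq_add_neg] using this

lemma mul (hu : IsGrad u g) (hv : IsGrad v h) :
    IsGrad (fun z => u z * v z) (fun z => u z * h z + v z * g z) :=
  ⟨hu.cont.mul hv.cont,
    ((Complex.continuous_ofReal.comp_continuousOn hu.cont).mul hv.contGrad).add
      ((Complex.continuous_ofReal.comp_continuousOn hv.cont).mul hu.contGrad), fun z hz => by
    rw [dotL_add, dotL_smul, dotL_smul]; exact (hu.deriv z hz).mul (hv.deriv z hz)⟩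

lemma comp {φ φ' : ℝ → ℝ} (hφ : ∀ x, HasDerivAt φ (φ' x) x) (hφ' : Continuous φ')
    (hu : IsGrad u g) : IsGrad (fun z => φ (u z)) (fun z => φ' (u z) * g z) :=
  ⟨(continuous_iff_continuousAt.2 fun x => (hφ x).continuousAt).comp_continuousOn hu.cont,
    (Complex.continuous_ofReal.comp_continuousOn (hφ'.comp_continuousOn hu.cont)).mul hu.contGrad,
    fun z hz => by
      rw [dotL_smul]; exact (hφ (u z)).comp_hasFDerivAt z (hu.deriv z hz)⟩

lemma exp (hu : IsGrad u g) : IsGrad (fun z => Real.exp (u z)) (fun z => Real.exp (u z) * g z) :=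
  hu.comp Real.hasDerivAt_exp Real.continuous_exp

lemma congr {v : ℂ → ℝ} {h : ℂ → ℂ} (hu : IsGrad u g) (h1 : ∀ z ∈ cdisc, v z = u z)
    (h2 : ∀ z ∈ cdisc, h z = g z) : IsGrad v h :=
  ⟨hu.cont.congr h1, hu.contGrad.congr h2, fun z hz => by
    rw [h2 z (odisc_subset_cdisc hz)]
    refine (hu.deriv z hz).congr_of_eventuallyEq ?_
    filter_upwards [isOpen_odisc.mem_nhds hz] with w hw using h1 w (odisc_subset_cdisc hw)⟩

end IsGrad

namespace HasDiv

variable {V W : ℂ → ℂ} {d e : ℂ → ℝ}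

lemma add (hV : HasDiv V d) (hW : HasDiv W e) :
    HasDiv (fun z => V z + W z) (fun z => d z + e z) :=
  ⟨hV.cont.add hW.cont, hV.contDiv.add hW.contDiv, fun z hz => by
    obtain ⟨V', h1, h2⟩ := hV.deriv z hz
    obtain ⟨W', h3, h4⟩ := hW.deriv z hz
    refine ⟨V' + W', h1.add h3, ?_⟩
    rw [← h2, ← h4]; simp; ring⟩

lemma const_mul (c : ℝ) (hV : HasDiv V d) : HasDiv (fun z => c * V z) (fun z => c * d z) :=
  ⟨continuousOn_const.mul hV.cont, continuousOn_const.mul hV.contDiv, fun z hz => by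
    obtain ⟨V', h1, h2⟩ := hV.deriv z hz
    refine ⟨c • V', ?_, ?_⟩
    · exact (h1.const_smul c).congr_of_eventuallyEq (Eventually.of_forall fun w => by simp)
    · rw [← h2]; simp; ring⟩

lemma sub (hV : HasDiv V d) (hW : HasDiv W e) :
    HasDiv (fun z => V z - W z) (fun z => d z - e z) := by
  have := hV.add (hW.const_mul (-1))
  simpa [sub_eq_add_neg] using this

lemma smul {u : ℂ → ℝ} {g : ℂ → ℂ} (hu : IsGrad u g) (hV : HasDiv V d) :
    HasDiv (fun z => u z * V z) (fun z => dot (g z) (V z) + u z * d z) :=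
  ⟨(Complex.continuous_ofReal.comp_continuousOn hu.cont).mul hV.cont,
    (hu.contGrad.dot hV.cont).add (hu.cont.mul hV.contDiv), fun z hz => by
    obtain ⟨V', h1, h2⟩ := hV.deriv z hz
    have h3 : HasFDerivAt (fun z => u z • V z) _ z := (hu.deriv z hz).smul h1
    refine ⟨_, h3.congr_of_eventuallyEq (Eventually.of_forall fun w => by simp), ?_⟩
    rw [← h2]
    simp [dot]
    ring⟩

lemma congr {W : ℂ → ℂ} {e : ℂ → ℝ} (hV : HasDiv V d) (h1 : ∀ z ∈ cdisc, W z = V z)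
    (h2 : ∀ z ∈ cdisc, e z = d z) : HasDiv W e :=
  ⟨hV.cont.congr h1, hV.contDiv.congr h2, fun z hz => by
    rw [h2 z (odisc_subset_cdisc hz)]
    obtain ⟨V', h3, h4⟩ := hV.deriv z hz
    refine ⟨V', h3.congr_of_eventuallyEq ?_, h4⟩
    filter_upwards [isOpen_odisc.mem_nhds hz] with w hw using h1 w (odisc_subset_cdisc hw)⟩

end HasDiv

/-- Green's first identity on the disc. -/
theorem green {u : ℂ → ℝ} {g V : ℂ → ℂ} {d : ℂ → ℝ} (hu : IsGrad u g) (hV : HasDiv V d) :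
    ballInt (fun z => dot (g z) (V z)) + ballInt (fun z => u z * d z) =
      circInt fun z => u z * dot z (V z) := by
  rw [← ballInt_add (ψ := fun z => u z * d z) (hu.contGrad.dot hV.cont) (hu.cont.mul hV.contDiv),
    (HasDiv.smul hu hV).ballInt_eq]
  exact circInt_congr fun z _ => dot_smul_right _ _ _

lemma isGrad_re {h h' : ℂ → ℂ} (hh : ∀ z ∈ cdisc, HasDerivAt h (h' z) z)
    (hc : ContinuousOn h' cdisc) :
    IsGrad (fun z => (h z).re) (fun z => (starRingEnd ℂ) (h' z)) :=
  ⟨fun z hz => (Complex.continuous_re.continuousAt.comp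
      (hh z hz).continuousAt).continuousWithinAt,
    Complex.continuous_conj.comp_continuousOn hc, fun z hz => by
    have h1 := (hh z (odisc_subset_cdisc hz)).hasFDerivAt.restrictScalars ℝ
    refine (Complex.reCLM.hasFDerivAt.comp z h1).congr_fderiv ?_
    ext; simp [dotL]; ring⟩

lemma hasDiv_conj {k k' : ℂ → ℂ} (hk : ∀ z ∈ cdisc, HasDerivAt k (k' z) z) :
    HasDiv (fun z => (starRingEnd ℂ) (k z)) (fun _ => 0) :=
  ⟨fun z hz => (Complex.continuous_conj.continuousAt.comp
      (hk z hz).continuousAt).continuousWithinAt, continuousOn_const, fun z hz => by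
    have h1 := (hk z (odisc_subset_cdisc hz)).hasFDerivAt.restrictScalars ℝ
    refine ⟨_, Complex.conjCLE.toContinuousLinearMap.hasFDerivAt.comp z h1, ?_⟩
    simp⟩

local notation "conj" => starRingEnd ℂ

/-- The denominator of the disc automorphism sending `a` to `0`. -/
def mobDen (a z : ℂ) : ℂ := 1 - conj a * z

/-- The conformal factor `(1 - |a|²) / |1 - \bar a z|²` of the disc automorphism. -/
def jac (a z : ℂ) : ℝ := (1 - ‖a‖ ^ 2) / ‖mobDen a z‖ ^ 2

/-- The logarithm of the conformal factor. -/
def psi (a z : ℂ) : ℝ := Real.log (jac a z)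

/-- The gradient of `psi a`. -/
def gradPsi (a z : ℂ) : ℂ := conj (2 * conj a / mobDen a z)

/-- The disc automorphism sending `a` to `0`. -/
def mob (a z : ℂ) : ℂ := (z - a) / mobDen a z

/-- The complex derivative of `mob a`. -/
def mobDeriv (a z : ℂ) : ℂ := (1 - ‖a‖ ^ 2) / mobDen a z ^ 2

/-- Half the gradient of `|mob a|²`. -/
def mobField (a z : ℂ) : ℂ := mob a z * conj (mobDeriv a z)

/-- The function `1 - |mob a|²`. -/
def eta (a z : ℂ) : ℝ := (1 - ‖z‖ ^ 2) * jac a z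

lemma hasDerivAt_mobDen (a z : ℂ) : HasDerivAt (mobDen a) (-conj a) z := by
  have := ((hasDerivAt_id z).const_mul (conj a)).const_sub 1
  rw [mul_one] at this
  exact this

lemma continuous_mobDen (a : ℂ) : Continuous (mobDen a) := by unfold mobDen; fun_prop

lemma eta_bdry (a : ℂ) {z : ℂ} (hz : z ∈ bdry) : eta a z = 0 := by simp [eta, mem_bdry.1 hz]

section Mobius

variable {a : ℂ} (ha : a ∈ odisc)
include ha

lemma mobDen_re_pos {z : ℂ} (hz : z ∈ cdisc) : 0 < (mobDen a z).re := by
  have h1 : (conj a * z).re ≤ ‖conj a * z‖ := Complex.re_le_norm _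
  rw [norm_mul, RCLike.norm_conj] at h1
  have h2 : ‖a‖ * ‖z‖ < 1 := by
    nlinarith [mem_odisc.1 ha, mem_cdisc.1 hz, norm_nonneg a, norm_nonneg z]
  simp only [mobDen, Complex.sub_re, Complex.one_re]
  linarith

lemma mobDen_ne_zero {z : ℂ} (hz : z ∈ cdisc) : mobDen a z ≠ 0 := by
  intro h
  have := mobDen_re_pos ha hz
  simp [h] at this

lemma one_sub_norm_sq_pos : 0 < 1 - ‖a‖ ^ 2 := by
  nlinarith [mem_odisc.1 ha, norm_nonneg a]

lemma jac_pos {z : ℂ} (hz : z ∈ cdisc) : 0 < jac a z :=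
  div_pos (one_sub_norm_sq_pos ha) (by have := mobDen_ne_zero ha hz; positivity)

lemma exp_psi {z : ℂ} (hz : z ∈ cdisc) : Real.exp (psi a z) = jac a z := Real.exp_log (jac_pos ha hz)

lemma psi_eq {z : ℂ} (hz : z ∈ cdisc) :
    psi a z = (Real.log (1 - ‖a‖ ^ 2) - 2 * Complex.log (mobDen a z)).re := by
  have := mobDen_ne_zero ha hz
  rw [psi, jac, Real.log_div (one_sub_norm_sq_pos ha).ne' (by positivity), Real.log_pow]
  rw [Complex.sub_re, Complex.ofReal_re, Complex.mul_re, Complex.log_re]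
  simp

lemma hasDerivAt_psiC {z : ℂ} (hz : z ∈ cdisc) :
    HasDerivAt (fun z => (Real.log (1 - ‖a‖ ^ 2) - 2 * Complex.log (mobDen a z) : ℂ))
      (2 * conj a / mobDen a z) z := by
  have h1 := ((hasDerivAt_mobDen a z).clog (Or.inl (mobDen_re_pos ha hz))).const_mul 2
  refine (h1.const_sub (Real.log (1 - ‖a‖ ^ 2) : ℂ)).congr_deriv ?_
  ring

lemma hasDerivAt_gradPsi {z : ℂ} (hz : z ∈ cdisc) :
    HasDerivAt (fun z => 2 * conj a / mobDen a z) (2 * (conj a) ^ 2 / mobDen a z ^ 2) z := by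
  refine ((hasDerivAt_const z (2 * conj a)).div (hasDerivAt_mobDen a z)
    (mobDen_ne_zero ha hz)).congr_deriv ?_
  ring

lemma isGrad_psi : IsGrad (psi a) (gradPsi a) :=
  (isGrad_re (fun _ hz => hasDerivAt_psiC ha hz) fun _ hz =>
    (hasDerivAt_gradPsi ha hz).continuousAt.continuousWithinAt).congr
    (fun _ hz => psi_eq ha hz) fun _ _ => rfl

lemma hasDiv_gradPsi : HasDiv (gradPsi a) (fun _ => 0) := hasDiv_conj fun _ hz => hasDerivAt_gradPsi ha hz

lemma continuousOn_jac : ContinuousOn (jac a) cdisc :=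
  continuousOn_const.div ((continuous_mobDen a).norm.pow 2).continuousOn fun z hz => by
    have := mobDen_ne_zero ha hz; positivity

lemma dot_gradPsi {z : ℂ} (hz : z ∈ bdry) : dot z (gradPsi a z) = jac a z - 1 := by
  have hd := mobDen_ne_zero ha (bdry_subset_cdisc hz)
  have hn : ‖mobDen a z‖ ^ 2 = (mobDen a z).re ^ 2 + (mobDen a z).im ^ 2 := by
    rw [Complex.sq_norm, Complex.normSq_apply]; ring
  have hn0 : ‖mobDen a z‖ ^ 2 ≠ 0 := by positivity
  have hz1 : z.re ^ 2 + z.im ^ 2 = 1 := by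
    have := mem_bdry.1 hz
    have h2 := Complex.sq_norm z
    rw [Complex.normSq_apply, this] at h2; linarith
  have hsq : ‖a‖ ^ 2 = a.re ^ 2 + a.im ^ 2 := by rw [Complex.sq_norm, Complex.normSq_apply]; ring
  rw [gradPsi, dot_conj, jac, ← mul_div_assoc, Complex.div_re, Complex.normSq_eq_norm_sq,
    ← add_div, eq_sub_iff_add_eq, div_add_one hn0]
  congr 1
  rw [hn, hsq]
  simp [mobDen]
  linear_combination (-a.re ^ 2 - a.im ^ 2) * hz1

lemma hasDerivAt_mob {z : ℂ} (hz : z ∈ cdisc) : HasDerivAt (mob a) (mobDeriv a z) z := by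
  have hd := mobDen_ne_zero ha hz
  refine (((hasDerivAt_id z).sub_const a).div (hasDerivAt_mobDen a z) hd).congr_deriv ?_
  rw [mobDeriv]
  congr 1
  rw [← Complex.mul_conj']
  simp [mobDen]
  ring

lemma hasDerivAt_mobDeriv {z : ℂ} (hz : z ∈ cdisc) :
    HasDerivAt (mobDeriv a) (2 * conj a * (1 - ‖a‖ ^ 2) / mobDen a z ^ 3) z := by
  have hd := mobDen_ne_zero ha hz
  refine ((hasDerivAt_const z ((1 - ‖a‖ ^ 2 : ℂ))).div ((hasDerivAt_mobDen a z).pow 2)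
    (pow_ne_zero 2 hd)).congr_deriv ?_
  simp only [Nat.cast_ofNat, Pi.pow_apply]
  field_simp
  ring

lemma norm_mobDeriv (z : ℂ) : ‖mobDeriv a z‖ = jac a z := by
  rw [mobDeriv, jac, norm_div, norm_pow]
  congr 1
  rw [show (1 - (‖a‖:ℂ) ^ 2) = ((1 - ‖a‖ ^ 2 : ℝ) : ℂ) by push_cast; ring, Complex.norm_real,
    Real.norm_of_nonneg (one_sub_norm_sq_pos ha).le]

lemma eta_eq {z : ℂ} (hz : z ∈ cdisc) : eta a z = 1 - ‖mob a z‖ ^ 2 := by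
  have hd := mobDen_ne_zero ha hz
  have hn0 : ‖mobDen a z‖ ^ 2 ≠ 0 := by positivity
  rw [eta, jac, mob, norm_div, div_pow, eq_sub_iff_add_eq, ← mul_div_assoc, ← add_div,
    div_eq_one_iff_eq hn0]
  simp only [Complex.sq_norm, Complex.normSq_apply, mobDen]
  simp
  ring

lemma eta_nonneg {z : ℂ} (hz : z ∈ cdisc) : 0 ≤ eta a z :=
  mul_nonneg (by nlinarith [mem_cdisc.1 hz, norm_nonneg z]) (jac_pos ha hz).le

lemma eta_le_one {z : ℂ} (hz : z ∈ cdisc) : eta a z ≤ 1 := by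
  rw [eta_eq ha hz]; linarith [sq_nonneg ‖mob a z‖]

lemma continuousOn_mobField : ContinuousOn (mobField a) cdisc := fun _ hz =>
  (((hasDerivAt_mob ha hz).continuousAt).mul
    (Complex.continuous_conj.continuousAt.comp
      (hasDerivAt_mobDeriv ha hz).continuousAt)).continuousWithinAt

lemma hasDiv_mobField : HasDiv (mobField a) (fun z => 2 * jac a z ^ 2) :=
  ⟨continuousOn_mobField ha, continuousOn_const.mul ((continuousOn_jac ha).pow 2), fun z hz => by
    have h1 := (hasDerivAt_mob ha (odisc_subset_cdisc hz)).hasFDerivAt.restrictScalars ℝ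
    have h2 := (hasDerivAt_mobDeriv ha (odisc_subset_cdisc hz)).hasFDerivAt.restrictScalars ℝ
    refine ⟨_, h1.mul (Complex.conjCLE.toContinuousLinearMap.hasFDerivAt.comp z h2), ?_⟩
    rw [← norm_mobDeriv ha, Complex.sq_norm, Complex.normSq_apply]
    simp
    ring⟩

lemma isGrad_eta : IsGrad (eta a) (fun z => (-2 : ℝ) * mobField a z) := by
  have hre : ∀ z, 1 - ‖mob a z‖ ^ 2 = 1 - ((mob a z).re * (mob a z).re +
      (mob a z).im * (mob a z).im) := fun z => by rw [Complex.sq_norm, Complex.normSq_apply]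
  have hc : ContinuousOn (mob a) cdisc := fun z hz =>
    (hasDerivAt_mob ha hz).continuousAt.continuousWithinAt
  refine IsGrad.congr (u := fun z => 1 - ((mob a z).re * (mob a z).re +
      (mob a z).im * (mob a z).im)) ⟨?_, continuousOn_const.mul (continuousOn_mobField ha), ?_⟩
    (fun z hz => by rw [eta_eq ha hz, hre]) (fun _ _ => rfl)
  · fun_prop
  · intro z hz
    have h1 := (hasDerivAt_mob ha (odisc_subset_cdisc hz)).hasFDerivAt.restrictScalars ℝ
    have h2 := Complex.reCLM.hasFDerivAt.comp z h1
    have h3 := Complex.imCLM.hasFDerivAt.comp z h1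
    refine (((h2.mul h2).add (h3.mul h3)).const_sub 1).congr_fderiv ?_
    ext
    simp [dotL, mobField]
    ring

lemma dot_mobField_self {z : ℂ} (hz : z ∈ cdisc) :
    dot (mobField a z) (mobField a z) = (1 - eta a z) * jac a z ^ 2 := by
  rw [dot_self, mobField, norm_mul, RCLike.norm_conj, norm_mobDeriv ha, eta_eq ha hz]
  ring

lemma dot_mobField {z : ℂ} (hz : z ∈ bdry) : dot z (mobField a z) = jac a z := by
  have hd := mobDen_ne_zero ha (bdry_subset_cdisc hz)
  have hd' : conj (mobDen a z) ≠ 0 := by simpa using hd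
  have hz1 : z * conj z = 1 := by rw [Complex.mul_conj', mem_bdry.1 hz]; simp
  have h1 : conj z * mobField a z = jac a z := by
    rw [mobField, mob, mobDeriv, jac]
    push_cast
    rw [← Complex.mul_conj' (mobDen a z)]
    simp only [map_div₀, map_pow, map_sub, map_one, Complex.conj_ofReal]
    have h2 : conj z * (z - a) = conj (mobDen a z) := by
      simp [mobDen]; linear_combination hz1
    field_simp
    linear_combination (1 - (‖a‖ : ℂ) ^ 2) * h2
  have h3 : dot z (mobField a z) = (conj z * mobField a z).re := by simp [dot]
  rw [h3, h1, Complex.ofReal_re]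

lemma jac_self : jac a a = (1 - ‖a‖ ^ 2)⁻¹ := by
  have h := one_sub_norm_sq_pos ha
  have : mobDen a a = ((1 - ‖a‖ ^ 2 : ℝ) : ℂ) := by
    rw [mobDen, mul_comm, Complex.mul_conj']; push_cast; ring
  rw [jac, this, Complex.norm_real, Real.norm_of_nonneg h.le]
  field_simp

lemma poisson_re {h h' : ℂ → ℂ} (hh : ∀ z ∈ cdisc, HasDerivAt h (h' z) z) :
    circInt (fun z => (h z).re * jac a z) = 2 * π * (h a).re := by
  have hd : DiffContOnCl ℂ h (ball 0 1) := by
    refine DifferentiableOn.diffContOnCl fun z hz => ?_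
    rw [closure_ball 0 one_ne_zero] at hz
    exact (hh z hz).differentiableAt.differentiableWithinAt
  have key := hd.circleAverage_poissonKernel_smul (w := a) ha
  rw [Real.circleAverage_def] at key
  have hP : ∀ θ, poissonKernel 0 a (bpt θ) = jac a (bpt θ) := by
    intro θ
    rw [poissonKernel_def, jac]
    simp only [sub_zero, norm_bpt, one_pow]
    congr 2
    have hz1 : bpt θ * conj (bpt θ) = 1 := by rw [Complex.mul_conj', norm_bpt]; simp
    have : bpt θ - a = bpt θ * conj (mobDen a (bpt θ)) := by
      simp [mobDen]; linear_combination (a) * hz1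
    rw [this, norm_mul, norm_bpt, RCLike.norm_conj, one_mul]
  have hmap : ∀ θ, circleMap 0 1 θ = bpt θ := fun θ => by simp [circleMap, bpt]
  have hc : Continuous fun θ => (jac a (bpt θ) : ℂ) * h (bpt θ) := by
    refine (Complex.continuous_ofReal.comp ?_).mul ?_
    · exact continuous_comp_bpt ((continuousOn_jac ha).mono bdry_subset_cdisc)
    · have : ContinuousOn h cdisc := fun z hz => (hh z hz).continuousAt.continuousWithinAt
      exact this.comp_continuous continuous_bpt bpt_mem_cdisc
  have e : circInt (fun z => (h z).re * jac a z) =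
      (∫ θ in (0:ℝ)..2 * π, (jac a (bpt θ) : ℂ) * h (bpt θ)).re := by
    have := Complex.reCLM.intervalIntegral_comp_comm (hc.intervalIntegrable (μ := volume) 0 (2 * π))
    simp only [Complex.reCLM_apply] at this
    rw [← this]
    simp [circInt, mul_comm]
  simp only [hmap, Pi.smul_apply', hP, Complex.real_smul] at key
  rw [e, ← key]
  simp
  field_simp

end Mobius

/-- The Dirichlet integral of a vector field. -/
def dirich (g : ℂ → ℂ) : ℝ := ballInt fun z => dot (g z) (g z)

/-- The conformal energy `½∫|∇u|² + ∫_{∂B} u`. -/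
def confEnergy (u : ℂ → ℝ) (g : ℂ → ℂ) : ℝ := dirich g / 2 + circInt u

lemma dirich_nonneg (g : ℂ → ℂ) : 0 ≤ dirich g :=
  ballInt_nonneg fun z _ => by rw [dot_self]; positivity

lemma dirich_sub {g h : ℂ → ℂ} (hg : ContinuousOn g cdisc) (hh : ContinuousOn h cdisc) :
    dirich (fun z => g z - h z) =
      dirich g - 2 * ballInt (fun z => dot (g z) (h z)) + dirich h := by
  unfold dirich
  have hgg := hg.dot hg
  have hgh := hg.dot hh
  rw [← ballInt_const_mul, ← ballInt_sub hgg (by fun_prop), ← ballInt_add (by fun_prop) (hh.dot hh)]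
  congr 1
  ext z
  rw [dot_sub_left, dot_sub_right, dot_sub_right, dot_comm (h z) (g z)]
  ring

lemma two_mul_dot_le (x y : ℂ) : 2 * dot x y ≤ dot x x + dot y y := by
  have h : 0 ≤ dot (x - y) (x - y) := by rw [dot_self]; positivity
  rw [dot_sub_left, dot_sub_right, dot_sub_right, dot_comm y x] at h
  linarith

section Mobius

variable {a : ℂ} (ha : a ∈ odisc)
include ha

lemma circInt_jac : circInt (jac a) = 2 * π := by
  have := poisson_re ha (h := fun _ => 1) (h' := fun _ => 0) fun z _ => hasDerivAt_const z 1
  simpa using this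

lemma circInt_psi_mul_jac : circInt (fun z => psi a z * jac a z) = -(2 * π * Real.log (1 - ‖a‖ ^ 2)) := by
  have := poisson_re ha fun z hz => hasDerivAt_psiC ha hz
  rw [← psi_eq ha (odisc_subset_cdisc ha), psi, jac_self ha, Real.log_inv] at this
  rw [circInt_congr (ψ := fun z => psi a z * jac a z)
    fun z hz => by rw [psi_eq ha (bdry_subset_cdisc hz)]] at this
  rw [this]; ring

lemma circInt_psi : circInt (psi a) = 2 * π * Real.log (1 - ‖a‖ ^ 2) := by
  have h0 : (0 : ℂ) ∈ odisc := by simp [mem_odisc]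
  have := poisson_re h0 fun z hz => hasDerivAt_psiC ha hz
  rw [← psi_eq ha (odisc_subset_cdisc h0)] at this
  have hj : ∀ z, jac 0 z = 1 := by simp [jac, mobDen]
  simp only [hj, mul_one] at this
  rw [circInt_congr (ψ := psi a) fun z hz => by rw [psi_eq ha (bdry_subset_cdisc hz)]] at this
  rw [this]
  simp [psi, jac, mobDen]

lemma ballInt_dot_gradPsi {u : ℂ → ℝ} {g : ℂ → ℂ} (hu : IsGrad u g) :
    ballInt (fun z => dot (g z) (gradPsi a z)) = circInt (fun z => u z * jac a z) - circInt u := by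
  have h := green hu (hasDiv_gradPsi ha)
  have hc := hu.cont.mono bdry_subset_cdisc
  have hj := (continuousOn_jac ha).mono bdry_subset_cdisc
  simp only [mul_zero, ballInt_const, add_zero] at h
  rw [h, ← circInt_sub (by fun_prop) hc]
  exact circInt_congr fun z hz => by rw [dot_gradPsi ha hz]; ring

lemma dirich_sub_gradPsi {u : ℂ → ℝ} {g : ℂ → ℂ} (hu : IsGrad u g) :
    confEnergy u g = dirich (fun z => g z - gradPsi a z) / 2 + circInt (fun z => u z * jac a z) +
      2 * π * Real.log (1 - ‖a‖ ^ 2) := by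
  have h1 := ballInt_dot_gradPsi ha (isGrad_psi ha)
  rw [circInt_psi_mul_jac ha, circInt_psi ha] at h1
  rw [dirich_sub hu.contGrad (isGrad_psi ha).contGrad, ballInt_dot_gradPsi ha hu, confEnergy,
    show dirich (gradPsi a) = _ from h1]
  ring

lemma ballInt_jac_sq : ballInt (fun z => jac a z ^ 2) = π := by
  have h := (hasDiv_mobField ha).ballInt_eq
  rw [ballInt_const_mul, circInt_congr fun z hz => dot_mobField ha hz, circInt_jac ha] at h
  linarith

/-- Lower bound for the boundary length by Jensen's inequality. -/
lemma circInt_exp_ge {u : ℂ → ℝ} (hu : ContinuousOn u bdry) :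
    2 * π * Real.exp (circInt (fun z => u z * jac a z) / (2 * π) + Real.log (1 - ‖a‖ ^ 2)) ≤
      circInt fun z => Real.exp (u z) := by
  set c := circInt (fun z => u z * jac a z) / (2 * π) + Real.log (1 - ‖a‖ ^ 2) with hc
  have hj := (continuousOn_jac ha).mono bdry_subset_cdisc
  have hψ := (isGrad_psi ha).cont.mono bdry_subset_cdisc
  have h1 : circInt (fun z => Real.exp c * ((1 - c) * jac a z +
      (u z * jac a z - psi a z * jac a z))) ≤ circInt fun z => Real.exp (u z) := by
    refine circInt_mono (by fun_prop) (by fun_prop) fun z hz => ?_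
    have h2 := Real.add_one_le_exp (u z - psi a z - c)
    have h3 : Real.exp (u z) = Real.exp c * (jac a z * Real.exp (u z - psi a z - c)) := by
      rw [← exp_psi ha (bdry_subset_cdisc hz), ← Real.exp_add, ← Real.exp_add]; congr 1; ring
    rw [h3]
    have := jac_pos ha (bdry_subset_cdisc hz)
    gcongr
    calc _ = jac a z * (u z - psi a z - c + 1) := by ring
      _ ≤ _ := by gcongr
  rw [circInt_const_mul, circInt_add (by fun_prop) (by fun_prop), circInt_const_mul, circInt_sub
    (by fun_prop) (by fun_prop), circInt_psi_mul_jac ha, circInt_jac ha] at h1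
  refine le_trans (le_of_eq ?_) h1
  have : circInt (fun z => u z * jac a z) = 2 * π * (c - Real.log (1 - ‖a‖ ^ 2)) := by
    rw [hc]; field_simp; ring
  rw [this]; ring

/-- Lower bound for the area by Jensen's inequality. -/
lemma ballInt_exp_ge {u : ℂ → ℝ} {g : ℂ → ℂ} (hu : IsGrad u g) :
    π * Real.exp (2 * (circInt (fun z => u z * jac a z) / (2 * π) + Real.log (1 - ‖a‖ ^ 2)) -
      (dirich (fun z => g z - gradPsi a z) + π) / (2 * π)) ≤
      ballInt fun z => Real.exp (2 * u z) := by
  have hj := continuousOn_jac ha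
  have hψ := isGrad_psi ha
  have huc := hu.cont
  have hψc := hψ.cont
  have hw := hu.sub hψ
  have hgc := hw.contGrad
  have hVc := continuousOn_mobField ha
  have hG := green hw (hasDiv_mobField ha)
  set D := dirich (fun z => g z - gradPsi a z) with hD
  set X := ballInt (fun z => (u z - psi a z) * jac a z ^ 2) with hX
  have e1 : ballInt (fun z => (u z - psi a z) * (2 * jac a z ^ 2)) = 2 * X := by
    rw [hX, ← ballInt_const_mul]; congr 1; ext z; ring
  have e2 : (circInt fun z => (u z - psi a z) * dot z (mobField a z)) =
      circInt (fun z => u z * jac a z) + 2 * π * Real.log (1 - ‖a‖ ^ 2) := by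
    have := circInt_psi_mul_jac ha
    rw [← sub_neg_eq_add, ← this, ← circInt_sub]
    · exact circInt_congr fun z hz => by rw [dot_mobField ha hz]; ring
    · exact (huc.mul hj).mono bdry_subset_cdisc
    · exact (hψc.mul hj).mono bdry_subset_cdisc
  have e3 : ballInt (fun z => dot (g z - gradPsi a z) (mobField a z)) ≤ (D + π) / 2 := by
    have : ballInt (fun z => (1/2) * (dot (g z - gradPsi a z) (g z - gradPsi a z) + jac a z ^ 2)) =
        (D + π) / 2 := by
      rw [ballInt_const_mul, ballInt_add (hgc.dot hgc) (by fun_prop), ballInt_jac_sq ha, hD]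
      unfold dirich; ring
    rw [← this]
    refine ballInt_mono (hgc.dot hVc) (continuousOn_const.mul ((hgc.dot hgc).add (hj.pow 2)))
      fun z hz => ?_
    have h1 := dot_mobField_self ha (odisc_subset_cdisc hz)
    have h2 := eta_nonneg ha (odisc_subset_cdisc hz)
    have h3 : dot (mobField a z) (mobField a z) ≤ jac a z ^ 2 := by
      rw [h1]; nlinarith [sq_nonneg (jac a z)]
    linarith [two_mul_dot_le (g z - gradPsi a z) (mobField a z)]
  rw [e1, e2] at hG
  set c := 2 / π * X with hc
  have hcX : X = π / 2 * c := by rw [hc]; field_simp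
  have h1 : ballInt (fun z => Real.exp c * ((1 - c) * jac a z ^ 2 +
      2 * ((u z - psi a z) * jac a z ^ 2))) ≤ ballInt fun z => Real.exp (2 * u z) := by
    refine ballInt_mono (by fun_prop) (by fun_prop) fun z hz => ?_
    have h2 := Real.add_one_le_exp (2 * (u z - psi a z) - c)
    have h3 : Real.exp (2 * u z) = Real.exp c * (jac a z ^ 2 *
        Real.exp (2 * (u z - psi a z) - c)) := by
      rw [← exp_psi ha (odisc_subset_cdisc hz), ← Real.exp_nat_mul, ← Real.exp_add,
        ← Real.exp_add]
      congr 1; push_cast; ring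
    rw [h3]
    gcongr
    calc _ = jac a z ^ 2 * (2 * (u z - psi a z) - c + 1) := by ring
      _ ≤ _ := by gcongr
  rw [ballInt_const_mul, ballInt_add (by fun_prop) (by fun_prop), ballInt_const_mul,
    ballInt_const_mul, ballInt_jac_sq ha, ← hX, hcX] at h1
  refine le_trans ?_ h1
  have h5 : Real.exp c * ((1 - c) * π + 2 * (π / 2 * c)) = π * Real.exp c := by ring
  rw [h5]
  gcongr
  have hpi := Real.pi_pos
  rw [hc]
  have h6 : 2 / π * X = (2 * X) / π := by ring
  rw [h6, le_div_iff₀ hpi]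
  have h7 : (2 * (circInt (fun z => u z * jac a z) / (2 * π) + Real.log (1 - ‖a‖ ^ 2)) -
      (D + π) / (2 * π)) * π = circInt (fun z => u z * jac a z) + 2 * π * Real.log (1 - ‖a‖ ^ 2) -
        (D + π) / 2 := by field_simp
  rw [h7]
  linarith

/-- Comparison with a harmonic function `Q` on the disc, in the gauge `a`. -/
structure Gauge (a : ℂ) (Q : ℂ → ℝ) (gQ : ℂ → ℂ) (s : ℝ) : Prop where
  grad : IsGrad Q gQ
  div : HasDiv gQ (fun _ => 0)
  le : ∀ z ∈ cdisc, (1 - ‖z‖ ^ 2) * Real.exp (Q z) ≤ s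

namespace Gauge

variable {Q : ℂ → ℝ} {gQ : ℂ → ℂ} {s : ℝ} (hQ : Gauge a Q gQ s)
include hQ

omit ha in
lemma nonneg : 0 ≤ s := by
  refine le_trans ?_ (hQ.le 0 (by simp [mem_cdisc]))
  simp; positivity

lemma eta_mul_exp_le {z : ℂ} (hz : z ∈ cdisc) :
    eta a z * Real.exp (Q z - psi a z) ≤ s := by
  refine le_trans (le_of_eq ?_) (hQ.le z hz)
  rw [Real.exp_sub, exp_psi ha hz, eta]
  have := (jac_pos ha hz).ne'
  field_simp

lemma two_mul_circInt_exp_le :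
    2 * circInt (fun z => Real.exp (Q z)) ≤
      3 / 2 * s * dirich (fun z => gQ z - gradPsi a z) + 8 * π * s := by
  have hw := hQ.grad.sub (isGrad_psi ha)
  have hwd : HasDiv (fun z => gQ z - gradPsi a z) fun _ => 0 :=
    (hQ.div.sub (hasDiv_gradPsi ha)).congr (fun _ _ => rfl) (fun _ _ => by simp)
  have hη := isGrad_eta ha
  set G := fun z => gQ z - gradPsi a z with hGdef
  set w := fun z => Q z - psi a z with hwdef
  have hF := hw.exp
  have hp := hη.comp (φ := fun x => x + x ^ 2 / 2) (φ' := fun x => 1 + x) (fun x => by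
    refine ((hasDerivAt_id x).add ((hasDerivAt_pow 2 x).div_const 2)).congr_deriv ?_
    simp) (by fun_prop)
  have hV : HasDiv (fun z => ((1 + eta a z : ℝ) : ℂ) * ((-2 : ℝ) * mobField a z))
      (fun z => -8 * eta a z * jac a z ^ 2) := by
    refine (HasDiv.smul ((IsGrad.const 1).add hη) ((hasDiv_mobField ha).const_mul (-2))).congr
      (fun _ _ => rfl) fun z hz => ?_
    simp only [zero_add, dot_smul_left, dot_smul_right, dot_mobField_self ha hz]
    ring
  have g1 := green (hp.mul hF) hwd
  have g2 := green hF hV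
  have hbd : (circInt fun z => (eta a z + eta a z ^ 2 / 2) * Real.exp (w z) * dot z (G z)) = 0 := by
    rw [circInt_congr (ψ := fun _ => 0) fun z hz => by simp [eta_bdry a hz], circInt_const, mul_zero]
  have hjc := continuousOn_jac ha
  have hbd2 : (circInt fun z => Real.exp (w z) *
      dot z (((1 + eta a z : ℝ) : ℂ) * ((-2 : ℝ) * mobField a z))) =
      -2 * circInt (fun z => Real.exp (Q z)) := by
    rw [← circInt_const_mul]
    refine circInt_congr fun z hz => ?_
    have hz' := bdry_subset_cdisc hz
    have hj := (jac_pos ha hz').ne'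
    rw [dot_smul_right, dot_smul_right, dot_mobField ha hz, eta_bdry a hz, hwdef]
    simp only []
    rw [Real.exp_sub, exp_psi ha hz']
    field_simp
    ring
  rw [hbd] at g1
  rw [hbd2] at g2
  simp only [mul_zero, ballInt_const, add_zero] at g1
  have hηc := hη.cont
  have hwc : ContinuousOn w cdisc := hw.cont
  have hGG := hw.contGrad.dot hw.contGrad
  have hFV : ContinuousOn (fun z => dot (((Real.exp (w z) : ℝ) : ℂ) * G z)
      (((1 + eta a z : ℝ) : ℂ) * ((-2 : ℝ) * mobField a z))) cdisc := hF.contGrad.dot hV.cont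
  have g1' : ballInt (fun z => (eta a z + eta a z ^ 2 / 2) * Real.exp (w z) * dot (G z) (G z)) +
      ballInt (fun z => dot (((Real.exp (w z) : ℝ) : ℂ) * G z)
      (((1 + eta a z : ℝ) : ℂ) * ((-2 : ℝ) * mobField a z))) = 0 := by
    rw [← g1, ← ballInt_add (by fun_prop) hFV]
    congr 1
    ext z
    simp only [dot_smul_left, dot_smul_right, dot_add_left]
    rw [dot_comm (mobField a z)]
    ring
  have b1 : ballInt (fun z => (eta a z + eta a z ^ 2 / 2) * Real.exp (w z) * dot (G z) (G z)) ≤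
      3 / 2 * s * dirich G := by
    unfold dirich
    rw [← ballInt_const_mul]
    refine ballInt_mono (by fun_prop) (by fun_prop) fun z hz => ?_
    have hz' := odisc_subset_cdisc hz
    have h1 := hQ.eta_mul_exp_le ha hz'
    have h2 := eta_le_one ha hz'
    have h3 := eta_nonneg ha hz'
    have h4 : 0 ≤ dot (G z) (G z) := by rw [dot_self]; positivity
    have h5 : (eta a z + eta a z ^ 2 / 2) * Real.exp (w z) =
        (1 + eta a z / 2) * (eta a z * Real.exp (w z)) := by ring
    rw [h5]
    have h6 : 0 ≤ eta a z * Real.exp (w z) := by positivity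
    refine mul_le_mul_of_nonneg_right ?_ h4
    nlinarith [hQ.nonneg]
  have b2 : -ballInt (fun z => Real.exp (w z) * (-8 * eta a z * jac a z ^ 2)) ≤ 8 * π * s := by
    have : 8 * π * s = ballInt (fun z => 8 * s * jac a z ^ 2) := by
      rw [ballInt_const_mul, ballInt_jac_sq ha]; ring
    rw [this, neg_le, ← neg_one_mul, ← ballInt_const_mul]
    refine ballInt_mono (by fun_prop) (by fun_prop) fun z hz => ?_
    have h1 := hQ.eta_mul_exp_le ha (odisc_subset_cdisc hz)
    have : eta a z * Real.exp (w z) * jac a z ^ 2 ≤ s * jac a z ^ 2 := by gcongr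
    linarith
  linarith

lemma eight_mul_ballInt_exp_le :
    8 * ballInt (fun z => Real.exp (2 * Q z)) ≤
      20 / 3 * s ^ 2 * dirich (fun z => gQ z - gradPsi a z) + 24 * π * s ^ 2 := by
  have hw := hQ.grad.sub (isGrad_psi ha)
  have hwd : HasDiv (fun z => gQ z - gradPsi a z) fun _ => 0 :=
    (hQ.div.sub (hasDiv_gradPsi ha)).congr (fun _ _ => rfl) (fun _ _ => by simp)
  have hη := isGrad_eta ha
  set G := fun z => gQ z - gradPsi a z with hGdef
  set w := fun z => Q z - psi a z with hwdef
  have hF := (hw.const_mul 2).exp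
  have hp := hη.comp (φ := fun x => x ^ 2 + 2 / 3 * x ^ 3) (φ' := fun x => 2 * x + 2 * x ^ 2)
    (fun x => by
      refine ((hasDerivAt_pow 2 x).add ((hasDerivAt_pow 3 x).const_mul (2 / 3))).congr_deriv ?_
      simp; ring) (by fun_prop)
  have hq := hη.comp (φ := fun x => 2 * x + 2 * x ^ 2) (φ' := fun x => 2 + 4 * x)
    (fun x => by
      refine (((hasDerivAt_id x).const_mul 2).add
        ((hasDerivAt_pow 2 x).const_mul 2)).congr_deriv ?_
      simp; ring) (by fun_prop)
  have hV : HasDiv (fun z => ((2 * eta a z + 2 * eta a z ^ 2 : ℝ) : ℂ) * ((-2 : ℝ) * mobField a z))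
      (fun z => (8 - 24 * eta a z ^ 2) * jac a z ^ 2) := by
    refine (HasDiv.smul hq ((hasDiv_mobField ha).const_mul (-2))).congr
      (fun _ _ => rfl) fun z hz => ?_
    simp only [dot_smul_left, dot_smul_right, dot_mobField_self ha hz]
    ring
  have g1 := green (hp.mul hF) hwd
  have g2 := green hF hV
  have hbd : (circInt fun z => (eta a z ^ 2 + 2 / 3 * eta a z ^ 3) * Real.exp (2 * w z) *
      dot z (G z)) = 0 := by
    rw [circInt_congr (ψ := fun _ => 0) fun z hz => by simp [eta_bdry a hz], circInt_const, mul_zero]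
  have hjc := continuousOn_jac ha
  have hbd2 : (circInt fun z => Real.exp (2 * w z) *
      dot z (((2 * eta a z + 2 * eta a z ^ 2 : ℝ) : ℂ) * ((-2 : ℝ) * mobField a z))) = 0 := by
    rw [circInt_congr (ψ := fun _ => 0) fun z hz => by simp [eta_bdry a hz, dot], circInt_const,
      mul_zero]
  rw [hbd] at g1
  rw [hbd2] at g2
  simp only [mul_zero, ballInt_const, add_zero] at g1
  have hηc := hη.cont
  have hwc : ContinuousOn w cdisc := hw.cont
  have hQc := hQ.grad.cont
  have hGG := hw.contGrad.dot hw.contGrad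
  have hFV : ContinuousOn (fun z => dot (((Real.exp (2 * w z) : ℝ) : ℂ) * ((2 : ℝ) * G z))
      (((2 * eta a z + 2 * eta a z ^ 2 : ℝ) : ℂ) * ((-2 : ℝ) * mobField a z))) cdisc :=
    hF.contGrad.dot hV.cont
  set Y := ballInt (fun z => dot (((Real.exp (2 * w z) : ℝ) : ℂ) * ((2 : ℝ) * G z))
      (((2 * eta a z + 2 * eta a z ^ 2 : ℝ) : ℂ) * ((-2 : ℝ) * mobField a z)))
  have g1' : ballInt (fun z => 4 * ((eta a z ^ 2 + 2 / 3 * eta a z ^ 3) * Real.exp (2 * w z) *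
      dot (G z) (G z))) + Y = 0 := by
    have h0 : 2 * (0:ℝ) = 0 := mul_zero 2
    rw [← h0, ← g1, ← ballInt_const_mul, ← ballInt_add (by fun_prop) hFV]
    congr 1
    ext z
    simp only [dot_smul_left, dot_smul_right, dot_add_left]
    rw [dot_comm (mobField a z)]
    ring
  have b1 : ballInt (fun z => 4 * ((eta a z ^ 2 + 2 / 3 * eta a z ^ 3) * Real.exp (2 * w z) *
      dot (G z) (G z))) ≤ 20 / 3 * s ^ 2 * dirich G := by
    unfold dirich
    rw [← ballInt_const_mul]
    refine ballInt_mono (by fun_prop) (by fun_prop) fun z hz => ?_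
    have hz' := odisc_subset_cdisc hz
    have h1 := hQ.eta_mul_exp_le ha hz'
    have h2 := eta_le_one ha hz'
    have h3 := eta_nonneg ha hz'
    have h4 : 0 ≤ dot (G z) (G z) := by rw [dot_self]; positivity
    have h6 : 0 ≤ eta a z * Real.exp (w z) := by positivity
    have h7 : (eta a z * Real.exp (w z)) ^ 2 ≤ s ^ 2 := by gcongr
    have h5 : 4 * ((eta a z ^ 2 + 2 / 3 * eta a z ^ 3) * Real.exp (2 * w z)) =
        (4 + 8 / 3 * eta a z) * (eta a z * Real.exp (w z)) ^ 2 := by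
      rw [mul_pow, ← Real.exp_nat_mul]; push_cast; ring
    rw [← mul_assoc, h5]
    gcongr
    nlinarith [sq_nonneg s, sq_nonneg (eta a z * Real.exp (w z))]
  have b2 : 8 * ballInt (fun z => Real.exp (2 * Q z)) - 24 * π * s ^ 2 ≤
      ballInt (fun z => Real.exp (2 * w z) * ((8 - 24 * eta a z ^ 2) * jac a z ^ 2)) := by
    have : 24 * π * s ^ 2 = ballInt (fun z => 24 * s ^ 2 * jac a z ^ 2) := by
      rw [ballInt_const_mul, ballInt_jac_sq ha]; ring
    rw [this, ← ballInt_const_mul, ← ballInt_sub (by fun_prop) (by fun_prop)]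
    refine ballInt_mono (by fun_prop) (by fun_prop) fun z hz => ?_
    have hz' := odisc_subset_cdisc hz
    have h1 := hQ.eta_mul_exp_le ha hz'
    have h3 := eta_nonneg ha hz'
    have h6 : 0 ≤ eta a z * Real.exp (w z) := by positivity
    have h7 : (eta a z * Real.exp (w z)) ^ 2 ≤ s ^ 2 := by gcongr
    have h8 : Real.exp (2 * w z) * jac a z ^ 2 = Real.exp (2 * Q z) := by
      rw [← exp_psi ha hz', ← Real.exp_nat_mul, ← Real.exp_add]
      congr 1; push_cast; ring
    have h9 : (eta a z * Real.exp (w z)) ^ 2 = eta a z ^ 2 * Real.exp (2 * w z) := by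
      rw [mul_pow, ← Real.exp_nat_mul]; push_cast; ring
    rw [h9] at h7
    have h10 := mul_le_mul_of_nonneg_right h7 (sq_nonneg (jac a z))
    rw [← h8]
    linarith
  linarith

/-- Almost orthogonality of `∇u - ∇Q` and `∇Q - ∇ψ`. -/
lemma dirich_add_le {u : ℂ → ℝ} {g : ℂ → ℂ} (hu : IsGrad u g)
    (hclose : ∀ z ∈ bdry, |u z - Q z| ≤ 1) (horth : circInt (fun z => (u z - Q z) * dot z (gQ z)) = 0) :
    dirich (fun z => g z - gQ z) + dirich (fun z => gQ z - gradPsi a z) ≤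
      dirich (fun z => g z - gradPsi a z) + 8 * π := by
  have hv := hu.sub hQ.grad
  have hψ := isGrad_psi ha
  have hwd : HasDiv (fun z => gradPsi a z - gQ z) fun _ => 0 :=
    ((hasDiv_gradPsi ha).sub hQ.div).congr (fun _ _ => rfl) (fun _ _ => by simp)
  have h1 := green hv hwd
  simp only [mul_zero, ballInt_const, add_zero] at h1
  have h2 := dirich_sub hv.contGrad hwd.cont
  have h3 : dirich (fun z => gradPsi a z - gQ z) = dirich (fun z => gQ z - gradPsi a z) := by
    unfold dirich; congr 1; ext z; simp [dot]; ring
  have h4 : (fun z => g z - gQ z - (gradPsi a z - gQ z)) = fun z => g z - gradPsi a z := by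
    ext z; ring
  rw [h4, h3, h1] at h2
  have huc := hu.cont.mono bdry_subset_cdisc
  have hQc := hQ.grad.cont.mono bdry_subset_cdisc
  have hjc := (continuousOn_jac ha).mono bdry_subset_cdisc
  have hnc : ContinuousOn (fun z => dot z (gQ z)) bdry :=
    continuousOn_id.dot (hQ.grad.contGrad.mono bdry_subset_cdisc)
  have h5 : (circInt fun z => (u z - Q z) * dot z (gradPsi a z - gQ z)) ≤ 4 * π := by
    have e : (circInt fun z => (u z - Q z) * dot z (gradPsi a z - gQ z)) =
        circInt (fun z => (u z - Q z) * (jac a z - 1)) := by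
      rw [← sub_zero (circInt fun z => (u z - Q z) * (jac a z - 1)), ← horth,
        ← circInt_sub (by fun_prop) (by fun_prop)]
      exact circInt_congr fun z hz => by rw [dot_sub_right, dot_gradPsi ha hz]; ring
    have e2 : 4 * π = circInt (fun z => jac a z + 1) := by
      rw [circInt_add hjc continuousOn_const, circInt_jac ha, circInt_const]; ring
    rw [e, e2]
    refine circInt_mono (by fun_prop) (by fun_prop) fun z hz => ?_
    have h6 := abs_le.1 (hclose z hz)
    have h7 := jac_pos ha (bdry_subset_cdisc hz)
    nlinarith
  linarith

end Gauge

end Mobius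

lemma IsGrad.comp_pos {u : ℂ → ℝ} {g : ℂ → ℂ} {φ φ' : ℝ → ℝ}
    (hφ : ∀ x, 0 < x → HasDerivAt φ (φ' x) x)
    (hφ' : ContinuousOn φ' (Ioi 0)) (hu : IsGrad u g) (hpos : ∀ z ∈ cdisc, 0 < u z) :
    IsGrad (fun z => φ (u z)) (fun z => φ' (u z) * g z) :=
  ⟨fun z hz => ((hφ _ (hpos z hz)).continuousAt.comp_continuousWithinAt (hu.cont z hz)),
    (Complex.continuous_ofReal.comp_continuousOn (hφ'.comp hu.cont hpos)).mul hu.contGrad,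
    fun z hz => by
      rw [dotL_smul]
      exact (hφ (u z) (hpos z (odisc_subset_cdisc hz))).comp_hasFDerivAt z (hu.deriv z hz)⟩

/-- The regularised squared modulus of an affine function. -/
def quad (δ : ℝ) (c d y : ℂ) : ℝ := ‖c * y + d‖ ^ 2 + δ ^ 2

lemma quad_pos {δ : ℝ} (hδ : 0 < δ) (c d y : ℂ) : 0 < quad δ c d y := by unfold quad; positivity

lemma isGrad_quad (δ : ℝ) (c d : ℂ) :
    IsGrad (quad δ c d) (fun y => ((2 : ℝ) : ℂ) * (conj c * (c * y + d))) := by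
  refine ⟨by unfold quad; fun_prop, by fun_prop, fun z _ => ?_⟩
  have h1 : HasDerivAt (fun y => c * y + d) c z := by
    simpa using ((hasDerivAt_id z).const_mul c).add_const d
  have h2 := (h1.hasFDerivAt.restrictScalars ℝ).norm_sq.add_const (δ ^ 2)
  refine h2.congr_fderiv ?_
  ext
  simp [dotL, Complex.inner]
  ring

lemma hasDiv_affine (c d : ℂ) :
    HasDiv (fun y => conj c * (c * y + d)) (fun _ => 2 * ‖c‖ ^ 2) := by
  refine ⟨by fun_prop, by fun_prop, fun z _ => ?_⟩
  have h1 : HasDerivAt (fun y => conj c * (c * y + d)) (conj c * c) z := by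
    simpa using (((hasDerivAt_id z).const_mul c).add_const d).const_mul (conj c)
  refine ⟨_, h1.hasFDerivAt.restrictScalars ℝ, ?_⟩
  simp [Complex.sq_norm, Complex.normSq_apply]; ring

/-- The gradient of `log (quad δ c d)`. -/
def gradLogQuad (δ : ℝ) (c d y : ℂ) : ℂ := ((2 / quad δ c d y : ℝ) : ℂ) * (conj c * (c * y + d))

lemma isGrad_logQuad {δ : ℝ} (hδ : 0 < δ) (c d : ℂ) :
    IsGrad (fun y => Real.log (quad δ c d y)) (gradLogQuad δ c d) := by
  have h := (isGrad_quad δ c d).comp_pos (φ := Real.log) (φ' := fun x => x⁻¹)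
    (fun x hx => Real.hasDerivAt_log hx.ne')
    (continuousOn_inv₀.mono fun x hx => (ne_of_gt hx)) fun z _ => quad_pos hδ c d z
  refine h.congr (fun _ _ => rfl) fun z _ => ?_
  simp only [gradLogQuad, Complex.ofReal_div, Complex.ofReal_inv]
  ring

lemma hasDiv_gradLogQuad {δ : ℝ} (hδ : 0 < δ) (c d : ℂ) :
    HasDiv (gradLogQuad δ c d) (fun y => 4 * ‖c‖ ^ 2 * δ ^ 2 / quad δ c d y ^ 2) := by
  have h := (isGrad_quad δ c d).comp_pos (φ := fun x => 2 * x⁻¹) (φ' := fun x => 2 * (-(x ^ 2)⁻¹))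
    (fun x hx => (hasDerivAt_inv hx.ne').const_mul 2)
    (continuousOn_const.mul (((continuousOn_id.pow 2).inv₀ fun x hx =>
      pow_ne_zero 2 (ne_of_gt hx)).neg)) fun z _ => quad_pos hδ c d z
  refine (HasDiv.smul h (hasDiv_affine c d)).congr (fun z _ => ?_) fun z _ => ?_
  · simp only [gradLogQuad, div_eq_mul_inv]
  · have h1 := quad_pos hδ c d z
    have h2 : dot (conj c * (c * z + d)) (conj c * (c * z + d)) =
        ‖c‖ ^ 2 * (quad δ c d z - δ ^ 2) := by
      rw [dot_self, norm_mul, quad, RCLike.norm_conj]; ring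
    rw [dot_smul_left, dot_smul_left, h2]
    field_simp
    ring

/-- The regularised Green kernel. -/
def regK (δ : ℝ) (x y : ℂ) : ℝ :=
  1 / (4 * π) * (Real.log (quad δ (-conj x) 1 y) - Real.log (quad δ (-1) x y))

/-- The gradient of `regK` in the second variable. -/
def gradK (δ : ℝ) (x y : ℂ) : ℂ :=
  ((1 / (4 * π) : ℝ) : ℂ) * (gradLogQuad δ (-conj x) 1 y - gradLogQuad δ (-1) x y)

/-- Minus the Laplacian of `regK` in the second variable. -/
def regM (δ : ℝ) (x y : ℂ) : ℝ :=
  1 / π * (δ ^ 2 / quad δ (-1) x y ^ 2 - ‖x‖ ^ 2 * δ ^ 2 / quad δ (-conj x) 1 y ^ 2)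

/-- Minus the normal derivative of `regK` on the boundary. -/
def regN (δ : ℝ) (x y : ℂ) : ℝ := 1 / (2 * π) * ((1 - ‖x‖ ^ 2) / quad δ (-1) x y)

lemma isGrad_regK {δ : ℝ} (hδ : 0 < δ) (x : ℂ) : IsGrad (regK δ x) (gradK δ x) :=
  ((isGrad_logQuad hδ _ _).sub (isGrad_logQuad hδ _ _)).const_mul _

lemma hasDiv_gradK {δ : ℝ} (hδ : 0 < δ) (x : ℂ) :
    HasDiv (gradK δ x) (fun y => -regM δ x y) := by
  refine (((hasDiv_gradLogQuad hδ (-conj x) 1).sub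
    (hasDiv_gradLogQuad hδ (-1) x)).const_mul (1 / (4 * π))).congr (fun _ _ => rfl) fun z _ => ?_
  simp only [regM, norm_neg, RCLike.norm_conj, norm_one]
  field_simp
  ring

lemma quad_neg_one (δ : ℝ) (x y : ℂ) : quad δ (-1) x y = ‖x - y‖ ^ 2 + δ ^ 2 := by
  rw [quad]; congr 3; ring

lemma norm_sq_sub_norm_sq (x y : ℂ) :
    ‖-conj x * y + 1‖ ^ 2 = ‖x - y‖ ^ 2 + (1 - ‖x‖ ^ 2) * (1 - ‖y‖ ^ 2) := by
  simp only [Complex.sq_norm, Complex.normSq_apply]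
  simp
  ring

lemma quad_conj (δ : ℝ) (x y : ℂ) :
    quad δ (-conj x) 1 y = quad δ (-1) x y + (1 - ‖x‖ ^ 2) * (1 - ‖y‖ ^ 2) := by
  rw [quad_neg_one, quad, norm_sq_sub_norm_sq]; ring

lemma one_sub_sq_nonneg {x : ℂ} (hx : x ∈ cdisc) : 0 ≤ 1 - ‖x‖ ^ 2 := by
  rw [mem_cdisc] at hx
  nlinarith [norm_nonneg x]

lemma one_sub_sq_eq_zero {x : ℂ} (hx : x ∈ bdry) : 1 - ‖x‖ ^ 2 = 0 := by
  rw [mem_bdry] at hx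
  rw [hx]; ring

lemma quad_le_quad_conj (δ : ℝ) {x y : ℂ} (hx : x ∈ cdisc) (hy : y ∈ cdisc) :
    quad δ (-1) x y ≤ quad δ (-conj x) 1 y := by
  rw [quad_conj]
  nlinarith [mul_nonneg (one_sub_sq_nonneg hx) (one_sub_sq_nonneg hy)]

lemma regK_nonneg {δ : ℝ} (hδ : 0 < δ) {x y : ℂ} (hx : x ∈ cdisc) (hy : y ∈ cdisc) :
    0 ≤ regK δ x y := by
  have := Real.log_le_log (quad_pos hδ _ _ _) (quad_le_quad_conj δ hx hy)
  unfold regK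
  have h2 : 0 ≤ Real.log (quad δ (-conj x) 1 y) - Real.log (quad δ (-1) x y) := by linarith
  positivity

lemma regK_bdry (δ : ℝ) (x : ℂ) {y : ℂ} (hy : y ∈ bdry) : regK δ x y = 0 := by
  rw [regK, quad_conj, one_sub_sq_eq_zero hy]; simp

lemma regM_nonneg {δ : ℝ} (hδ : 0 < δ) {x y : ℂ} (hx : x ∈ cdisc) (hy : y ∈ cdisc) :
    0 ≤ regM δ x y := by
  have h1 := quad_le_quad_conj δ hx hy
  have h2 := quad_pos hδ (-1) x y
  have h3 : ‖x‖ ^ 2 ≤ 1 := by linarith [one_sub_sq_nonneg hx]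
  unfold regM
  refine mul_nonneg (by positivity) (sub_nonneg.2 ?_)
  have h4 : ‖x‖ ^ 2 * δ ^ 2 ≤ δ ^ 2 := by nlinarith [sq_nonneg δ]
  gcongr

lemma regM_le {δ : ℝ} (x y : ℂ) : regM δ x y ≤ δ ^ 2 / (‖x - y‖ ^ 2 + δ ^ 2) ^ 2 := by
  unfold regM
  rw [quad_neg_one]
  have h1 : (1 : ℝ) / π ≤ 1 := by rw [div_le_one Real.pi_pos]; linarith [Real.pi_gt_three]
  have h2 : 0 ≤ ‖x‖ ^ 2 * δ ^ 2 / quad δ (-conj x) 1 y ^ 2 := by positivity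
  have h3 : 0 ≤ δ ^ 2 / (‖x - y‖ ^ 2 + δ ^ 2) ^ 2 := by positivity
  have h4 : (0 : ℝ) < 1 / π := by positivity
  nlinarith [mul_nonneg h4.le h2]

lemma dot_gradLogQuad (δ : ℝ) (c d y : ℂ) :
    dot y (gradLogQuad δ c d y) = 2 / quad δ c d y * (c * y * conj (c * y + d)).re := by
  rw [gradLogQuad, dot_smul_right]
  congr 1
  simp [dot]; ring

lemma dot_gradK {δ : ℝ} (hδ : 0 < δ) (x : ℂ) {y : ℂ} (hy : y ∈ bdry) :
    dot y (gradK δ x y) = -regN δ x y := by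
  have h1 : quad δ (-conj x) 1 y = quad δ (-1) x y := by
    rw [quad_conj, one_sub_sq_eq_zero hy]; simp
  have h2 := quad_pos hδ (-1) x y
  have h3 : (-conj x * y * conj (-conj x * y + 1)).re - (-1 * y * conj (-1 * y + x)).re =
      ‖x‖ ^ 2 * ‖y‖ ^ 2 - ‖y‖ ^ 2 := by
    simp only [Complex.sq_norm, Complex.normSq_apply]; simp; ring
  rw [mem_bdry] at hy
  rw [hy] at h3
  rw [gradK, dot_smul_right, dot_sub_right, dot_gradLogQuad, dot_gradLogQuad, h1, ← mul_sub, h3,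
    regN]
  field_simp
  ring

lemma regN_nonneg (δ : ℝ) {x : ℂ} (hx : x ∈ cdisc) (y : ℂ) : 0 ≤ regN δ x y := by
  have := one_sub_sq_nonneg hx
  unfold regN quad
  positivity

lemma continuousOn_ballInt {X : Type*} [TopologicalSpace X] [FirstCountableTopology X]
    {K : Set X} (hK : IsCompact K) {F : X → ℂ → ℝ}
    (hF : ContinuousOn (fun p : X × ℂ => F p.1 p.2) (K ×ˢ cdisc)) :
    ContinuousOn (fun x => ballInt (F x)) K := by
  obtain ⟨C, hC⟩ := (hK.prod isCompact_cdisc).exists_bound_of_continuousOn hF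
  have hs : ∀ x ∈ K, ContinuousOn (F x) cdisc := fun x hx =>
    hF.comp (f := fun z => (x, z)) (by fun_prop) fun z hz => ⟨hx, hz⟩
  refine continuousOn_of_dominated (bound := fun _ => C)
    (fun x hx => (integrableOn_odisc (hs x hx)).aestronglyMeasurable)
    (fun x hx => ?_) (integrableOn_odisc continuousOn_const) ?_
  · filter_upwards [ae_restrict_mem measurableSet_odisc] with z hz
    exact hC (x, z) ⟨hx, odisc_subset_cdisc hz⟩
  · filter_upwards [ae_restrict_mem measurableSet_odisc] with z hz
    exact hF.comp (f := fun x => (x, z)) (by fun_prop) fun x hx => ⟨hx, odisc_subset_cdisc hz⟩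

lemma ballInt_swap {F : ℂ → ℂ → ℝ}
    (hF : ContinuousOn (fun p : ℂ × ℂ => F p.1 p.2) (cdisc ×ˢ cdisc)) :
    ballInt (fun x => ballInt (F x)) = ballInt (fun y => ballInt fun x => F x y) := by
  refine integral_integral_swap ?_
  rw [Measure.prod_restrict]
  exact (hF.integrableOn_compact (isCompact_cdisc.prod isCompact_cdisc)).mono_set
    (prod_mono odisc_subset_cdisc odisc_subset_cdisc)

lemma ContinuousOn.dot' {X : Type*} [TopologicalSpace X] {s : Set X} {f g : X → ℂ}
    (hf : ContinuousOn f s) (hg : ContinuousOn g s) :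
    ContinuousOn (fun z => _root_.dot (f z) (g z)) s := by
  unfold _root_.dot
  fun_prop

section Kernel

variable {δ : ℝ} (hδ : 0 < δ)
include hδ

lemma continuous_regK : Continuous fun p : ℂ × ℂ => regK δ p.1 p.2 := by
  have h1 : ∀ p : ℂ × ℂ, quad δ (-conj p.1) 1 p.2 ≠ 0 := fun p => (quad_pos hδ _ _ _).ne'
  have h2 : ∀ p : ℂ × ℂ, quad δ (-1) p.1 p.2 ≠ 0 := fun p => (quad_pos hδ _ _ _).ne'
  unfold regK
  unfold quad at *
  fun_prop (disch := assumption)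

lemma continuous_regM : Continuous fun p : ℂ × ℂ => regM δ p.1 p.2 := by
  have h1 : ∀ p : ℂ × ℂ, quad δ (-conj p.1) 1 p.2 ^ 2 ≠ 0 :=
    fun p => pow_ne_zero 2 (quad_pos hδ _ _ _).ne'
  have h2 : ∀ p : ℂ × ℂ, quad δ (-1) p.1 p.2 ^ 2 ≠ 0 :=
    fun p => pow_ne_zero 2 (quad_pos hδ _ _ _).ne'
  unfold regM
  unfold quad at *
  fun_prop (disch := assumption)

lemma continuous_gradK : Continuous fun p : ℂ × ℂ => gradK δ p.1 p.2 := by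
  have h1 : ∀ p : ℂ × ℂ, quad δ (-conj p.1) 1 p.2 ≠ 0 := fun p => (quad_pos hδ _ _ _).ne'
  have h2 : ∀ p : ℂ × ℂ, quad δ (-1) p.1 p.2 ≠ 0 := fun p => (quad_pos hδ _ _ _).ne'
  unfold gradK gradLogQuad
  unfold quad at *
  fun_prop (disch := assumption)

lemma continuous_regN (x : ℂ) : Continuous (regN δ x) := by
  have h2 : ∀ y : ℂ, quad δ (-1) x y ≠ 0 := fun p => (quad_pos hδ _ _ _).ne'
  unfold regN
  unfold quad at *
  fun_prop (disch := assumption)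

lemma ballInt_regM (x : ℂ) : ballInt (regM δ x) = circInt (regN δ x) := by
  have h := (hasDiv_gradK hδ x).ballInt_eq
  rw [circInt_congr fun z hz => dot_gradK hδ x hz] at h
  have h1 := ballInt_const_mul (-1) (regM δ x)
  have h2 := circInt_const_mul (-1) (regN δ x)
  simp only [neg_one_mul] at h1 h2
  linarith

lemma regN_bdry {x y : ℂ} (hx : x ∈ odisc) (hy : y ∈ bdry) :
    regN δ x y = 1 / (2 * π) * (jac x y * (1 - δ ^ 2 / quad δ (-1) x y)) := by
  have h1 := norm_sq_sub_norm_sq x y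
  rw [one_sub_sq_eq_zero hy, mul_zero, add_zero] at h1
  have h2 := quad_pos hδ (-1) x y
  have h0 : -conj x * y + 1 = 1 - conj x * y := by ring
  have h3 : 0 < ‖x - y‖ ^ 2 := by
    rw [← h1, h0]
    have := mobDen_ne_zero hx (bdry_subset_cdisc hy)
    unfold mobDen at this
    positivity
  rw [regN, jac, mobDen, ← h0, h1]
  congr 1
  rw [one_sub_div h2.ne', quad_neg_one, add_sub_cancel_right]
  rw [quad_neg_one] at h2
  have h4 := h3.ne'
  generalize ‖x - y‖ ^ 2 = r at *
  field_simp

lemma circInt_regN_le {x : ℂ} (hx : x ∈ odisc) : circInt (regN δ x) ≤ 1 := by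
  have hj := (continuousOn_jac hx).mono bdry_subset_cdisc
  have : (1 : ℝ) = circInt fun y => 1 / (2 * π) * jac x y := by
    rw [circInt_const_mul, circInt_jac hx]; field_simp
  rw [this]
  refine circInt_mono (continuous_regN hδ x).continuousOn (by fun_prop) fun y hy => ?_
  rw [regN_bdry hδ hx hy]
  have h1 := jac_pos hx (bdry_subset_cdisc hy)
  have h2 : 0 ≤ δ ^ 2 / quad δ (-1) x y := div_nonneg (sq_nonneg _) (quad_pos hδ _ _ _).le
  have h3 : jac x y * (1 - δ ^ 2 / quad δ (-1) x y) ≤ jac x y := by nlinarith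
  gcongr

lemma le_circInt_regN {x : ℂ} (hx : x ∈ odisc) :
    1 - δ ^ 2 / (1 - ‖x‖) ^ 2 ≤ circInt (regN δ x) := by
  have hj := (continuousOn_jac hx).mono bdry_subset_cdisc
  have hx1 : 0 < 1 - ‖x‖ := by rw [mem_odisc] at hx; linarith
  have : 1 - δ ^ 2 / (1 - ‖x‖) ^ 2 =
      circInt fun y => 1 / (2 * π) * ((1 - δ ^ 2 / (1 - ‖x‖) ^ 2) * jac x y) := by
    rw [circInt_const_mul, circInt_const_mul, circInt_jac hx]; field_simp
  rw [this]
  refine circInt_mono (by fun_prop) (continuous_regN hδ x).continuousOn fun y hy => ?_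
  rw [regN_bdry hδ hx hy, mul_comm (jac x y)]
  have h1 := jac_pos hx (bdry_subset_cdisc hy)
  have h2 : (1 - ‖x‖) ^ 2 ≤ quad δ (-1) x y := by
    rw [quad_neg_one]
    have h4 : 1 - ‖x‖ ≤ ‖x - y‖ := by
      rw [mem_bdry] at hy
      have := norm_sub_norm_le y x
      rw [norm_sub_rev] at this
      linarith
    nlinarith [sq_nonneg δ]
  gcongr

end Kernel

/-- The truncated singular radial profile `r ↦ r^{-3/2}`. -/
def sing (R r : ℝ) : ℝ := (Iio R).indicator (fun r => r ^ (-3 / 2 : ℝ)) r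

lemma sing_nonneg (R : ℝ) {r : ℝ} (hr : 0 ≤ r) : 0 ≤ sing R r := by
  unfold sing
  refine indicator_apply_nonneg fun _ => ?_
  positivity

lemma sing_of_lt {R r : ℝ} (h : r < R) : sing R r = r ^ (-3 / 2 : ℝ) :=
  indicator_of_mem (s := Iio R) h _

lemma sing_profile {R : ℝ} :
    EqOn (fun y : ℝ => y ^ (Module.finrank ℝ ℂ - 1) • sing R y)
      ((Ioo 0 R).indicator fun y => y ^ (-1 / 2 : ℝ)) (Ioi 0) := by
  intro y hy
  have hy : 0 < y := hy
  by_cases h : y < R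
  · have h1 : y * y ^ (-3 / 2 : ℝ) = y ^ (-1 / 2 : ℝ) := by
      rw [← Real.rpow_one_add' hy.le (by norm_num)]; norm_num
    simp [Complex.finrank_real_complex, sing_of_lt h, hy, h, h1]
  · simp [sing, h]

lemma integral_sing {R : ℝ} (hR : 0 < R) :
    Integrable (fun z : ℂ => sing R ‖z‖) ∧ ∫ z : ℂ, sing R ‖z‖ = 4 * π * R ^ (1 / 2 : ℝ) := by
  have h0 : Ioi (0 : ℝ) ∩ Ioo 0 R = Ioo 0 R := by ext; simp
  constructor
  · rw [integrable_fun_norm_addHaar volume (f := sing R),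
      integrableOn_congr_fun sing_profile measurableSet_Ioi, IntegrableOn,
      integrable_indicator_iff measurableSet_Ioo, IntegrableOn,
      Measure.restrict_restrict measurableSet_Ioo, inter_comm, h0]
    exact ((intervalIntegrable_iff_integrableOn_Ioo_of_le hR.le).1
      (intervalIntegral.intervalIntegrable_rpow' (by norm_num)))
  · rw [integral_fun_norm_addHaar volume (f := sing R),
      setIntegral_congr_fun measurableSet_Ioi sing_profile, setIntegral_indicator measurableSet_Ioo,
      h0, ← integral_Ioc_eq_integral_Ioo, ← intervalIntegral.integral_of_le hR.le,
      integral_rpow (by norm_num)]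
    have : volume.real (ball (0 : ℂ) 1) = π := volume_odisc
    rw [this, Complex.finrank_real_complex, Real.zero_rpow (by norm_num)]
    norm_num
    ring

/-- Comparison of integrals in the presence of an integrable singularity. -/
lemma ballInt_le_of_sing {φ ψ : ℂ → ℝ} (hφ : ContinuousOn φ cdisc) (hψ : ContinuousOn ψ cdisc)
    {x : ℂ} {R C : ℝ} (hR : 0 < R) (hC : 0 ≤ C)
    (h : ∀ z ∈ odisc, z ≠ x → φ z ≤ ψ z + C * sing R ‖z - x‖) :
    ballInt φ ≤ ballInt ψ + C * (4 * π * R ^ (1 / 2 : ℝ)) := by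
  obtain ⟨h1, h2⟩ := integral_sing hR
  have h3 : Integrable (fun z : ℂ => sing R ‖z - x‖) := h1.comp_sub_right x
  have h4 : ∫ z : ℂ, sing R ‖z - x‖ = 4 * π * R ^ (1 / 2 : ℝ) := by
    rw [← h2]; exact integral_sub_right_eq_self (fun z : ℂ => sing R ‖z‖) x
  have h5 : ∫ z in odisc, C * sing R ‖z - x‖ ≤ C * (4 * π * R ^ (1 / 2 : ℝ)) := by
    rw [integral_const_mul, ← h4]
    refine mul_le_mul_of_nonneg_left (setIntegral_le_integral h3 ?_) hC
    exact Eventually.of_forall fun z => sing_nonneg R (norm_nonneg _)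
  have h6 : ballInt φ ≤ ∫ z in odisc, (ψ z + C * sing R ‖z - x‖) := by
    refine integral_mono_ae (integrableOn_odisc hφ)
      ((integrableOn_odisc hψ).add (h3.const_mul C).integrableOn) ?_
    filter_upwards [ae_restrict_mem measurableSet_odisc,
      (compl_mem_ae_iff.2 (measure_singleton x) : {x}ᶜ ∈ ae (volume.restrict odisc))] with z hz hzx
    exact h z hz hzx
  rw [integral_add (integrableOn_odisc hψ) (h3.const_mul C).integrableOn] at h6
  unfold ballInt at *
  linarith

/-- Kernel average of the distance. -/
lemma ballInt_norm_mul_regM_le {δ : ℝ} (hδ : 0 < δ) {x : ℂ} (hx : x ∈ odisc) :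
    ballInt (fun y => ‖x - y‖ * regM δ x y) ≤ 8 * π * δ ^ (1 / 2 : ℝ) := by
  have hM : Continuous fun y => regM δ x y :=
    (continuous_regM hδ).comp (f := fun y => (x, y)) (by fun_prop)
  have h := ballInt_le_of_sing (φ := fun y => ‖x - y‖ * regM δ x y) (ψ := fun _ => 0) (x := x)
    (R := 4) (C := δ ^ (1 / 2 : ℝ)) (by fun_prop) continuousOn_const (by norm_num) (by positivity)
    fun y hy hyx => ?_
  · rw [ballInt_const] at h
    refine h.trans (le_of_eq ?_)
    have : (4 : ℝ) ^ (1 / 2 : ℝ) = 2 := by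
      rw [← Real.sqrt_eq_rpow]; rw [show (4 : ℝ) = 2 ^ 2 by norm_num]; simp
    rw [this]; ring
  · rw [norm_sub_rev y x]
    have hr : 0 < ‖x - y‖ := norm_pos_iff.2 (sub_ne_zero.2 (Ne.symm hyx))
    have h4 : ‖x - y‖ < 4 := by
      rw [mem_odisc] at hx hy
      linarith [norm_sub_le x y]
    rw [sing_of_lt h4, zero_add]
    have h1 := regM_le (δ := δ) x y
    set r := ‖x - y‖
    refine (mul_le_mul_of_nonneg_left h1 hr.le).trans ?_
    have h2 : r ^ (5 / 2 : ℝ) * δ ^ (3 / 2 : ℝ) ≤ (r ^ 2 + δ ^ 2) ^ 2 := by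
      have e1 : r ^ (5 / 2 : ℝ) ≤ (r ^ 2 + δ ^ 2) ^ (5 / 4 : ℝ) := by
        calc r ^ (5 / 2 : ℝ) = (r ^ 2) ^ (5 / 4 : ℝ) := by
              rw [← Real.rpow_natCast, ← Real.rpow_mul hr.le]; norm_num
          _ ≤ _ := by gcongr; nlinarith
      have e2 : δ ^ (3 / 2 : ℝ) ≤ (r ^ 2 + δ ^ 2) ^ (3 / 4 : ℝ) := by
        calc δ ^ (3 / 2 : ℝ) = (δ ^ 2) ^ (3 / 4 : ℝ) := by
              rw [← Real.rpow_natCast, ← Real.rpow_mul hδ.le]; norm_num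
          _ ≤ _ := by gcongr; nlinarith
      calc _ ≤ (r ^ 2 + δ ^ 2) ^ (5 / 4 : ℝ) * (r ^ 2 + δ ^ 2) ^ (3 / 4 : ℝ) := by gcongr
        _ = _ := by rw [← Real.rpow_add (by positivity), ← Real.rpow_natCast]; norm_num
    have h3 : r * δ ^ 2 = δ ^ (1 / 2 : ℝ) * r ^ (-3 / 2 : ℝ) * (r ^ (5 / 2 : ℝ) * δ ^ (3 / 2 : ℝ)) := by
      have e1 : δ ^ 2 = δ ^ (1 / 2 : ℝ) * δ ^ (3 / 2 : ℝ) := by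
        rw [← Real.rpow_add hδ, ← Real.rpow_natCast]; norm_num
      have e2 : r = r ^ (-3 / 2 : ℝ) * r ^ (5 / 2 : ℝ) := by
        rw [← Real.rpow_add hr]; norm_num
      rw [e1]; nth_rewrite 1 [e2]; ring
    rw [← mul_div_assoc, div_le_iff₀ (by positivity), h3]
    gcongr

lemma convex_odisc : Convex ℝ odisc := convex_ball 0 1

lemma closure_odisc : closure odisc = cdisc := closure_ball 0 one_ne_zero

lemma norm_dotL_le (g : ℂ) : ‖dotL g‖ ≤ ‖g‖ := by
  refine ContinuousLinearMap.opNorm_le_bound _ (norm_nonneg _) fun v => ?_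
  have h : dotL g v = (conj g * v).re := by simp [dot]
  rw [h, ← RCLike.norm_conj g, ← norm_mul]
  exact Complex.abs_re_le_norm _

lemma IsGrad.exists_lipschitz {v : ℂ → ℝ} {g : ℂ → ℂ} (hv : IsGrad v g) :
    ∃ C, 0 ≤ C ∧ ∀ x ∈ cdisc, ∀ y ∈ cdisc, |v x - v y| ≤ C * ‖x - y‖ := by
  obtain ⟨C, hC⟩ := isCompact_cdisc.exists_bound_of_continuousOn hv.contGrad
  have h1 : LipschitzOnWith (Real.toNNReal C) v odisc := by
    refine convex_odisc.lipschitzOnWith_of_nnnorm_hasFDerivWithin_le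
      (fun x hx => (hv.deriv x hx).hasFDerivWithinAt) fun x hx => ?_
    rw [← NNReal.coe_le_coe, coe_nnnorm]
    exact (norm_dotL_le _).trans ((hC x (odisc_subset_cdisc hx)).trans (Real.le_coe_toNNReal C))
  have h2 : LipschitzOnWith (Real.toNNReal C) v (closure odisc) :=
    h1.closure (by rw [closure_odisc]; exact hv.cont)
  rw [closure_odisc] at h2
  refine ⟨Real.toNNReal C, NNReal.coe_nonneg _, fun x hx y hy => ?_⟩
  have := h2.dist_le_mul x hx y hy
  rwa [Real.dist_eq, dist_eq_norm] at this

lemma le_add_ballInt_gradK {v : ℂ → ℝ} {g : ℂ → ℂ} (hv : IsGrad v g)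
    (hb : ∀ z ∈ bdry, |v z| ≤ 1) :
    ∃ δ, 0 < δ ∧ ∀ x ∈ odisc, v x ≤ 5 / 2 + ballInt fun y => dot (g y) (gradK δ x y) := by
  obtain ⟨C, hC0, hC⟩ := hv.exists_lipschitz
  have hδ : ∃ δ : ℝ, 0 < δ ∧ C * δ + C * (8 * π * δ ^ (1 / 2 : ℝ)) < 1 / 2 := by
    have h1 : ContinuousAt (fun δ : ℝ => C * δ + C * (8 * π * δ ^ (1 / 2 : ℝ))) 0 := by
      have := Real.continuousAt_rpow_const 0 (1 / 2) (Or.inr (by norm_num : (0 : ℝ) ≤ 1 / 2))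
      fun_prop
    have h2 : ∀ᶠ δ in 𝓝 (0 : ℝ), C * δ + C * (8 * π * δ ^ (1 / 2 : ℝ)) < 1 / 2 := by
      refine h1.eventually_lt_const ?_
      norm_num
    obtain ⟨δ, h3, h4⟩ := ((h2.filter_mono nhdsWithin_le_nhds).and
      (self_mem_nhdsWithin : Ioi (0 : ℝ) ∈ 𝓝[>] 0)).exists
    exact ⟨δ, h4, h3⟩
  obtain ⟨δ, hδ, hsmall⟩ := hδ
  refine ⟨δ, hδ, fun x hx => ?_⟩
  have hxc := odisc_subset_cdisc hx
  have hM : Continuous fun y => regM δ x y :=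
    (continuous_regM hδ).comp (f := fun y => (x, y)) (by fun_prop)
  have hN := continuous_regN hδ x
  have hvc := hv.cont
  have hvb := hvc.mono bdry_subset_cdisc
  have hG := green hv (hasDiv_gradK hδ x)
  have e1 : ballInt (fun z => v z * -regM δ x z) = -1 * ballInt (fun z => v z * regM δ x z) := by
    rw [← ballInt_const_mul]; congr 1; ext; ring
  have e2 : circInt (fun z => v z * dot z (gradK δ x z)) = -1 * circInt (fun z => v z * regN δ x z) := by
    rw [← circInt_const_mul]; exact circInt_congr fun z hz => by rw [dot_gradK hδ x hz]; ring
  rw [e1, e2] at hG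
  have h1 : v x * circInt (regN δ x) - C * (8 * π * δ ^ (1 / 2 : ℝ)) ≤
      ballInt fun z => v z * regM δ x z := by
    have a1 : ballInt (fun y => v x * regM δ x y - C * (‖x - y‖ * regM δ x y)) ≤
        ballInt fun z => v z * regM δ x z := by
      refine ballInt_mono (by fun_prop) (by fun_prop) fun y hy => ?_
      have b1 := regM_nonneg hδ hxc (odisc_subset_cdisc hy)
      have b2 := abs_le.1 (hC x hxc y (odisc_subset_cdisc hy))
      nlinarith
    rw [ballInt_sub (by fun_prop) (by fun_prop), ballInt_const_mul, ballInt_const_mul,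
      ballInt_regM hδ] at a1
    have := mul_le_mul_of_nonneg_left (ballInt_norm_mul_regM_le hδ hx) hC0
    linarith
  have h2 : circInt (fun z => v z * regN δ x z) ≤ circInt (regN δ x) := by
    refine circInt_mono (by fun_prop) (by fun_prop) fun y hy => ?_
    have b1 := regN_nonneg δ hxc y
    have b2 := (abs_le.1 (hb y hy)).2
    nlinarith
  have h3 := circInt_regN_le hδ hx
  have h4 := le_circInt_regN hδ hx
  have h5 : 0 ≤ circInt (regN δ x) := circInt_nonneg fun z _ => regN_nonneg δ hxc z
  set m := circInt (regN δ x)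
  have hx1 : 0 < 1 - ‖x‖ := by rw [mem_odisc] at hx; linarith
  have h6 : v x ≤ 1 + C * (1 - ‖x‖) := by
    rcases eq_or_ne x 0 with rfl | hx0
    · have := (abs_le.1 (hC 0 hxc 1 (by simp [mem_cdisc]))).2
      have := (abs_le.1 (hb 1 (by simp [mem_bdry]))).2
      simp at *; linarith
    · have hn : 0 < ‖x‖ := norm_pos_iff.2 hx0
      have hz : ((‖x‖⁻¹ : ℝ) : ℂ) * x ∈ bdry := by
        rw [mem_bdry, norm_mul, Complex.norm_real]; simp [hn.ne']
      have a1 := (abs_le.1 (hC x hxc _ (bdry_subset_cdisc hz))).2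
      have a2 := (abs_le.1 (hb _ hz)).2
      have a3 : ‖x - ((‖x‖⁻¹ : ℝ) : ℂ) * x‖ = 1 - ‖x‖ := by
        have : x - ((‖x‖⁻¹ : ℝ) : ℂ) * x = ((1 - ‖x‖⁻¹ : ℝ) : ℂ) * x := by push_cast; ring
        rw [this, norm_mul, Complex.norm_real, Real.norm_eq_abs, abs_of_nonpos]
        · field_simp; ring
        · rw [sub_nonpos]; exact (one_le_inv₀ hn).2 (by linarith)
      rw [a3] at a1
      linarith
  have h7 : (1 - ‖x‖) * (1 - m) ≤ δ := by
    rcases le_or_gt (1 - ‖x‖) δ with h | h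
    · nlinarith
    · have : (1 - ‖x‖) * (1 - m) ≤ (1 - ‖x‖) * (δ ^ 2 / (1 - ‖x‖) ^ 2) := by
        gcongr; linarith
      refine this.trans ?_
      have e : (1 - ‖x‖) * (δ ^ 2 / (1 - ‖x‖) ^ 2) = δ * (δ / (1 - ‖x‖)) := by field_simp
      rw [e]
      exact mul_le_of_le_one_right hδ.le ((div_le_one hx1).2 h.le)
  have h8 : v x * (1 - m) ≤ 1 + C * δ := by
    have a1 : v x * (1 - m) ≤ (1 + C * (1 - ‖x‖)) * (1 - m) := by gcongr
    have a2 := mul_le_mul_of_nonneg_left h7 hC0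
    nlinarith
  nlinarith

section IrreducibleKernel

attribute [local irreducible] regK gradK regM regN

section Gibbs

variable {δ : ℝ} (hδ : 0 < δ) {P : ℂ → ℝ} (hP : ContinuousOn P cdisc)

/-- The gradient of the potential of the density `P`. -/
def potGrad (δ : ℝ) (P : ℂ → ℝ) (y : ℂ) : ℂ :=
  ⟨ballInt fun x => P x * (gradK δ x y).re, ballInt fun x => P x * (gradK δ x y).im⟩

include hδ hP

lemma continuousOn_mul_gradK :
    ContinuousOn (fun p : ℂ × ℂ => (P p.2 : ℂ) * gradK δ p.2 p.1) (cdisc ×ˢ cdisc) := by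
  have h1 : ContinuousOn (fun p : ℂ × ℂ => P p.2) (cdisc ×ˢ cdisc) :=
    hP.comp continuousOn_snd fun p hp => hp.2
  have h2 : Continuous fun p : ℂ × ℂ => gradK δ p.2 p.1 :=
    (continuous_gradK hδ).comp (f := fun p : ℂ × ℂ => (p.2, p.1)) (by fun_prop)
  exact (Complex.continuous_ofReal.comp_continuousOn h1).mul h2.continuousOn

lemma continuousOn_potGrad : ContinuousOn (potGrad δ P) cdisc := by
  have h := continuousOn_mul_gradK hδ hP
  have h1 : ContinuousOn (fun y => ballInt fun x => P x * (gradK δ x y).re) cdisc := by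
    refine continuousOn_ballInt isCompact_cdisc ?_
    refine (Complex.continuous_re.comp_continuousOn h).congr fun p _ => ?_
    simp
  have h2 : ContinuousOn (fun y => ballInt fun x => P x * (gradK δ x y).im) cdisc := by
    refine continuousOn_ballInt isCompact_cdisc ?_
    refine (Complex.continuous_im.comp_continuousOn h).congr fun p _ => ?_
    simp
  have h3 : potGrad δ P = fun y => ((ballInt fun x => P x * (gradK δ x y).re : ℝ) : ℂ) +
      ((ballInt fun x => P x * (gradK δ x y).im : ℝ) : ℂ) * Complex.I := by
    ext y; apply Complex.ext <;> simp [potGrad]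
  rw [h3]
  fun_prop

lemma dot_potGrad (c y : ℂ) :
    dot c (potGrad δ P y) = ballInt fun x => P x * dot c (gradK δ x y) := by
  have h2 : Continuous fun x : ℂ => gradK δ x y :=
    (continuous_gradK hδ).comp (f := fun x => (x, y)) (by fun_prop)
  simp only [dot, potGrad]
  rw [← ballInt_const_mul, ← ballInt_const_mul, ← ballInt_add (by fun_prop) (by fun_prop)]
  congr 1; ext; ring

lemma ballInt_dot_potGrad {g : ℂ → ℂ} (hg : ContinuousOn g cdisc) :
    ballInt (fun y => dot (g y) (potGrad δ P y)) =
      ballInt fun x => P x * ballInt fun y => dot (g y) (gradK δ x y) := by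
  simp only [dot_potGrad hδ hP, ← ballInt_const_mul]
  refine ballInt_swap (F := fun y x => P x * dot (g y) (gradK δ x y)) ?_
  have h1 : ContinuousOn (fun p : ℂ × ℂ => P p.2) (cdisc ×ˢ cdisc) :=
    hP.comp continuousOn_snd fun p hp => hp.2
  have h2 : Continuous fun p : ℂ × ℂ => gradK δ p.2 p.1 :=
    (continuous_gradK hδ).comp (f := fun p : ℂ × ℂ => (p.2, p.1)) (by fun_prop)
  have h3 : ContinuousOn (fun p : ℂ × ℂ => g p.1) (cdisc ×ˢ cdisc) :=
    hg.comp continuousOn_fst fun p hp => hp.1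
  exact h1.mul (h3.dot' h2.continuousOn)

lemma ballInt_gradK_potGrad (x : ℂ) :
    ballInt (fun y => dot (gradK δ x y) (potGrad δ P y)) =
      ballInt fun y => regM δ x y * ballInt fun x' => P x' * regK δ x' y := by
  have hM : Continuous fun y => regM δ x y :=
    (continuous_regM hδ).comp (f := fun y => (x, y)) (by fun_prop)
  have hg : Continuous fun y => gradK δ x y :=
    (continuous_gradK hδ).comp (f := fun y => (x, y)) (by fun_prop)
  have h1 : ∀ x' : ℂ, ballInt (fun y => dot (gradK δ x y) (gradK δ x' y)) =
      ballInt fun y => regM δ x y * regK δ x' y := by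
    intro x'
    have h := green (isGrad_regK hδ x') (hasDiv_gradK hδ x)
    have e : circInt (fun z => regK δ x' z * dot z (gradK δ x z)) = 0 := by
      rw [circInt_congr (ψ := fun _ => 0) fun z hz => by rw [regK_bdry δ x' hz, zero_mul],
        circInt_const, mul_zero]
    have e2 : ballInt (fun z => regK δ x' z * -regM δ x z) =
        -1 * ballInt (fun y => regM δ x y * regK δ x' y) := by
      rw [← ballInt_const_mul]; congr 1; ext; ring
    have e3 : ballInt (fun y => dot (gradK δ x y) (gradK δ x' y)) =
        ballInt (fun y => dot (gradK δ x' y) (gradK δ x y)) := by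
      congr 1; ext; rw [dot_comm]
    rw [e, e2] at h
    rw [e3]; linarith
  rw [ballInt_dot_potGrad hδ hP hg.continuousOn]
  simp only [h1, ← ballInt_const_mul]
  have h2 : ContinuousOn (fun p : ℂ × ℂ => P p.1 * (regM δ x p.2 * regK δ p.1 p.2))
      (cdisc ×ˢ cdisc) := by
    have h1 : ContinuousOn (fun p : ℂ × ℂ => P p.1) (cdisc ×ˢ cdisc) :=
      hP.comp continuousOn_fst fun p hp => hp.1
    have h2 := continuous_regK hδ
    have h3 : Continuous fun p : ℂ × ℂ => regM δ x p.2 := hM.comp continuous_snd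
    exact h1.mul (h3.mul h2).continuousOn
  rw [ballInt_swap (F := fun x' y => P x' * (regM δ x y * regK δ x' y)) h2]
  congr 1; ext y; congr 1; ext x'; ring

end Gibbs

/-- A Moser–Trudinger inequality with a weight. -/
theorem moser_trudinger {v W : ℂ → ℝ} {g : ℂ → ℂ} (hv : IsGrad v g) (hb : ∀ z ∈ bdry, |v z| ≤ 1)
    (hW : ContinuousOn W cdisc) (hWpos : ∀ z ∈ cdisc, 0 < W z) {N : ℝ}
    (hN : ∀ δ, 0 < δ → ∀ y ∈ odisc,
      ballInt (fun x => Real.exp (3 * π * regK δ x y) * W x) ≤ N) :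
    ballInt (fun z => Real.exp (2 * v z) * W z) ≤ Real.exp (dirich g / (3 * π) + 5) * N := by
  obtain ⟨δ, hδ, hrep⟩ := le_add_ballInt_gradK hv hb
  have hvc := hv.cont
  set A := ballInt (fun z => Real.exp (2 * v z) * W z) with hA
  have hApos : 0 < A := ballInt_pos (by fun_prop) fun z hz => mul_pos (Real.exp_pos _) (hWpos z hz)
  obtain ⟨P, hPdef⟩ : ∃ P : ℂ → ℝ, P = fun z => A⁻¹ * (Real.exp (2 * v z) * W z) := ⟨_, rfl⟩
  have hP : ContinuousOn P cdisc := by rw [hPdef]; fun_prop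
  have hPpos : ∀ z ∈ cdisc, 0 < P z := fun z hz => by
    rw [hPdef]
    exact mul_pos (inv_pos.2 hApos) (mul_pos (Real.exp_pos _) (hWpos z hz))
  have hP1 : ballInt P = 1 := by
    rw [hPdef, ballInt_const_mul, ← hA]; field_simp
  set X := ballInt (fun z => P z * v z) with hX
  have hKc : ∀ y, Continuous fun x => regK δ x y := fun y =>
    (continuous_regK hδ).comp (f := fun x => (x, y)) (by fun_prop)
  have h0 : (0 : ℂ) ∈ odisc := by simp [mem_odisc]
  have hNpos : 0 < N := by
    refine lt_of_lt_of_le (ballInt_pos ?_ fun z hz => ?_) (hN δ hδ 0 h0)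
    · have := hKc 0
      fun_prop
    · exact mul_pos (Real.exp_pos _) (hWpos z hz)
  set S := 2 * X - Real.log A + Real.log N with hS
  have hq : ∀ y ∈ odisc, ballInt (fun x => P x * regK δ x y) ≤ 1 / (3 * π) * S := by
    intro y hy
    have hK := hKc y
    have a1 : ballInt (fun x => (1 + Real.log A - Real.log N) * P x +
        (3 * π * (P x * regK δ x y) - 2 * (P x * v x))) ≤
        ballInt (fun x => N⁻¹ * (Real.exp (3 * π * regK δ x y) * W x)) := by
      refine ballInt_mono (by fun_prop) (by fun_prop) fun x hx => ?_
      have b1 := Real.add_one_le_exp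
        (3 * π * regK δ x y - 2 * v x + Real.log A - Real.log N)
      have b2 := hPpos x (odisc_subset_cdisc hx)
      have b3 : N⁻¹ * (Real.exp (3 * π * regK δ x y) * W x) = P x * Real.exp
        (3 * π * regK δ x y - 2 * v x + Real.log A - Real.log N) := by
        rw [Real.exp_sub, Real.exp_add, Real.exp_sub, Real.exp_log hApos, Real.exp_log hNpos, hPdef]
        have := Real.exp_pos (2 * v x)
        field_simp
      rw [b3]
      nlinarith
    rw [ballInt_add (by fun_prop) (by fun_prop), ballInt_sub (by fun_prop) (by fun_prop),
      ballInt_const_mul, ballInt_const_mul, ballInt_const_mul, ballInt_const_mul, hP1, ← hX] at a1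
    have a2 : N⁻¹ * ballInt (fun x => Real.exp (3 * π * regK δ x y) * W x) ≤ 1 := by
      rw [inv_mul_le_iff₀ hNpos, mul_one]
      exact hN δ hδ y hy
    have a3 : 3 * π * ballInt (fun x => P x * regK δ x y) ≤ S := by linarith
    rw [one_div_mul_eq_div, le_div_iff₀ (by positivity)]
    linarith
  have hS0 : 0 ≤ S := by
    have a1 : 0 ≤ ballInt (fun x => P x * regK δ x 0) := ballInt_nonneg fun x hx =>
      mul_nonneg (hPpos x (odisc_subset_cdisc hx)).le
        (regK_nonneg hδ (odisc_subset_cdisc hx) (odisc_subset_cdisc h0))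
    have a2 := a1.trans (hq 0 h0)
    by_contra hneg
    have : 1 / (3 * π) * S < 0 := mul_neg_of_pos_of_neg (by positivity) (not_le.1 hneg)
    linarith
  have hQc := continuousOn_potGrad hδ hP
  have hqc : ContinuousOn (fun y => ballInt fun x => P x * regK δ x y) cdisc := by
    refine continuousOn_ballInt isCompact_cdisc ?_
    have h1 : ContinuousOn (fun p : ℂ × ℂ => P p.2) (cdisc ×ˢ cdisc) :=
      hP.comp continuousOn_snd fun p hp => hp.2
    have h2 : Continuous fun p : ℂ × ℂ => regK δ p.2 p.1 :=
      (continuous_regK hδ).comp (f := fun p : ℂ × ℂ => (p.2, p.1)) (by fun_prop)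
    exact h1.mul h2.continuousOn
  have hQ : ballInt (fun y => dot (potGrad δ P y) (potGrad δ P y)) ≤ 1 / (3 * π) * S := by
    rw [ballInt_dot_potGrad hδ hP hQc]
    have a1 : ∀ x ∈ odisc, ballInt (fun y => dot (potGrad δ P y) (gradK δ x y)) ≤
        1 / (3 * π) * S := by
      intro x hx
      have hM : Continuous fun y => regM δ x y :=
        (continuous_regM hδ).comp (f := fun y => (x, y)) (by fun_prop)
      simp only [dot_comm (potGrad δ P _)]
      rw [ballInt_gradK_potGrad hδ hP]
      have b1 : ballInt (fun y => regM δ x y * ballInt fun x' => P x' * regK δ x' y) ≤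
          ballInt fun y => 1 / (3 * π) * S * regM δ x y := by
        refine ballInt_mono (by fun_prop) (by fun_prop) fun y hy => ?_
        rw [mul_comm (regM δ x y)]
        exact mul_le_mul_of_nonneg_right (hq y hy)
          (regM_nonneg hδ (odisc_subset_cdisc hx) (odisc_subset_cdisc hy))
      refine b1.trans ?_
      rw [ballInt_const_mul, ballInt_regM hδ]
      exact mul_le_of_le_one_right (by positivity) (circInt_regN_le hδ hx)
    have hc : ContinuousOn (fun x => ballInt fun y => dot (potGrad δ P y) (gradK δ x y)) cdisc := by
      refine continuousOn_ballInt isCompact_cdisc ?_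
      exact (hQc.comp continuousOn_snd fun p hp => hp.2).dot' (continuous_gradK hδ).continuousOn
    calc _ ≤ ballInt (fun x => 1 / (3 * π) * S * P x) := by
          refine ballInt_mono (by fun_prop) (by fun_prop) fun x hx => ?_
          rw [mul_comm (P x)]
          exact mul_le_mul_of_nonneg_right (a1 x hx) (hPpos x (odisc_subset_cdisc hx)).le
      _ = _ := by rw [ballInt_const_mul, hP1, mul_one]
  have hXle : X ≤ 5 / 2 + ballInt (fun y => dot (g y) (potGrad δ P y)) := by
    rw [ballInt_dot_potGrad hδ hP hv.contGrad]
    have hc : ContinuousOn (fun x => ballInt fun y => dot (g y) (gradK δ x y)) cdisc := by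
      refine continuousOn_ballInt isCompact_cdisc ?_
      exact (hv.contGrad.comp continuousOn_snd fun p hp => hp.2).dot'
        (continuous_gradK hδ).continuousOn
    have a1 : X ≤ ballInt (fun x => 5 / 2 * P x +
        P x * ballInt fun y => dot (g y) (gradK δ x y)) := by
      refine ballInt_mono (by fun_prop) (by fun_prop) fun x hx => ?_
      have b1 := hPpos x (odisc_subset_cdisc hx)
      have b2 := hrep x hx
      nlinarith
    rw [ballInt_add (by fun_prop) (by fun_prop), ballInt_const_mul, hP1] at a1
    linarith
  have hYoung : 2 * ballInt (fun y => dot (g y) (potGrad δ P y)) ≤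
      1 / (3 * π) * dirich g + 3 * π * ballInt (fun y => dot (potGrad δ P y) (potGrad δ P y)) := by
    have hgg := hv.contGrad.dot hv.contGrad
    have hgQ := hv.contGrad.dot hQc
    have hQQ := hQc.dot hQc
    unfold dirich
    rw [← ballInt_const_mul, ← ballInt_const_mul, ← ballInt_const_mul,
      ← ballInt_add (by fun_prop) (by fun_prop)]
    refine ballInt_mono (by fun_prop) (by fun_prop) fun y _ => ?_
    have a1 := two_mul_dot_le (g y) (((3 * π : ℝ) : ℂ) * potGrad δ P y)
    rw [dot_smul_left, dot_smul_right] at a1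
    have a2 : 3 * π * dot (potGrad δ P y) (potGrad δ P y) = 1 / (3 * π) *
      (3 * π * (3 * π * dot (potGrad δ P y) (potGrad δ P y))) := by field_simp
    have a3 : 2 * dot (g y) (potGrad δ P y) = 1 / (3 * π) *
      (2 * (3 * π * dot (g y) (potGrad δ P y))) := by field_simp
    rw [dot_smul_right] at a1
    rw [a2, a3, ← mul_add]
    exact mul_le_mul_of_nonneg_left a1 (by positivity)
  have hfin : Real.log A ≤ dirich g / (3 * π) + 5 + Real.log N := by
    have : 3 * π * ballInt (fun y => dot (potGrad δ P y) (potGrad δ P y)) ≤ S := by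
      calc _ ≤ 3 * π * (1 / (3 * π) * S) := by gcongr
        _ = S := by field_simp
    have e : 1 / (3 * π) * dirich g = dirich g / (3 * π) := by ring
    linarith
  calc A = Real.exp (Real.log A) := (Real.exp_log hApos).symm
    _ ≤ Real.exp (dirich g / (3 * π) + 5 + Real.log N) := Real.exp_le_exp.2 hfin
    _ = _ := by rw [Real.exp_add, Real.exp_log hNpos]

end IrreducibleKernel

lemma exp_regK {δ : ℝ} (hδ : 0 < δ) (x y : ℂ) :
    Real.exp (3 * π * regK δ x y) = (quad δ (-conj x) 1 y / quad δ (-1) x y) ^ (3 / 4 : ℝ) := by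
  have h1 := quad_pos hδ (-conj x) 1 y
  have h2 := quad_pos hδ (-1) x y
  rw [Real.rpow_def_of_pos (div_pos h1 h2), Real.log_div h1.ne' h2.ne', regK]
  congr 1
  field_simp

lemma quad_div_quad_le {δ : ℝ} (hδ : 0 < δ) {x y : ℂ} (hx : x ∈ cdisc) (hy : y ∈ cdisc)
    (hxy : x ≠ y) : quad δ (-conj x) 1 y / quad δ (-1) x y ≤
      1 + (1 - ‖x‖ ^ 2) * (1 - ‖y‖ ^ 2) / ‖x - y‖ ^ 2 := by
  have h1 := quad_pos hδ (-1) x y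
  have h2 : 0 < ‖x - y‖ := norm_pos_iff.2 (sub_ne_zero.2 hxy)
  have h3 := mul_nonneg (one_sub_sq_nonneg hx) (one_sub_sq_nonneg hy)
  rw [quad_conj, add_div, div_self h1.ne', quad_neg_one]
  gcongr
  nlinarith [sq_nonneg δ]

lemma four_rpow_le : (4 : ℝ) ^ (3 / 4 : ℝ) ≤ 3 := by
  have h : ((4 : ℝ) ^ (3 / 4 : ℝ)) ^ 4 ≤ 3 ^ 4 := by
    rw [← Real.rpow_natCast, ← Real.rpow_mul (by norm_num)]; norm_num
  exact le_of_pow_le_pow_left₀ (by norm_num) (by norm_num) h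

lemma kernel_weight_le {w : ℂ → ℝ} {s : ℝ} (hw : ∀ z ∈ cdisc, 0 ≤ w z)
    (hs : ∀ z ∈ cdisc, (1 - ‖z‖ ^ 2) ^ 2 * w z ≤ s ^ 2) {δ : ℝ} (hδ : 0 < δ) {x y : ℂ}
    (hx : x ∈ odisc) (hy : y ∈ odisc) (hxy : x ≠ y) :
    Real.exp (3 * π * regK δ x y) * w x ≤ 3 * w x +
      27 * s ^ 2 * (1 - ‖y‖ ^ 2) ^ (-1 / 2 : ℝ) * sing (1 - ‖y‖ ^ 2) ‖x - y‖ := by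
  have hxc := odisc_subset_cdisc hx
  have hyc := odisc_subset_cdisc hy
  have h1 := quad_div_quad_le hδ hxc hyc hxy
  have h0 : 0 ≤ quad δ (-conj x) 1 y / quad δ (-1) x y :=
    (div_pos (quad_pos hδ _ _ _) (quad_pos hδ _ _ _)).le
  rw [exp_regK hδ]
  have ha := one_sub_norm_sq_pos hx
  have hb := one_sub_norm_sq_pos hy
  have hr : 0 < ‖x - y‖ := norm_pos_iff.2 (sub_ne_zero.2 hxy)
  have hw0 := hw x hxc
  have hs0 := hs x hxc
  have hab : |‖x‖ - ‖y‖| ≤ ‖x - y‖ := abs_norm_sub_norm_le x y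
  have hx1 : ‖x‖ < 1 := mem_odisc.1 hx
  have hy1 : ‖y‖ < 1 := mem_odisc.1 hy
  have hx0 := norm_nonneg x
  have hy0 := norm_nonneg y
  obtain ⟨hab1, hab2⟩ := abs_le.1 hab
  have hba : 1 - ‖x‖ ^ 2 ≤ 1 - ‖y‖ ^ 2 + 2 * ‖x - y‖ := by nlinarith
  have hba' : 1 - ‖y‖ ^ 2 ≤ 1 - ‖x‖ ^ 2 + 2 * ‖x - y‖ := by nlinarith
  have hsing := sing_nonneg (1 - ‖y‖ ^ 2) hr.le
  set a := 1 - ‖x‖ ^ 2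
  set b := 1 - ‖y‖ ^ 2
  set r := ‖x - y‖
  set m := quad δ (-conj x) 1 y / quad δ (-1) x y
  rcases le_or_gt (a * b) (3 * r ^ 2) with h | h
  · have h2 : m ≤ 4 := by
      have : a * b / r ^ 2 ≤ 3 := (div_le_iff₀ (by positivity)).2 h
      linarith
    have h3 : m ^ (3 / 4 : ℝ) ≤ 3 := (Real.rpow_le_rpow h0 h2 (by norm_num)).trans four_rpow_le
    have h4 : 0 ≤ 27 * s ^ 2 * b ^ (-1 / 2 : ℝ) * sing b r := by positivity
    nlinarith
  · have hrb : r < b := by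
      by_contra hc
      have hc := not_lt.1 hc
      nlinarith
    have hra : r < a := by
      by_contra hc
      have hc := not_lt.1 hc
      nlinarith
    have h2 : m ≤ (2 * b / r) ^ 2 := by
      have : 1 + a * b / r ^ 2 ≤ (2 * b / r) ^ 2 := by
        rw [div_pow, one_add_div (by positivity)]
        gcongr
        nlinarith
      linarith
    have h3 : m ^ (3 / 4 : ℝ) ≤ 3 * b ^ (3 / 2 : ℝ) * r ^ (-3 / 2 : ℝ) := by
      refine (Real.rpow_le_rpow h0 h2 (by norm_num)).trans ?_
      have e1 : ((2 * b / r) ^ 2) ^ (3 / 4 : ℝ) = 4 ^ (3 / 4 : ℝ) * b ^ (3 / 2 : ℝ) * r ^ (-3 / 2 : ℝ) := by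
        have : (2 * b / r) ^ 2 = 4 * b ^ 2 * (r⁻¹) ^ 2 := by field_simp; ring
        rw [this, Real.mul_rpow (by positivity) (by positivity),
          Real.mul_rpow (by positivity) (by positivity), ← Real.rpow_natCast b,
          ← Real.rpow_mul hb.le, ← Real.rpow_natCast (r⁻¹), ← Real.rpow_mul (by positivity),
          Real.inv_rpow hr.le, ← Real.rpow_neg hr.le]
        norm_num
      rw [e1]
      gcongr
      exact four_rpow_le
    have h4 : b ^ 2 * w x ≤ 9 * s ^ 2 := by
      have : b ^ 2 ≤ 9 * a ^ 2 := by nlinarith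
      nlinarith
    have h5 : b ^ (3 / 2 : ℝ) * w x ≤ 9 * s ^ 2 * b ^ (-1 / 2 : ℝ) := by
      have e : b ^ (3 / 2 : ℝ) = b ^ 2 * b ^ (-1 / 2 : ℝ) := by
        rw [← Real.rpow_natCast b, ← Real.rpow_add hb]; norm_num
      rw [e]
      calc _ = b ^ 2 * w x * b ^ (-1 / 2 : ℝ) := by ring
        _ ≤ _ := by gcongr
    rw [sing_of_lt hrb]
    calc m ^ (3 / 4 : ℝ) * w x ≤ 3 * b ^ (3 / 2 : ℝ) * r ^ (-3 / 2 : ℝ) * w x := by gcongr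
      _ = 3 * (b ^ (3 / 2 : ℝ) * w x) * r ^ (-3 / 2 : ℝ) := by ring
      _ ≤ 3 * (9 * s ^ 2 * b ^ (-1 / 2 : ℝ)) * r ^ (-3 / 2 : ℝ) := by gcongr
      _ = 27 * s ^ 2 * b ^ (-1 / 2 : ℝ) * r ^ (-3 / 2 : ℝ) := by ring
      _ ≤ _ := by linarith

lemma ballInt_kernel_weight_le {w : ℂ → ℝ} {s : ℝ} (hc : ContinuousOn w cdisc)
    (hw : ∀ z ∈ cdisc, 0 ≤ w z)
    (hs : ∀ z ∈ cdisc, (1 - ‖z‖ ^ 2) ^ 2 * w z ≤ s ^ 2) {δ : ℝ} (hδ : 0 < δ) {y : ℂ}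
    (hy : y ∈ odisc) :
    ballInt (fun x => Real.exp (3 * π * regK δ x y) * w x) ≤
      3 * ballInt w + 108 * π * s ^ 2 := by
  have hK : Continuous fun x => regK δ x y :=
    (continuous_regK hδ).comp (f := fun x => (x, y)) (by fun_prop)
  have hb := one_sub_norm_sq_pos hy
  have h := ballInt_le_of_sing (φ := fun x => Real.exp (3 * π * regK δ x y) * w x)
    (ψ := fun x => 3 * w x) (x := y) (R := 1 - ‖y‖ ^ 2)
    (C := 27 * s ^ 2 * (1 - ‖y‖ ^ 2) ^ (-1 / 2 : ℝ)) (by fun_prop) (by fun_prop) hb (by positivity)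
    fun x hx hxy => kernel_weight_le hw hs hδ hx hy hxy
  rw [ballInt_const_mul] at h
  refine h.trans (le_of_eq ?_)
  have e : (1 - ‖y‖ ^ 2) ^ (-1 / 2 : ℝ) * (1 - ‖y‖ ^ 2) ^ (1 / 2 : ℝ) = 1 := by
    rw [← Real.rpow_add hb]; norm_num
  linear_combination (108 * π * s ^ 2) * e

lemma bpt_zpow (θ : ℝ) (n : ℤ) : bpt θ ^ n = Complex.exp (n * (θ * Complex.I)) := by
  rw [bpt, Complex.exp_int_mul]

lemma bpt_add_two_pi (θ : ℝ) : bpt (θ + 2 * π) = bpt θ := by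
  simp only [bpt]
  push_cast
  rw [add_mul, Complex.exp_add, Complex.exp_two_pi_mul_I, mul_one]

lemma continuous_bpt_zpow (n : ℤ) : Continuous fun θ => bpt θ ^ n := by
  simp only [bpt_zpow]; fun_prop

instance two_pi_pos_fact : Fact (0 < 2 * π) := ⟨Real.two_pi_pos⟩

lemma fourier_two_pi (n : ℤ) (θ : ℝ) : fourier n (θ : AddCircle (2 * π)) = bpt θ ^ n := by
  rw [fourier_coe_apply, bpt_zpow]
  congr 1
  have : (π : ℂ) ≠ 0 := by exact_mod_cast Real.pi_ne_zero
  push_cast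
  field_simp

lemma fourierCoeff_two_pi (F : AddCircle (2 * π) → ℂ) (n : ℤ) :
    fourierCoeff F n = (1 / (2 * π)) • ∫ θ in (0:ℝ)..2 * π, F θ * bpt θ ^ (-n) := by
  rw [fourierCoeff_eq_intervalIntegral F n 0, zero_add]
  simp only [fourier_two_pi, smul_eq_mul, mul_comm]

/-- Integration by parts against a Fourier mode. -/
lemma integral_mul_bpt_zpow {φ φ' : ℝ → ℂ} (hφ : ∀ θ, HasDerivAt φ (φ' θ) θ) (hφ' : Continuous φ')
    (hper : φ (2 * π) = φ 0) {n : ℤ} (hn : n ≠ 0) :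
    ∫ θ in (0:ℝ)..2 * π, φ θ * bpt θ ^ n =
      -(1 / (n * Complex.I)) * ∫ θ in (0:ℝ)..2 * π, φ' θ * bpt θ ^ n := by
  have hn' : (n : ℂ) * Complex.I ≠ 0 := mul_ne_zero (by exact_mod_cast hn) Complex.I_ne_zero
  have hd : ∀ θ : ℝ, HasDerivAt (fun θ : ℝ => bpt θ ^ n / (n * Complex.I)) (bpt θ ^ n) θ := by
    intro θ
    simp only [bpt_zpow]
    have h1 : HasDerivAt (fun z : ℂ => Complex.exp (n * (z * Complex.I)) / (n * Complex.I))
        (Complex.exp (n * (θ * Complex.I))) (θ : ℂ) := by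
      have h := (((hasDerivAt_id (θ : ℂ)).mul_const Complex.I).const_mul (n : ℂ)).cexp.div_const
        (n * Complex.I)
      refine h.congr_deriv ?_
      rw [div_eq_iff hn']
      simp
    exact h1.comp_ofReal
  rw [intervalIntegral.integral_mul_deriv_eq_deriv_mul (u := φ) (v' := fun θ => bpt θ ^ n)
    (fun θ _ => hφ θ) (fun θ _ => hd θ) (hφ'.intervalIntegrable _ _)
    ((continuous_bpt_zpow n).intervalIntegrable _ _)]
  have h0 : bpt (2 * π) = bpt 0 := by simpa using bpt_add_two_pi 0
  rw [hper, h0, sub_self, zero_sub, ← intervalIntegral.integral_const_mul,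
    ← intervalIntegral.integral_neg]
  congr 1; ext θ
  ring

lemma norm_integral_mul_bpt_zpow_le {φ : ℝ → ℂ} {C : ℝ} (hC : ∀ θ ∈ Icc 0 (2 * π), ‖φ θ‖ ≤ C) (n : ℤ) :
    ‖∫ θ in (0:ℝ)..2 * π, φ θ * bpt θ ^ n‖ ≤ C * (2 * π) := by
  have h := intervalIntegral.norm_integral_le_of_norm_le_const (a := 0) (b := 2 * π) (C := C)
    (f := fun θ => φ θ * bpt θ ^ n) (fun θ hθ => by
      rw [uIoc_of_le Real.two_pi_pos.le] at hθ
      simpa [norm_bpt] using hC θ (Ioc_subset_Icc_self hθ))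
  simpa [abs_of_pos Real.pi_pos] using h

lemma summable_fourierCoeff {F : AddCircle (2 * π) → ℂ} {φ φ' φ'' : ℝ → ℂ}
    (hF : ∀ θ : ℝ, F θ = φ θ) (h1 : ∀ θ, HasDerivAt φ (φ' θ) θ)
    (h2 : ∀ θ, HasDerivAt φ' (φ'' θ) θ) (hc : Continuous φ'')
    (hp : φ (2 * π) = φ 0) (hp' : φ' (2 * π) = φ' 0) : Summable (fourierCoeff F) := by
  obtain ⟨C, hC⟩ := (isCompact_Icc (a := 0) (b := 2 * π)).exists_bound_of_continuousOn
    hc.continuousOn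
  have hc' : Continuous φ' := continuous_iff_continuousAt.2 fun θ => (h2 θ).continuousAt
  have hs : Summable fun n : ℤ => C * ((1 : ℝ) / (n : ℝ) ^ 2) :=
    ((Real.summable_one_div_int_pow (p := 2)).2 (by norm_num)).mul_left C
  refine Summable.of_norm_bounded_eventually hs ?_
  filter_upwards [(Set.finite_singleton (0 : ℤ)).compl_mem_cofinite] with n hn
  have hn0 : n ≠ 0 := hn
  have hneg : -n ≠ 0 := neg_ne_zero.2 hn0
  rw [fourierCoeff_two_pi]
  simp only [hF]
  rw [integral_mul_bpt_zpow h1 hc' hp hneg, integral_mul_bpt_zpow h2 hc hp' hneg]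
  have hb := norm_integral_mul_bpt_zpow_le hC (-n)
  have hnr : (0:ℝ) < |(n : ℝ)| := abs_pos.2 (by exact_mod_cast hn0)
  rw [norm_smul, norm_mul, norm_mul]
  simp only [norm_neg, norm_div, norm_mul, norm_one, Complex.norm_I, mul_one, Int.cast_neg,
    Complex.norm_intCast, Real.norm_eq_abs]
  rw [abs_of_pos Real.pi_pos, abs_two, ← sq_abs (n : ℝ)]
  calc _ ≤ 1 / (2 * π) * (1 / |(n : ℝ)| * (1 / |(n : ℝ)| * (C * (2 * π)))) := by gcongr
    _ = _ := by field_simp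

/-- A twice differentiable function on the circle is uniformly approximated by a partial sum of
its Fourier series. -/
lemma exists_fourier_approx {u : ℂ → ℝ} {φ' φ'' : ℝ → ℝ}
    (h1 : ∀ θ, HasDerivAt (fun θ => u (bpt θ)) (φ' θ) θ) (h2 : ∀ θ, HasDerivAt φ' (φ'' θ) θ)
    (hc : Continuous φ'') :
    ∃ (s : Finset ℤ) (c : ℤ → ℂ), (∀ n ∈ s, -n ∈ s) ∧
      (∀ θ, ‖(u (bpt θ) : ℂ) - ∑ n ∈ s, c n * bpt θ ^ n‖ ≤ 1) ∧
      ∀ k ∈ s, ∫ θ in (0:ℝ)..2 * π,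
        ((u (bpt θ) : ℂ) - ∑ n ∈ s, c n * bpt θ ^ n) * bpt θ ^ k = 0 := by
  classical
  have hcont : Continuous fun θ => u (bpt θ) :=
    continuous_iff_continuousAt.2 fun θ => (h1 θ).continuousAt
  have hper : Function.Periodic (fun θ => (u (bpt θ) : ℂ)) (2 * π) := fun θ => by
    simp only [bpt_add_two_pi]
  have hper' : φ' (2 * π) = φ' 0 := by
    have h := (h1 (0 + 2 * π)).comp_add_const 0 (2 * π)
    simp only [bpt_add_two_pi] at h
    simpa using h.unique (h1 0)
  let F : C(AddCircle (2 * π), ℂ) := ⟨hper.lift, by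
    refine continuous_coinduced_dom.2 ?_
    exact Complex.continuous_ofReal.comp hcont⟩
  have hF : ∀ θ : ℝ, F θ = u (bpt θ) := fun θ => hper.lift_coe θ
  have hsum : Summable (fourierCoeff F) := by
    refine summable_fourierCoeff (φ := fun θ => (u (bpt θ) : ℂ)) (φ' := fun θ => (φ' θ : ℂ))
      (φ'' := fun θ => (φ'' θ : ℂ)) hF (fun θ => (h1 θ).ofReal_comp)
      (fun θ => (h2 θ).ofReal_comp) (Complex.continuous_ofReal.comp hc) ?_ ?_
    · have := hper 0; simpa using this
    · exact_mod_cast hper'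
  have hlim := hasSum_fourier_series_of_summable hsum
  obtain ⟨s₀, hs₀⟩ := Filter.eventually_atTop.1
    ((Metric.tendsto_nhds.1 hlim) 1 one_pos)
  refine ⟨s₀ ∪ s₀.image (fun n => -n), fourierCoeff F, ?_, ?_, ?_⟩
  · intro n hn
    simp only [Finset.mem_union, Finset.mem_image] at hn ⊢
    rcases hn with h | ⟨m, hm, rfl⟩
    · exact Or.inr ⟨n, h, rfl⟩
    · left; simpa using hm
  · intro θ
    have h := hs₀ _ (Finset.subset_union_left (s₂ := s₀.image (fun n => -n)))
    rw [dist_comm, dist_eq_norm] at h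
    refine le_trans (le_of_eq ?_) ((ContinuousMap.norm_coe_le_norm _ (θ : AddCircle (2 * π))).trans h.le)
    simp only [ContinuousMap.sub_apply, ContinuousMap.sum_apply, ContinuousMap.smul_apply,
      smul_eq_mul, hF, fourier_two_pi]
  · intro k hk
    have hk' : -k ∈ s₀ ∪ s₀.image (fun n => -n) := by
      simp only [Finset.mem_union, Finset.mem_image] at hk ⊢
      rcases hk with h | ⟨m, hm, rfl⟩
      · exact Or.inr ⟨k, h, rfl⟩
      · left; simpa using hm
    obtain ⟨s, hs⟩ : ∃ s, s = s₀ ∪ s₀.image (fun n => -n) := ⟨_, rfl⟩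
    rw [← hs] at hk' ⊢
    have hmode : ∀ n, ∫ θ in (0:ℝ)..2 * π, bpt θ ^ n * bpt θ ^ k
        = (2 * π) * (if -k = n then 1 else 0) := by
      intro n
      have h := congrFun (fourierCoeff_fourier (T := 2 * π) n) (-k)
      rw [fourierCoeff_two_pi, Pi.single_apply, neg_neg] at h
      simp only [fourier_two_pi] at h
      rw [← h, Complex.real_smul]
      have : (π : ℂ) ≠ 0 := by exact_mod_cast Real.pi_ne_zero
      push_cast
      field_simp
    have hmain : ∫ θ in (0:ℝ)..2 * π, (u (bpt θ) : ℂ) * bpt θ ^ k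
        = (2 * π) * fourierCoeff F (-k) := by
      have h := fourierCoeff_two_pi F (-k)
      rw [neg_neg] at h
      simp only [hF] at h
      rw [h, Complex.real_smul]
      have : (π : ℂ) ≠ 0 := by exact_mod_cast Real.pi_ne_zero
      push_cast
      field_simp
    simp only [sub_mul, Finset.sum_mul]
    have hi : ∀ n : ℤ, Continuous fun θ => fourierCoeff F n * bpt θ ^ n * bpt θ ^ k := fun n =>
      (continuous_const.mul (continuous_bpt_zpow n)).mul (continuous_bpt_zpow k)
    have hi' : Continuous fun θ => (u (bpt θ) : ℂ) * bpt θ ^ k :=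
      (Complex.continuous_ofReal.comp hcont).mul (continuous_bpt_zpow k)
    rw [intervalIntegral.integral_sub (hi'.intervalIntegrable _ _)
      ((continuous_finsetSum _ fun n _ => hi n).intervalIntegrable _ _),
      intervalIntegral.integral_finsetSum fun n _ => (hi n).intervalIntegrable _ _, hmain]
    simp only [mul_assoc, intervalIntegral.integral_const_mul, hmode]
    simp [hk', mul_comm, mul_left_comm]
    ring

lemma exists_bpt_eq {z : ℂ} (hz : z ∈ bdry) : ∃ θ, bpt θ = z := by
  obtain ⟨θ, hθ⟩ := Complex.norm_eq_one_iff z |>.1 (mem_bdry.1 hz)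
  exact ⟨θ, hθ⟩

/-- A twice differentiable function on the circle is close to the boundary values of the real part
of a polynomial, with an error orthogonal to the normal derivative of the latter. -/
lemma exists_harmonic_approx {u : ℂ → ℝ} {φ' φ'' : ℝ → ℝ}
    (h1 : ∀ θ, HasDerivAt (fun θ => u (bpt θ)) (φ' θ) θ) (h2 : ∀ θ, HasDerivAt φ' (φ'' θ) θ)
    (hc : Continuous φ'') :
    ∃ p : Polynomial ℂ, (∀ z ∈ bdry, |u z - (p.eval z).re| ≤ 1) ∧
      circInt (fun z => (u z - (p.eval z).re) * dot z (conj (p.derivative.eval z))) = 0 := by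
  obtain ⟨s, c, hs, hclose, horth⟩ := exists_fourier_approx h1 h2 hc
  have hcont : Continuous fun θ => u (bpt θ) :=
    continuous_iff_continuousAt.2 fun θ => (h1 θ).continuousAt
  obtain ⟨e, he⟩ : ∃ e : ℤ → ℂ, e = fun n => if 0 ≤ n then c n else conj (c n) := ⟨_, rfl⟩
  obtain ⟨g, hg⟩ : ∃ g : ℝ → ℂ, g = fun θ => (u (bpt θ) : ℂ) - ∑ n ∈ s, c n * bpt θ ^ n := ⟨_, rfl⟩
  have hgc : Continuous g := by
    rw [hg]
    exact (Complex.continuous_ofReal.comp hcont).sub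
      (continuous_finsetSum _ fun n _ => continuous_const.mul (continuous_bpt_zpow n))
  let p : Polynomial ℂ := ∑ n ∈ s, Polynomial.C (e n) * Polynomial.X ^ n.natAbs
  have hconj : ∀ θ (n : ℤ), conj (bpt θ ^ n) = bpt θ ^ (-n) := by
    intro θ n
    rw [map_zpow₀, zpow_neg, ← inv_zpow, Complex.inv_def, Complex.normSq_eq_norm_sq, norm_bpt]
    simp
  have hre : ∀ θ, u (bpt θ) - (p.eval (bpt θ)).re = (g θ).re := by
    intro θ
    rw [hg]
    simp only [p, Polynomial.eval_finsetSum, Polynomial.eval_mul, Polynomial.eval_C,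
      Polynomial.eval_pow, Polynomial.eval_X, Complex.sub_re, Complex.ofReal_re, Complex.re_sum]
    congr 1
    refine Finset.sum_congr rfl fun n _ => ?_
    rcases le_or_gt 0 n with hn | hn
    · rw [he]
      simp only [hn, if_true]
      conv_rhs => rw [← Int.natAbs_of_nonneg hn, zpow_natCast]
      rw [Int.natAbs_of_nonneg hn]
    · rw [he]
      simp only [not_le.2 hn, if_false]
      rw [← Complex.conj_re (c n * _), map_mul, hconj, ← zpow_natCast, Int.ofNat_natAbs_of_nonpos hn.le]
  refine ⟨p, ?_, ?_⟩
  · intro z hz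
    obtain ⟨θ, rfl⟩ := exists_bpt_eq hz
    rw [hre]
    exact (Complex.abs_re_le_norm _).trans (by rw [hg]; exact hclose θ)
  · have hmode : ∀ n ∈ s, ∫ θ in (0:ℝ)..2 * π, ((g θ).re : ℂ) * bpt θ ^ n.natAbs = 0 := by
      have key : ∀ k ∈ s, ∫ θ in (0:ℝ)..2 * π, ((g θ).re : ℂ) * bpt θ ^ k = 0 := by
        intro k hk
        have e1 : ∫ θ in (0:ℝ)..2 * π, g θ * bpt θ ^ k = 0 := by rw [hg]; exact horth k hk
        have e2 : ∫ θ in (0:ℝ)..2 * π, conj (g θ) * bpt θ ^ k = 0 := by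
          have h : ∫ θ in (0:ℝ)..2 * π, g θ * bpt θ ^ (-k) = 0 := by
            rw [hg]; exact horth _ (hs k hk)
          have h' : ∫ θ in (0:ℝ)..2 * π, conj (g θ * bpt θ ^ (-k)) = 0 := by
            rw [intervalIntegral.integral_of_le Real.two_pi_pos.le] at h ⊢
            rw [integral_conj, h, map_zero]
          simpa only [map_mul, hconj, neg_neg] using h'
        have i1 : Continuous fun θ => g θ * bpt θ ^ k := hgc.mul (continuous_bpt_zpow k)
        have i2 : Continuous fun θ => conj (g θ) * bpt θ ^ k :=
          (Complex.continuous_conj.comp hgc).mul (continuous_bpt_zpow k)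
        have e3 : ∀ θ, ((g θ).re : ℂ) * bpt θ ^ k =
            (1 / 2) * (g θ * bpt θ ^ k + conj (g θ) * bpt θ ^ k) := by
          intro θ; rw [Complex.re_eq_add_conj]; ring
        simp only [e3]
        rw [intervalIntegral.integral_const_mul, intervalIntegral.integral_add
          (i1.intervalIntegrable _ _) (i2.intervalIntegrable _ _), e1, e2]
        simp
      intro n hn
      have hmem : ((n.natAbs : ℕ) : ℤ) ∈ s := by
        rcases Int.natAbs_eq n with h | h
        · rwa [← h]
        · have := hs n hn
          rwa [h, neg_neg] at this
      simpa only [zpow_natCast] using key _ hmem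
    have hz : ∀ z : ℂ, dot z (conj (p.derivative.eval z)) =
        (∑ n ∈ s, (e n * n.natAbs) * z ^ n.natAbs).re := by
      intro z
      rw [dot_conj]
      simp only [p, Polynomial.derivative_sum, Polynomial.eval_finsetSum,
        Polynomial.derivative_C_mul, Polynomial.derivative_X_pow, Finset.mul_sum]
      congr 1
      refine Finset.sum_congr rfl fun n _ => ?_
      rcases Nat.eq_zero_or_pos n.natAbs with h | h
      · simp [h]
      · obtain ⟨m, hm⟩ := Nat.exists_eq_succ_of_ne_zero h.ne'
        rw [hm]
        simp [pow_succ]; ring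
    have hintegrand : ∀ θ, (u (bpt θ) - (p.eval (bpt θ)).re) * dot (bpt θ) (conj (p.derivative.eval (bpt θ)))
        = (∑ n ∈ s, (e n * n.natAbs) * (((g θ).re : ℂ) * bpt θ ^ n.natAbs)).re := by
      intro θ
      rw [hre, hz, ← Complex.re_ofReal_mul, Finset.mul_sum]
      congr 1
      refine Finset.sum_congr rfl fun n _ => by ring
    have hi : ∀ n : ℤ, Continuous fun θ =>
        (e n * n.natAbs) * (((g θ).re : ℂ) * bpt θ ^ n.natAbs) := fun n =>
      continuous_const.mul ((Complex.continuous_ofReal.comp (Complex.continuous_re.comp hgc)).mul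
        (continuous_bpt.pow _))
    rw [circInt]
    simp only [hintegrand]
    have hI : IntervalIntegrable (fun θ => ∑ n ∈ s, (e n * n.natAbs) *
        (((g θ).re : ℂ) * bpt θ ^ n.natAbs)) volume 0 (2 * π) :=
      (continuous_finsetSum _ fun n _ => hi n).intervalIntegrable _ _
    have h0 : ∫ θ in (0:ℝ)..2 * π, ∑ n ∈ s, (e n * n.natAbs) *
        (((g θ).re : ℂ) * bpt θ ^ n.natAbs) = 0 := by
      rw [intervalIntegral.integral_finsetSum fun n _ => (hi n).intervalIntegrable _ _]
      refine Finset.sum_eq_zero fun n hn => ?_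
      rw [intervalIntegral.integral_const_mul, hmode n hn, mul_zero]
    have h3 := Complex.reCLM.intervalIntegral_comp_comm hI
    simp only [Complex.reCLM_apply] at h3
    rw [h3, h0, Complex.zero_re]

/-- The data attached to a function on the disc by balancing its boundary values. -/
lemma exists_gauge {u : ℂ → ℝ} {φ' φ'' : ℝ → ℝ}
    (h1 : ∀ θ, HasDerivAt (fun θ => u (bpt θ)) (φ' θ) θ) (h2 : ∀ θ, HasDerivAt φ' (φ'' θ) θ)
    (hc : Continuous φ'') (hu : ContinuousOn u bdry) :
    ∃ (a : ℂ) (Q : ℂ → ℝ) (gQ : ℂ → ℂ) (σ : ℝ), a ∈ odisc ∧ Gauge a Q gQ (Real.exp σ) ∧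
      (∀ z ∈ bdry, |u z - Q z| ≤ 1) ∧ circInt (fun z => (u z - Q z) * dot z (gQ z)) = 0 ∧
      σ - 1 ≤ circInt (fun z => u z * jac a z) / (2 * π) + Real.log (1 - ‖a‖ ^ 2) := by
  obtain ⟨p, hclose, horth⟩ := exists_harmonic_approx h1 h2 hc
  have hd : ∀ q : Polynomial ℂ, ∀ z ∈ cdisc,
      HasDerivAt (fun z => q.eval z) (q.derivative.eval z) z := fun q z _ => q.hasDerivAt z
  obtain ⟨Q, hQ⟩ : ∃ Q : ℂ → ℝ, Q = fun z => (p.eval z).re := ⟨_, rfl⟩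
  have hgrad : IsGrad Q fun z => conj (p.derivative.eval z) := by
    rw [hQ]; exact isGrad_re (hd p) p.derivative.continuous.continuousOn
  have hQc := hgrad.cont
  obtain ⟨a, ha, hmax⟩ := isCompact_cdisc.exists_isMaxOn ⟨0, by simp [mem_cdisc]⟩
    (f := fun z => (1 - ‖z‖ ^ 2) * Real.exp (Q z)) (by fun_prop)
  have hpos : 0 < (1 - ‖a‖ ^ 2) * Real.exp (Q a) := by
    have h := hmax (show (0 : ℂ) ∈ cdisc by simp [mem_cdisc])
    simp only [mem_ofPred_eq, norm_zero] at h
    exact lt_of_lt_of_le (by norm_num; positivity) h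
  have ha1 : 0 < 1 - ‖a‖ ^ 2 := pos_of_mul_pos_left hpos (Real.exp_pos _).le
  have hao : a ∈ odisc := mem_odisc.2 (by nlinarith [norm_nonneg a])
  have hσ : Real.exp (Q a + Real.log (1 - ‖a‖ ^ 2)) = (1 - ‖a‖ ^ 2) * Real.exp (Q a) := by
    rw [Real.exp_add, Real.exp_log ha1, mul_comm]
  refine ⟨a, Q, _, Q a + Real.log (1 - ‖a‖ ^ 2), hao, ⟨hgrad, hasDiv_conj (hd p.derivative),
    fun z hz => hσ ▸ hmax hz⟩, by rw [hQ]; exact hclose, by rw [hQ]; exact horth, ?_⟩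
  have hj := (continuousOn_jac hao).mono bdry_subset_cdisc
  have hQb := hQc.mono bdry_subset_cdisc
  have hP : circInt (fun z => Q z * jac a z) = 2 * π * Q a := by
    rw [hQ]; exact poisson_re hao (hd p)
  have hle : circInt (fun z => Q z * jac a z - jac a z) ≤ circInt (fun z => u z * jac a z) := by
    refine circInt_mono (by fun_prop) (by fun_prop) fun z hz => ?_
    have h := (abs_le.1 (hclose z hz)).1
    have hjz := jac_pos hao (bdry_subset_cdisc hz)
    rw [hQ]
    nlinarith
  rw [circInt_sub (by fun_prop) hj, hP, circInt_jac hao] at hle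
  have hdiv : Q a - 1 ≤ circInt (fun z => u z * jac a z) / (2 * π) := by
    rw [le_div_iff₀ Real.two_pi_pos]; linarith
  linarith

lemma tendsto_exp_mul_affine_atBot {k : ℝ} (hk : 0 < k) (b c : ℝ) :
    Tendsto (fun x => Real.exp (k * x) * (b + c * x)) atBot (𝓝 0) := by
  have h0 := (Real.tendsto_pow_mul_exp_neg_atTop_nhds_zero 0).const_mul b
  have h1 := (Real.tendsto_pow_mul_exp_neg_atTop_nhds_zero 1).const_mul (-(c / k))
  have h := h0.add h1
  simp only [mul_zero, add_zero] at h
  have hlim : Tendsto (fun x : ℝ => -(k * x)) atBot atTop :=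
    tendsto_neg_atBot_atTop.comp (tendsto_id.const_mul_atBot hk)
  refine (h.comp hlim).congr fun x => ?_
  simp only [Function.comp, neg_neg, pow_zero, pow_one]
  field_simp

/-- Upper bounds for the area and boundary length in terms of the gauge parameter. -/
lemma area_length_le {u : ℂ → ℝ} {g : ℂ → ℂ} (hu : IsGrad u g) {a : ℂ} (ha : a ∈ odisc)
    {Q : ℂ → ℝ} {gQ : ℂ → ℂ} {σ : ℝ} (hQ : Gauge a Q gQ (Real.exp σ))
    (hclose : ∀ z ∈ bdry, |u z - Q z| ≤ 1)
    (horth : circInt (fun z => (u z - Q z) * dot z (gQ z)) = 0) {K : ℝ}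
    (hT : dirich (fun z => g z - gradPsi a z) + 8 * π ≤ K - 4 * π * σ) :
    ballInt (fun z => Real.exp (2 * u z)) ≤ Real.exp (K / (3 * π) + 5) *
        (Real.exp (2 / 3 * σ) * ((117 * π + 5 / 2 * K) + -(10 * π) * σ)) ∧
      circInt (fun z => Real.exp (u z)) ≤
        Real.exp 1 * (Real.exp (1 * σ) * ((3 / 4 * K + 4 * π) + -(3 * π) * σ)) := by
  have hadd := hQ.dirich_add_le ha hu hclose horth
  have hD := dirich_nonneg fun z => gQ z - gradPsi a z
  have hV := dirich_nonneg fun z => g z - gQ z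
  have hL := hQ.two_mul_circInt_exp_le ha
  have hA := hQ.eight_mul_ballInt_exp_le ha
  obtain ⟨D, hDd⟩ : ∃ D, D = dirich fun z => gQ z - gradPsi a z := ⟨_, rfl⟩
  obtain ⟨V, hVd⟩ : ∃ V, V = dirich fun z => g z - gQ z := ⟨_, rfl⟩
  rw [← hDd] at hadd hD hL hA
  rw [← hVd] at hadd hV
  have hDB : D ≤ K - 4 * π * σ := by linarith
  have hVB : V ≤ K - 4 * π * σ := by linarith
  have huc := hu.cont
  have hQc := hQ.grad.cont
  have hub := huc.mono bdry_subset_cdisc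
  have hQb := hQc.mono bdry_subset_cdisc
  constructor
  · have hW : ContinuousOn (fun z => Real.exp (2 * Q z)) cdisc := by fun_prop
    have hN := moser_trudinger (v := fun z => u z - Q z) (g := fun z => g z - gQ z)
      (hu.sub hQ.grad) hclose hW (fun z _ => Real.exp_pos _) fun δ hδ y hy =>
        ballInt_kernel_weight_le hW (fun z _ => (Real.exp_pos _).le) (s := Real.exp σ)
          (fun z hz => by
            have h := pow_le_pow_left₀ (mul_nonneg (one_sub_sq_nonneg hz) (Real.exp_pos _).le)
              (hQ.le z hz) 2
            rwa [mul_pow, ← Real.exp_nat_mul] at h) hδ hy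
    rw [← hVd] at hN
    have hcongr : ballInt (fun z => Real.exp (2 * u z)) =
        ballInt fun z => Real.exp (2 * (u z - Q z)) * Real.exp (2 * Q z) :=
      ballInt_congr fun z _ => by rw [← Real.exp_add]; congr 1; ring
    rw [hcongr]
    have hs2 : 0 < Real.exp σ ^ 2 := by positivity
    have hW0 : 0 ≤ ballInt fun z => Real.exp (2 * Q z) :=
      ballInt_nonneg fun z _ => (Real.exp_pos _).le
    calc _ ≤ _ := hN
      _ ≤ Real.exp ((K - 4 * π * σ) / (3 * π) + 5) *
          (Real.exp σ ^ 2 * ((117 * π + 5 / 2 * K) + -(10 * π) * σ)) := by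
        refine mul_le_mul (by gcongr) ?_ (by positivity) (Real.exp_pos _).le
        nlinarith [mul_le_mul_of_nonneg_left hDB hs2.le]
      _ = _ := by
        rw [← mul_assoc, ← mul_assoc, ← Real.exp_nat_mul, ← Real.exp_add, ← Real.exp_add]
        congr 2
        field_simp
        push_cast
        ring
  · have hle : circInt (fun z => Real.exp (u z)) ≤ circInt fun z => Real.exp 1 * Real.exp (Q z) := by
      refine circInt_mono (by fun_prop) (by fun_prop) fun z hz => ?_
      rw [← Real.exp_add, Real.exp_le_exp]
      linarith [(abs_le.1 (hclose z hz)).2]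
    rw [circInt_const_mul] at hle
    refine hle.trans (mul_le_mul_of_nonneg_left ?_ (Real.exp_pos _).le)
    rw [one_mul]
    nlinarith [mul_le_mul_of_nonneg_left hDB (Real.exp_pos σ).le]

/-- A bound on the conformal energy and a prescribed positive total mass bound area and boundary
length from below. -/
theorem exists_area_length_ge (C m : ℝ) (hm : 0 < m) :
    ∃ c > 0, ∀ (u : ℂ → ℝ) (g : ℂ → ℂ) (φ' φ'' : ℝ → ℝ), IsGrad u g →
      (∀ θ, HasDerivAt (fun θ => u (bpt θ)) (φ' θ) θ) → (∀ θ, HasDerivAt φ' (φ'' θ) θ) →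
      Continuous φ'' → confEnergy u g ≤ C →
      ballInt (fun z => Real.exp (2 * u z)) / 2 + circInt (fun z => Real.exp (u z)) = m →
      c ≤ ballInt (fun z => Real.exp (2 * u z)) ∧ c ≤ circInt (fun z => Real.exp (u z)) := by
  obtain ⟨K, hK⟩ : ∃ K, K = 2 * C + 12 * π := ⟨_, rfl⟩
  have hlim := (((tendsto_exp_mul_affine_atBot (show (0:ℝ) < 2 / 3 by norm_num)
    (117 * π + 5 / 2 * K) (-(10 * π))).const_mul (Real.exp (K / (3 * π) + 5))).div_const 2).add
    ((tendsto_exp_mul_affine_atBot (show (0:ℝ) < 1 by norm_num)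
    (3 / 4 * K + 4 * π) (-(3 * π))).const_mul (Real.exp 1))
  simp only [mul_zero, add_zero, zero_div] at hlim
  obtain ⟨σ₀, hσ₀⟩ := eventually_atBot.1 (hlim.eventually_lt_const hm)
  obtain ⟨c₁, hc₁⟩ : ∃ c₁, c₁ = π * Real.exp (2 * (σ₀ - 1) -
    (2 * C - 4 * π * (σ₀ - 1) + π) / (2 * π)) := ⟨_, rfl⟩
  obtain ⟨c₂, hc₂⟩ : ∃ c₂, c₂ = 2 * π * Real.exp (σ₀ - 1) := ⟨_, rfl⟩
  refine ⟨min c₁ c₂, lt_min (hc₁ ▸ by positivity) (hc₂ ▸ by positivity), ?_⟩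
  intro u g φ' φ'' hu h1 h2 hc hE hmass
  obtain ⟨a, Q, gQ, σ, ha, hQ, hclose, horth, hx⟩ :=
    exists_gauge h1 h2 hc (hu.cont.mono bdry_subset_cdisc)
  rw [dirich_sub_gradPsi ha hu] at hE
  have hlen := circInt_exp_ge ha (hu.cont.mono bdry_subset_cdisc)
  have harea := ballInt_exp_ge ha hu
  obtain ⟨I, hI⟩ : ∃ I, I = circInt (fun z => u z * jac a z) := ⟨_, rfl⟩
  rw [← hI] at hE hx hlen harea
  obtain ⟨x, hxd⟩ : ∃ x, x = I / (2 * π) + Real.log (1 - ‖a‖ ^ 2) := ⟨_, rfl⟩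
  have hIx : I + 2 * π * Real.log (1 - ‖a‖ ^ 2) = 2 * π * x := by rw [hxd]; field_simp
  rw [← hxd] at hx hlen harea
  obtain ⟨D, hD⟩ : ∃ D, D = dirich fun z => g z - gradPsi a z := ⟨_, rfl⟩
  rw [← hD] at hE harea
  have hπ := Real.pi_pos
  have hDx : D ≤ 2 * C - 4 * π * x := by linarith
  have hT : D + 8 * π ≤ K - 4 * π * σ := by rw [hK]; nlinarith
  have hup := area_length_le hu ha hQ hclose horth (hD ▸ hT)
  have hσ : σ₀ ≤ σ := by
    by_contra hlt
    have := hσ₀ σ (not_le.1 hlt).le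
    linarith [hup.1, hup.2]
  have hx0 : σ₀ - 1 ≤ x := by linarith
  refine ⟨(min_le_left _ _).trans (le_trans ?_ harea), (min_le_right _ _).trans (le_trans ?_ hlen)⟩
  · rw [hc₁]
    have : D ≤ 2 * C - 4 * π * (σ₀ - 1) := by nlinarith
    gcongr
  · rw [hc₂]
    gcongr

lemma convex_cdisc : Convex ℝ cdisc := convex_closedBall 0 1

lemma interior_cdisc : interior cdisc = odisc := interior_closedBall 0 one_ne_zero

lemma uniqueDiffOn_cdisc : UniqueDiffOn ℝ cdisc :=
  uniqueDiffOn_convex convex_cdisc ⟨0, by rw [interior_cdisc, mem_odisc]; simp⟩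

lemma cdisc_mem_nhds {z : ℂ} (hz : z ∈ odisc) : cdisc ∈ 𝓝 z :=
  mem_of_superset (isOpen_odisc.mem_nhds hz) odisc_subset_cdisc

section FlowDom

variable {T : ℝ≥0∞}

lemma flowDom_eq (T : ℝ≥0∞) : flowDom T = Ici 0 ∩ ENNReal.ofReal ⁻¹' Iio T := rfl

lemma ordConnected_flowDom (T : ℝ≥0∞) : (flowDom T).OrdConnected :=
  ⟨fun _ hx _ hy _ hz => ⟨hx.1.trans hz.1,
    lt_of_le_of_lt (ENNReal.ofReal_le_ofReal hz.2) hy.2⟩⟩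

lemma flowDom_mem_nhds {t : ℝ} (ht : t ∈ flowDom T) (h0 : 0 < t) : flowDom T ∈ 𝓝 t := by
  rw [flowDom_eq]
  exact inter_mem (Ici_mem_nhds h0)
    (ENNReal.continuous_ofReal.continuousAt.preimage_mem_nhds (Iio_mem_nhds ht.2))

lemma zero_mem_flowDom (hT : 0 < T) : (0 : ℝ) ∈ flowDom T := ⟨le_rfl, by simpa using hT⟩

lemma Icc_subset_flowDom {t : ℝ} (hT : 0 < T) (ht : t ∈ flowDom T) : Icc 0 t ⊆ flowDom T :=
  (ordConnected_flowDom T).out (zero_mem_flowDom hT) ht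

lemma exists_pos_mem_flowDom (hT : 0 < T) : ∃ t ∈ flowDom T, 0 < t := by
  have h : ∀ᶠ t in 𝓝[>] (0 : ℝ), ENNReal.ofReal t < T := by
    refine (ENNReal.continuous_ofReal.continuousAt.mono_left nhdsWithin_le_nhds).eventually_lt_const ?_
    simpa using hT
  obtain ⟨t, ht, h0⟩ := (h.and self_mem_nhdsWithin).exists
  exact ⟨t, ⟨le_of_lt h0, ht⟩, h0⟩

lemma uniqueDiffOn_flowDom (hT : 0 < T) : UniqueDiffOn ℝ (flowDom T) := by
  obtain ⟨t, ht, h0⟩ := exists_pos_mem_flowDom hT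
  exact uniqueDiffOn_convex (ordConnected_flowDom T).convex
    ⟨t, mem_interior_iff_mem_nhds.2 (flowDom_mem_nhds ht h0)⟩

end FlowDom

section Jets

/-- The space-time differential of `u` on `cdisc × D`. -/
def jet (u : ℂ → ℝ → ℝ) (D : Set ℝ) (p : ℂ × ℝ) : ℂ × ℝ →L[ℝ] ℝ :=
  fderivWithin ℝ (fun p : ℂ × ℝ => u p.1 p.2) (cdisc ×ˢ D) p

/-- The second space-time differential of `u` on `cdisc × D`. -/
def hess (u : ℂ → ℝ → ℝ) (D : Set ℝ) (p : ℂ × ℝ) : ℂ × ℝ →L[ℝ] ℂ × ℝ →L[ℝ] ℝ :=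
  fderivWithin ℝ (jet u D) (cdisc ×ˢ D) p

/-- The spatial gradient. -/
def spGrad (u : ℂ → ℝ → ℝ) (D : Set ℝ) (z : ℂ) (t : ℝ) : ℂ :=
  ⟨jet u D (z, t) (1, 0), jet u D (z, t) (Complex.I, 0)⟩

/-- The time derivative. -/
def vel (u : ℂ → ℝ → ℝ) (D : Set ℝ) (z : ℂ) (t : ℝ) : ℝ := jet u D (z, t) (0, 1)

/-- The spatial gradient of the time derivative. -/
def velGrad (u : ℂ → ℝ → ℝ) (D : Set ℝ) (z : ℂ) (t : ℝ) : ℂ :=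
  ⟨hess u D (z, t) (1, 0) (0, 1), hess u D (z, t) (Complex.I, 0) (0, 1)⟩

/-- The spatial Laplacian. -/
def spLap (u : ℂ → ℝ → ℝ) (D : Set ℝ) (z : ℂ) (t : ℝ) : ℝ :=
  hess u D (z, t) (1, 0) (1, 0) + hess u D (z, t) (Complex.I, 0) (Complex.I, 0)

lemma clm_eq_dotL (L : ℂ →L[ℝ] ℝ) : L = dotL ⟨L 1, L Complex.I⟩ := by
  ext z
  have h : z = z.re • (1 : ℂ) + z.im • Complex.I := by
    apply Complex.ext <;> simp
  rw [dotL_apply]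
  conv_lhs => rw [h]
  rw [map_add, map_smul, map_smul]
  simp only [dot, smul_eq_mul]
  ring

variable {u : ℂ → ℝ → ℝ} {T : ℝ≥0∞} (hT : 0 < T)
  (hu : ContDiffOn ℝ (⊤ : ℕ∞) (fun p : ℂ × ℝ => u p.1 p.2) (cdisc ×ˢ flowDom T))
include hT

lemma uniqueDiffOn_cdisc_prod : UniqueDiffOn ℝ (cdisc ×ˢ flowDom T) :=
  uniqueDiffOn_cdisc.prod (uniqueDiffOn_flowDom hT)

lemma closure_interior_cdisc_prod : cdisc ×ˢ flowDom T ⊆ closure (interior (cdisc ×ˢ flowDom T)) := by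
  obtain ⟨t, ht, h0⟩ := exists_pos_mem_flowDom hT
  have hc : Convex ℝ (cdisc ×ˢ flowDom T) := convex_cdisc.prod (ordConnected_flowDom T).convex
  rw [hc.closure_interior_eq_closure_of_nonempty_interior]
  · exact subset_closure
  · refine ⟨(0, t), mem_interior_iff_mem_nhds.2 (prod_mem_nhds (cdisc_mem_nhds ?_)
      (flowDom_mem_nhds ht h0))⟩
    simp [mem_odisc]

include hu

lemma contDiffOn_jet : ContDiffOn ℝ (⊤ : ℕ∞) (jet u (flowDom T)) (cdisc ×ˢ flowDom T) :=
  hu.fderivWithin (uniqueDiffOn_cdisc_prod hT) (by simp)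

lemma contDiffOn_hess : ContDiffOn ℝ (⊤ : ℕ∞) (hess u (flowDom T)) (cdisc ×ˢ flowDom T) :=
  (contDiffOn_jet hT hu).fderivWithin (uniqueDiffOn_cdisc_prod hT) (by simp)

omit hT in
lemma hasFDerivWithinAt_jet {p : ℂ × ℝ} (hp : p ∈ cdisc ×ˢ flowDom T) :
    HasFDerivWithinAt (fun p : ℂ × ℝ => u p.1 p.2) (jet u (flowDom T) p) (cdisc ×ˢ flowDom T) p :=
  (hu.differentiableOn (by simp) p hp).hasFDerivWithinAt

lemma hasFDerivWithinAt_hess {p : ℂ × ℝ} (hp : p ∈ cdisc ×ˢ flowDom T) (e : ℂ × ℝ) :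
    HasFDerivWithinAt (fun p => jet u (flowDom T) p e) ((hess u (flowDom T) p).flip e)
      (cdisc ×ˢ flowDom T) p := by
  have h := ((contDiffOn_jet hT hu).differentiableOn (by simp) p hp).hasFDerivWithinAt
  refine ((ContinuousLinearMap.apply ℝ ℝ e).hasFDerivAt.comp_hasFDerivWithinAt p h).congr_fderiv ?_
  ext <;> simp [hess]

lemma hess_symm {p : ℂ × ℝ} (hp : p ∈ cdisc ×ˢ flowDom T) (e e' : ℂ × ℝ) :
    hess u (flowDom T) p e e' = hess u (flowDom T) p e' e :=
  (hu p hp).isSymmSndFDerivWithinAt 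
    (by simpa using WithTop.coe_le_coe.2 (le_top (a := (2 : ℕ∞))))
    (uniqueDiffOn_cdisc_prod hT)
    (closure_interior_cdisc_prod hT hp) hp e e'

omit hT hu in
/-- A function on `cdisc × [0, T)` restricts to a function on time slices. -/
lemma slice_fderivWithin {F : ℂ × ℝ → ℝ} {L : ℂ × ℝ →L[ℝ] ℝ} {z : ℂ} {t : ℝ}
    (ht : t ∈ flowDom T) (h : HasFDerivWithinAt F L (cdisc ×ˢ flowDom T) (z, t)) :
    HasFDerivWithinAt (fun w => F (w, t)) (dotL ⟨L (1, 0), L (Complex.I, 0)⟩) cdisc z := by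
  have h2 : HasFDerivWithinAt (fun w : ℂ => (w, t)) (ContinuousLinearMap.inl ℝ ℂ ℝ) cdisc z :=
    (hasFDerivAt_prodMk_left z t).hasFDerivWithinAt
  have hm : MapsTo (fun w : ℂ => (w, t)) cdisc (cdisc ×ˢ flowDom T) := fun w hw => ⟨hw, ht⟩
  have h3 := HasFDerivWithinAt.comp z h h2 hm
  refine h3.congr_fderiv ?_
  rw [clm_eq_dotL (L.comp _)]
  simp

omit hT hu in
lemma slice_hasDerivAt {F : ℂ × ℝ → ℝ} {L : ℂ × ℝ →L[ℝ] ℝ} {z : ℂ} {t : ℝ} (hz : z ∈ cdisc)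
    (ht : t ∈ flowDom T) (h0 : 0 < t) (h : HasFDerivWithinAt F L (cdisc ×ˢ flowDom T) (z, t)) :
    HasDerivAt (fun s => F (z, s)) (L (0, 1)) t := by
  have h2 : HasFDerivWithinAt (fun s : ℝ => (z, s)) (ContinuousLinearMap.inr ℝ ℂ ℝ) (flowDom T) t :=
    (hasFDerivAt_prodMk_right z t).hasFDerivWithinAt
  have hm : MapsTo (fun s : ℝ => (z, s)) (flowDom T) (cdisc ×ˢ flowDom T) := fun w hw => ⟨hz, hw⟩
  have h3 := HasFDerivWithinAt.comp t h h2 hm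
  have h4 := (h3.hasFDerivAt (flowDom_mem_nhds ht h0)).hasDerivAt
  exact h4.congr_deriv (by simp)

omit hT hu in
lemma continuousOn_mk {X : Type*} [TopologicalSpace X] {s : Set X} {a b : X → ℝ}
    (ha : ContinuousOn a s) (hb : ContinuousOn b s) :
    ContinuousOn (fun x => (⟨a x, b x⟩ : ℂ)) s :=
  Complex.equivRealProdCLM.symm.continuous.comp_continuousOn (ha.prodMk hb)

lemma continuousOn_jet_apply (e : ℂ × ℝ) :
    ContinuousOn (fun p => jet u (flowDom T) p e) (cdisc ×ˢ flowDom T) :=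
  (contDiffOn_jet hT hu).continuousOn.clm_apply continuousOn_const

lemma continuousOn_hess_apply (e e' : ℂ × ℝ) :
    ContinuousOn (fun p => hess u (flowDom T) p e e') (cdisc ×ˢ flowDom T) :=
  ((contDiffOn_hess hT hu).continuousOn.clm_apply continuousOn_const).clm_apply continuousOn_const

lemma continuousOn_spGrad :
    ContinuousOn (fun p : ℂ × ℝ => spGrad u (flowDom T) p.1 p.2) (cdisc ×ˢ flowDom T) :=
  continuousOn_mk (continuousOn_jet_apply hT hu _) (continuousOn_jet_apply hT hu _)

lemma continuousOn_velGrad :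
    ContinuousOn (fun p : ℂ × ℝ => velGrad u (flowDom T) p.1 p.2) (cdisc ×ˢ flowDom T) :=
  continuousOn_mk (continuousOn_hess_apply hT hu _ _) (continuousOn_hess_apply hT hu _ _)

lemma continuousOn_vel :
    ContinuousOn (fun p : ℂ × ℝ => vel u (flowDom T) p.1 p.2) (cdisc ×ˢ flowDom T) :=
  continuousOn_jet_apply hT hu _

lemma continuousOn_spLap :
    ContinuousOn (fun p : ℂ × ℝ => spLap u (flowDom T) p.1 p.2) (cdisc ×ˢ flowDom T) :=
  (continuousOn_hess_apply hT hu _ _).add (continuousOn_hess_apply hT hu _ _)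

omit hT hu in
lemma ContinuousOn.slice {Y : Type*} [TopologicalSpace Y] {F : ℂ × ℝ → Y} {D : Set ℝ}
    {t : ℝ} (h : ContinuousOn F (cdisc ×ˢ D)) (ht : t ∈ D) :
    ContinuousOn (fun z => F (z, t)) cdisc :=
  h.comp (by fun_prop) fun _ hz => ⟨hz, ht⟩

omit hT in
lemma hasFDerivWithinAt_slice {z : ℂ} {t : ℝ} (hz : z ∈ cdisc) (ht : t ∈ flowDom T) :
    HasFDerivWithinAt (fun w => u w t) (dotL (spGrad u (flowDom T) z t)) cdisc z :=
  slice_fderivWithin ht (hasFDerivWithinAt_jet hu (p := (z, t)) ⟨hz, ht⟩)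

lemma isGrad_slice {t : ℝ} (ht : t ∈ flowDom T) :
    IsGrad (fun z => u z t) fun z => spGrad u (flowDom T) z t :=
  ⟨hu.continuousOn.slice ht, (continuousOn_spGrad hT hu).slice ht, fun _ hz =>
    (hasFDerivWithinAt_slice hu (odisc_subset_cdisc hz) ht).hasFDerivAt (cdisc_mem_nhds hz)⟩

omit hT in
lemma nder_slice {z : ℂ} {t : ℝ} (hz : z ∈ cdisc) (ht : t ∈ flowDom T) :
    nder (fun w => u w t) z = dot z (spGrad u (flowDom T) z t) := by
  rw [nder, (hasFDerivWithinAt_slice hu hz ht).fderivWithin (uniqueDiffOn_cdisc z hz),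
    dotL_apply, dot_comm]

lemma isGrad_vel {t : ℝ} (ht : t ∈ flowDom T) :
    IsGrad (fun z => vel u (flowDom T) z t) fun z => velGrad u (flowDom T) z t :=
  ⟨(continuousOn_vel hT hu).slice ht, (continuousOn_velGrad hT hu).slice ht, fun _ hz =>
    (slice_fderivWithin ht (hasFDerivWithinAt_hess hT hu (p := (_, t))
      ⟨odisc_subset_cdisc hz, ht⟩ (0, 1))).hasFDerivAt (cdisc_mem_nhds hz)⟩

lemma lapW_slice {z : ℂ} {t : ℝ} (hz : z ∈ cdisc) (ht : t ∈ flowDom T) :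
    lapW (fun w => u w t) z = spLap u (flowDom T) z t := by
  have h : ∀ e : ℂ, fderivWithin ℝ (fun x => fderivWithin ℝ (fun w => u w t) cdisc x e) cdisc z e =
      hess u (flowDom T) (z, t) (e, 0) (e, 0) := by
    intro e
    have h1 : ∀ x ∈ cdisc, fderivWithin ℝ (fun w => u w t) cdisc x e =
        jet u (flowDom T) (x, t) (e, 0) := by
      intro x hx
      rw [(hasFDerivWithinAt_slice hu hx ht).fderivWithin (uniqueDiffOn_cdisc x hx)]
      have h2 := congrArg (fun M : ℂ →L[ℝ] ℝ => M e)
        (clm_eq_dotL ((jet u (flowDom T) (x, t)).comp (ContinuousLinearMap.inl ℝ ℂ ℝ)))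
      simpa [spGrad] using h2.symm
    rw [fderivWithin_congr h1 (h1 z hz), (slice_fderivWithin ht (hasFDerivWithinAt_hess hT hu
      (p := (z, t)) ⟨hz, ht⟩ (e, 0))).fderivWithin (uniqueDiffOn_cdisc z hz)]
    have h2 := congrArg (fun M : ℂ →L[ℝ] ℝ => M e)
      (clm_eq_dotL (((hess u (flowDom T) (z, t)).flip (e, 0)).comp (ContinuousLinearMap.inl ℝ ℂ ℝ)))
    simpa using h2.symm
  rw [lapW, h, h, spLap]

lemma hasDiv_slice {t : ℝ} (ht : t ∈ flowDom T) :
    HasDiv (fun z => spGrad u (flowDom T) z t) fun z => spLap u (flowDom T) z t := by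
  refine ⟨(continuousOn_spGrad hT hu).slice ht, (continuousOn_spLap hT hu).slice ht, fun z hz => ?_⟩
  have h : ∀ e : ℂ × ℝ, _ := fun e => (slice_fderivWithin ht (hasFDerivWithinAt_hess hT hu
    (p := (z, t)) ⟨odisc_subset_cdisc hz, ht⟩ e)).hasFDerivAt (cdisc_mem_nhds hz)
  refine ⟨_, (Complex.equivRealProdCLM.symm : ℝ × ℝ →L[ℝ] ℂ).hasFDerivAt.comp z
    ((h (1, 0)).prodMk (h (Complex.I, 0))), ?_⟩
  simp [dot, spLap]

omit hT in
lemma hasDerivAt_vel {z : ℂ} {t : ℝ} (hz : z ∈ cdisc) (ht : t ∈ flowDom T) (h0 : 0 < t) :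
    HasDerivAt (u z) (vel u (flowDom T) z t) t :=
  slice_hasDerivAt hz ht h0 (hasFDerivWithinAt_jet hu (p := (z, t)) ⟨hz, ht⟩)

lemma hasDerivAt_dot_spGrad {z : ℂ} {t : ℝ} (hz : z ∈ cdisc) (ht : t ∈ flowDom T) (h0 : 0 < t) :
    HasDerivAt (fun s => dot (spGrad u (flowDom T) z s) (spGrad u (flowDom T) z s))
      (2 * dot (velGrad u (flowDom T) z t) (spGrad u (flowDom T) z t)) t := by
  have h : ∀ e : ℂ × ℝ, _ := fun e => slice_hasDerivAt hz ht h0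
    (hasFDerivWithinAt_hess hT hu (p := (z, t)) ⟨hz, ht⟩ e)
  have hs : ∀ e : ℂ × ℝ, (hess u (flowDom T) (z, t)).flip e (0, 1) =
      hess u (flowDom T) (z, t) e (0, 1) := fun e => hess_symm hT hu (p := (z, t)) ⟨hz, ht⟩ _ _
  simp only [hs] at h
  refine (((h (1, 0)).mul (h (1, 0))).add ((h (Complex.I, 0)).mul (h (Complex.I, 0)))).congr_deriv ?_
  simp only [dot, velGrad, spGrad]
  ring

end Jets

/-- `F'` is the time derivative of `F` on `K × D` for positive times, both being continuous. -/
structure IsRate (K : Set ℂ) (D : Set ℝ) (F F' : ℂ → ℝ → ℝ) : Prop where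
  cont : ContinuousOn (fun p : ℂ × ℝ => F p.1 p.2) (K ×ˢ D)
  contRate : ContinuousOn (fun p : ℂ × ℝ => F' p.1 p.2) (K ×ˢ D)
  deriv : ∀ z ∈ K, ∀ t ∈ D, 0 < t → HasDerivAt (F z) (F' z t) t

namespace IsRate

variable {K : Set ℂ} {D : Set ℝ} {F F' G G' : ℂ → ℝ → ℝ} {T : ℝ≥0∞}

lemma mono {K' : Set ℂ} (h : IsRate K D F F') (hK : K' ⊆ K) : IsRate K' D F F' :=
  ⟨h.cont.mono (prod_mono hK le_rfl), h.contRate.mono (prod_mono hK le_rfl),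
    fun z hz => h.deriv z (hK hz)⟩

lemma exp (h : IsRate K D F F') :
    IsRate K D (fun z t => Real.exp (F z t)) fun z t => F' z t * Real.exp (F z t) :=
  ⟨Real.continuous_exp.comp_continuousOn h.cont,
    h.contRate.mul (Real.continuous_exp.comp_continuousOn h.cont), fun z hz t ht h0 => by
    rw [mul_comm]; exact (h.deriv z hz t ht h0).exp⟩

lemma weight {w : ℂ → ℝ} (hw : ContinuousOn w K) (h : IsRate K D F F') :
    IsRate K D (fun z t => w z * F z t) fun z t => w z * F' z t := by
  have hw' : ContinuousOn (fun p : ℂ × ℝ => w p.1) (K ×ˢ D) :=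
    hw.comp continuousOn_fst fun p hp => hp.1
  exact ⟨hw'.mul h.cont, hw'.mul h.contRate, fun z hz t ht h0 =>
    (h.deriv z hz t ht h0).const_mul _⟩

lemma continuousOn_slice (h : IsRate K D F F') {t : ℝ} (ht : t ∈ D) :
    ContinuousOn (fun z => F z t) K :=
  h.cont.comp (f := fun z => (z, t)) (by fun_prop) fun _ hz => ⟨hz, ht⟩

lemma continuousOn_slice_rate (h : IsRate K D F F') {t : ℝ} (ht : t ∈ D) :
    ContinuousOn (fun z => F' z t) K :=
  h.contRate.comp (f := fun z => (z, t)) (by fun_prop) fun _ hz => ⟨hz, ht⟩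

lemma exists_local_bound (h : IsRate K (flowDom T) F F') (hK : IsCompact K) {t : ℝ}
    (ht : t ∈ flowDom T) (h0 : 0 < t) :
    ∃ s ∈ 𝓝 t, s ⊆ flowDom T ∧ (∀ r ∈ s, 0 < r) ∧ ∃ C, ∀ z ∈ K, ∀ r ∈ s, ‖F' z r‖ ≤ C := by
  obtain ⟨s, hs, hsub, hcomp⟩ := local_compact_nhds
    (inter_mem (flowDom_mem_nhds ht h0) (Ioi_mem_nhds h0))
  obtain ⟨C, hC⟩ := (hK.prod hcomp).exists_bound_of_continuousOn
    (h.contRate.mono (prod_mono le_rfl fun r hr => (hsub hr).1))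
  exact ⟨s, hs, fun r hr => (hsub hr).1, fun r hr => (hsub hr).2, C,
    fun z hz r hr => hC (z, r) ⟨hz, hr⟩⟩

lemma hasDerivAt_ballInt (h : IsRate cdisc (flowDom T) F F') {t : ℝ} (ht : t ∈ flowDom T)
    (h0 : 0 < t) : HasDerivAt (fun t => ballInt fun z => F z t) (ballInt fun z => F' z t) t := by
  obtain ⟨s, hs, hsD, hpos, C, hC⟩ := h.exists_local_bound isCompact_cdisc ht h0
  refine (hasDerivAt_integral_of_dominated_loc_of_deriv_le (F := fun t z => F z t)
    (F' := fun t z => F' z t) (bound := fun _ => C) (μ := volume.restrict odisc) hs ?_ ?_ ?_ ?_ ?_ ?_).2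
  · filter_upwards [hs] with r hr
    exact (integrableOn_odisc (h.continuousOn_slice (hsD hr))).aestronglyMeasurable
  · exact integrableOn_odisc (h.continuousOn_slice ht)
  · exact (integrableOn_odisc (h.continuousOn_slice_rate ht)).aestronglyMeasurable
  · filter_upwards [ae_restrict_mem measurableSet_odisc] with z hz r hr
    exact hC z (odisc_subset_cdisc hz) r hr
  · exact integrableOn_odisc continuousOn_const
  · filter_upwards [ae_restrict_mem measurableSet_odisc] with z hz r hr
    exact h.deriv z (odisc_subset_cdisc hz) r (hsD hr) (hpos r hr)

lemma hasDerivAt_circInt (h : IsRate bdry (flowDom T) F F') {t : ℝ} (ht : t ∈ flowDom T)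
    (h0 : 0 < t) : HasDerivAt (fun t => circInt fun z => F z t) (circInt fun z => F' z t) t := by
  obtain ⟨s, hs, hsD, hpos, C, hC⟩ := h.exists_local_bound (isCompact_sphere 0 1) ht h0
  refine (intervalIntegral.hasDerivAt_integral_of_dominated_loc_of_deriv_le
    (F := fun t θ => F (bpt θ) t)
    (F' := fun t θ => F' (bpt θ) t) (bound := fun _ => C) hs ?_ ?_ ?_ ?_ ?_ ?_).2
  · filter_upwards [hs] with r hr
    exact (continuous_comp_bpt (h.continuousOn_slice (hsD hr))).aestronglyMeasurable
  · exact (continuous_comp_bpt (h.continuousOn_slice ht)).intervalIntegrable _ _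
  · exact (continuous_comp_bpt (h.continuousOn_slice_rate ht)).aestronglyMeasurable
  · exact ae_of_all _ fun θ _ r hr => hC _ (bpt_mem_bdry θ) r hr
  · exact continuous_const.intervalIntegrable _ _
  · exact ae_of_all _ fun θ _ r hr => h.deriv _ (bpt_mem_bdry θ) r (hsD hr) (hpos r hr)

lemma continuousOn_ballInt_Icc (h : IsRate cdisc D F F') {t : ℝ} (ht : Icc 0 t ⊆ D) :
    ContinuousOn (fun s => ballInt fun z => F z s) (Icc 0 t) :=
  continuousOn_ballInt (F := fun s z => F z s) isCompact_Icc
    (h.cont.comp (f := fun p : ℝ × ℂ => (p.2, p.1)) (by fun_prop) fun _ hp => ⟨hp.2, ht hp.1⟩)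

lemma continuousOn_circInt_Icc (h : IsRate bdry D F F') {t : ℝ} (ht : Icc 0 t ⊆ D) :
    ContinuousOn (fun s => circInt fun z => F z s) (Icc 0 t) := by
  have hF : ContinuousOn (fun p : ℂ × ℝ => F p.1 p.2) (bdry ×ˢ Icc 0 t) :=
    h.cont.mono (prod_mono le_rfl ht)
  obtain ⟨C, hC⟩ := ((isCompact_sphere (0:ℂ) 1).prod isCompact_Icc).exists_bound_of_continuousOn hF
  intro s hs
  refine intervalIntegral.continuousWithinAt_of_dominated_interval (bound := fun _ => C) ?_ ?_
    (continuous_const.intervalIntegrable _ _) ?_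
  · filter_upwards [self_mem_nhdsWithin] with r hr
    exact (continuous_comp_bpt (h.continuousOn_slice (ht hr))).aestronglyMeasurable
  · filter_upwards [self_mem_nhdsWithin] with r hr
    exact ae_of_all _ fun θ _ => hC (bpt θ, r) ⟨bpt_mem_bdry θ, hr⟩
  · refine ae_of_all _ fun θ _ => ?_
    exact hF.comp (f := fun r => (bpt θ, r)) (by fun_prop) (fun r hr => ⟨bpt_mem_bdry θ, hr⟩) s hs

end IsRate

/-- The energy functional of the flow. -/
def flowEnergy (f j : ℂ → ℝ) (T : ℝ≥0∞) (u : ℂ → ℝ → ℝ) (ρ : ℝ → ℝ) (t : ℝ) : ℝ :=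
  confEnergy (fun z => u z t) (fun z => spGrad u (flowDom T) z t) +
    ρ t * Real.log (alphaC f u ρ t) + 2 * (π - ρ t) * Real.log (betaC j u ρ t) + ρ t

/-- The total mass of the flow. -/
def flowMass (u : ℂ → ℝ → ℝ) (t : ℝ) : ℝ :=
  ballInt (fun z => Real.exp (2 * u z t)) / 2 + circInt (fun z => Real.exp (u z t))

section Flow

variable {f j : ℂ → ℝ} {T : ℝ≥0∞} {u : ℂ → ℝ → ℝ} {ρ : ℝ → ℝ}

lemma isRate_flow (hT : 0 < T)
    (hu : ContDiffOn ℝ (⊤ : ℕ∞) (fun p : ℂ × ℝ => u p.1 p.2) (cdisc ×ˢ flowDom T)) :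
    IsRate cdisc (flowDom T) u (vel u (flowDom T)) :=
  ⟨hu.continuousOn, continuousOn_vel hT hu, fun _ hz _ ht h0 => hasDerivAt_vel hu hz ht h0⟩

lemma isRate_exp_two (hT : 0 < T)
    (hu : ContDiffOn ℝ (⊤ : ℕ∞) (fun p : ℂ × ℝ => u p.1 p.2) (cdisc ×ˢ flowDom T)) :
    IsRate cdisc (flowDom T) (fun z t => Real.exp (2 * u z t))
      fun z t => 2 * vel u (flowDom T) z t * Real.exp (2 * u z t) :=
  ((isRate_flow hT hu).weight (w := fun _ => 2) continuousOn_const).exp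

lemma isRate_exp_bdry (hT : 0 < T)
    (hu : ContDiffOn ℝ (⊤ : ℕ∞) (fun p : ℂ × ℝ => u p.1 p.2) (cdisc ×ˢ flowDom T)) :
    IsRate bdry (flowDom T) (fun z t => Real.exp (u z t))
      fun z t => vel u (flowDom T) z t * Real.exp (u z t) :=
  (isRate_flow hT hu).exp.mono bdry_subset_cdisc

lemma isRate_dirich (hT : 0 < T)
    (hu : ContDiffOn ℝ (⊤ : ℕ∞) (fun p : ℂ × ℝ => u p.1 p.2) (cdisc ×ˢ flowDom T)) :
    IsRate cdisc (flowDom T) (fun z t => dot (spGrad u (flowDom T) z t) (spGrad u (flowDom T) z t))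
      fun z t => 2 * dot (velGrad u (flowDom T) z t) (spGrad u (flowDom T) z t) :=
  ⟨(continuousOn_spGrad hT hu).dot' (continuousOn_spGrad hT hu),
    continuousOn_const.mul ((continuousOn_velGrad hT hu).dot' (continuousOn_spGrad hT hu)),
    fun _ hz _ ht h0 => hasDerivAt_dot_spGrad hT hu hz ht h0⟩

variable (hT : 0 < T) (h : IsFlow f j T u ρ)

include hT h in
lemma IsFlow.interior_eq {t : ℝ} (ht : t ∈ flowDom T) (h0 : 0 < t) {z : ℂ} (hz : z ∈ odisc) :
    vel u (flowDom T) z t * Real.exp (2 * u z t) =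
      alphaC f u ρ t * (f z * Real.exp (2 * u z t)) + spLap u (flowDom T) z t := by
  have h1 := h.2.2.2.1 t ht h0 z hz
  have hz' := odisc_subset_cdisc hz
  rw [(hasDerivAt_vel h.1 hz' ht h0).deriv, lapW_slice hT h.1 hz' ht, Real.exp_neg] at h1
  rw [h1]
  have := (Real.exp_pos (2 * u z t)).ne'
  field_simp

include h in
lemma IsFlow.bdry_eq {t : ℝ} (ht : t ∈ flowDom T) (h0 : 0 < t) {z : ℂ} (hz : z ∈ bdry) :
    vel u (flowDom T) z t * Real.exp (u z t) =
      betaC j u ρ t * (j z * Real.exp (u z t)) - dot z (spGrad u (flowDom T) z t) - 1 := by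
  have h1 := h.2.2.2.2.1 t ht h0 z hz
  have hz' := bdry_subset_cdisc hz
  rw [(hasDerivAt_vel h.1 hz' ht h0).deriv, nder_slice h.1 hz' ht, Real.exp_neg] at h1
  rw [h1]
  have := (Real.exp_pos (u z t)).ne'
  field_simp
  ring

include hT h

lemma IsFlow.ballInt_weight_pos {w : ℂ → ℝ} (hw : ContinuousOn w cdisc)
    (hpos : ∀ z ∈ cdisc, 0 < w z) {t : ℝ} (ht : t ∈ flowDom T) :
    0 < ballInt fun z => w z * Real.exp (2 * u z t) :=
  ballInt_pos (hw.mul ((isRate_exp_two hT h.1).continuousOn_slice ht)) fun z hz =>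
    mul_pos (hpos z hz) (Real.exp_pos _)

lemma IsFlow.circInt_weight_pos {w : ℂ → ℝ} (hw : ContinuousOn w bdry)
    (hpos : ∀ z ∈ bdry, 0 < w z) {t : ℝ} (ht : t ∈ flowDom T) :
    0 < circInt fun z => w z * Real.exp (u z t) :=
  circInt_pos (hw.mul ((isRate_exp_bdry hT h.1).continuousOn_slice ht)) fun z hz =>
    mul_pos (hpos z hz) (Real.exp_pos _)

lemma IsFlow.hasDerivAt_mass (hf : ContinuousOn f cdisc) (hfpos : ∀ z ∈ cdisc, 0 < f z)
    (hj : ContinuousOn j bdry) (hjpos : ∀ z ∈ bdry, 0 < j z) {t : ℝ} (ht : t ∈ flowDom T)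
    (h0 : 0 < t) : HasDerivAt (flowMass u) 0 t := by
  have hd := (((isRate_exp_two hT h.1).hasDerivAt_ballInt ht h0).div_const 2).add
    ((isRate_exp_bdry hT h.1).hasDerivAt_circInt ht h0)
  refine hd.congr_deriv ?_
  have hF := (h.ballInt_weight_pos hT hf hfpos ht).ne'
  have hJ := (h.circInt_weight_pos hT hj hjpos ht).ne'
  have he := (isRate_exp_two hT h.1).continuousOn_slice ht
  have he' := (isRate_exp_bdry hT h.1).continuousOn_slice ht
  have hdiv := hasDiv_slice hT h.1 ht
  have hdotc : ContinuousOn (fun z => dot z (spGrad u (flowDom T) z t)) bdry :=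
    (continuousOn_id.dot' hdiv.cont).mono bdry_subset_cdisc
  have hc1 : ContinuousOn (fun z => alphaC f u ρ t * (f z * Real.exp (2 * u z t))) cdisc :=
    continuousOn_const.mul (hf.mul he)
  have hc2 : ContinuousOn (fun z => betaC j u ρ t * (j z * Real.exp (u z t))) bdry :=
    continuousOn_const.mul (hj.mul he')
  have hc3 : ContinuousOn (fun z => betaC j u ρ t * (j z * Real.exp (u z t)) -
      dot z (spGrad u (flowDom T) z t)) bdry := hc2.sub hdotc
  have e1 : ballInt (fun z => 2 * vel u (flowDom T) z t * Real.exp (2 * u z t)) =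
      2 * (alphaC f u ρ t * ballInt (fun z => f z * Real.exp (2 * u z t)) +
        circInt fun z => dot z (spGrad u (flowDom T) z t)) := by
    rw [← hdiv.ballInt_eq, ← ballInt_const_mul (alphaC f u ρ t), ← ballInt_add hc1 hdiv.contDiv,
      ← ballInt_const_mul]
    exact ballInt_congr fun z hz => by rw [mul_assoc, h.interior_eq hT ht h0 hz]
  have e2 : circInt (fun z => vel u (flowDom T) z t * Real.exp (u z t)) =
      betaC j u ρ t * circInt (fun z => j z * Real.exp (u z t)) -
        circInt (fun z => dot z (spGrad u (flowDom T) z t)) - 2 * π * 1 := by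
    rw [← circInt_const, ← circInt_const_mul, ← circInt_sub hc2 hdotc,
      ← circInt_sub hc3 continuousOn_const]
    exact circInt_congr fun z hz => h.bdry_eq ht h0 hz
  rw [e1, e2, alphaC, betaC, div_mul_cancel₀ _ hF, div_mul_cancel₀ _ hJ]
  ring

lemma IsFlow.alpha_pos (hf : ContinuousOn f cdisc) (hfpos : ∀ z ∈ cdisc, 0 < f z) {t : ℝ}
    (ht : t ∈ flowDom T) : 0 < alphaC f u ρ t :=
  div_pos (mul_pos two_pos (h.2.2.1 t ht).1) (h.ballInt_weight_pos hT hf hfpos ht)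

lemma IsFlow.beta_pos (hj : ContinuousOn j bdry) (hjpos : ∀ z ∈ bdry, 0 < j z) {t : ℝ}
    (ht : t ∈ flowDom T) : 0 < betaC j u ρ t :=
  div_pos (mul_pos two_pos (sub_pos.2 (h.2.2.1 t ht).2)) (h.circInt_weight_pos hT hj hjpos ht)

omit hT in
lemma IsFlow.hasDerivAt_rho {t : ℝ} (ht : t ∈ flowDom T) (h0 : 0 < t) :
    HasDerivAt ρ (Real.log (betaC j u ρ t ^ 2 / alphaC f u ρ t)) t := by
  rw [← h.2.2.2.2.2 t ht h0]
  exact ((h.2.1.differentiableOn one_ne_zero).differentiableAt (flowDom_mem_nhds ht h0)).hasDerivAt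

end Flow

section FlowEnergy

variable {f j : ℂ → ℝ} {T : ℝ≥0∞} {u : ℂ → ℝ → ℝ} {ρ : ℝ → ℝ} (hT : 0 < T)
  (h : IsFlow f j T u ρ)

include hT h

lemma IsFlow.hasDerivAt_confEnergy {t : ℝ} (ht : t ∈ flowDom T) (h0 : 0 < t) :
    HasDerivAt (fun t => confEnergy (fun z => u z t) fun z => spGrad u (flowDom T) z t)
      (circInt (fun z => vel u (flowDom T) z t * (dot z (spGrad u (flowDom T) z t) + 1)) -
        ballInt fun z => vel u (flowDom T) z t * spLap u (flowDom T) z t) t := by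
  have hd := (((isRate_dirich hT h.1).hasDerivAt_ballInt ht h0).div_const 2).add
    (((isRate_flow hT h.1).mono bdry_subset_cdisc).hasDerivAt_circInt ht h0)
  refine hd.congr_deriv ?_
  have hdiv := hasDiv_slice hT h.1 ht
  have hg := green (isGrad_vel hT h.1 ht) hdiv
  have hv : ContinuousOn (fun z => vel u (flowDom T) z t) bdry :=
    (isGrad_vel hT h.1 ht).cont.mono bdry_subset_cdisc
  have hvd : ContinuousOn (fun z => vel u (flowDom T) z t * dot z (spGrad u (flowDom T) z t)) bdry :=
    hv.mul ((continuousOn_id.dot' hdiv.cont).mono bdry_subset_cdisc)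
  have e : circInt (fun z => vel u (flowDom T) z t * (dot z (spGrad u (flowDom T) z t) + 1)) =
      circInt (fun z => vel u (flowDom T) z t * dot z (spGrad u (flowDom T) z t)) +
        circInt fun z => vel u (flowDom T) z t := by
    rw [← circInt_add hvd hv]
    exact circInt_congr fun z _ => by ring
  rw [ballInt_const_mul, e, ← hg]
  ring

lemma IsFlow.hasDerivAt_entropy_area (hf : ContinuousOn f cdisc) (hfpos : ∀ z ∈ cdisc, 0 < f z)
    {t ρ' : ℝ} (ht : t ∈ flowDom T) (h0 : 0 < t) (hρ : HasDerivAt ρ ρ' t) :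
    HasDerivAt (fun t => ρ t * Real.log (alphaC f u ρ t))
      (ρ' * Real.log (alphaC f u ρ t) + ρ' -
        ballInt fun z => vel u (flowDom T) z t * (alphaC f u ρ t * (f z * Real.exp (2 * u z t)))) t := by
  have hF := (h.ballInt_weight_pos hT hf hfpos ht).ne'
  have hα := (h.alpha_pos hT hf hfpos ht).ne'
  have hρ0 := (h.2.2.1 t ht).1.ne'
  have hd := ((isRate_exp_two hT h.1).weight hf).hasDerivAt_ballInt ht h0
  refine (hρ.mul (((hρ.const_mul 2).div hd hF).log hα)).congr_deriv ?_
  have e : ballInt (fun z => f z * (2 * vel u (flowDom T) z t * Real.exp (2 * u z t))) =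
      2 * ballInt fun z => vel u (flowDom T) z t * (f z * Real.exp (2 * u z t)) := by
    rw [← ballInt_const_mul]
    exact ballInt_congr fun z _ => by ring
  have e' : ballInt (fun z => vel u (flowDom T) z t *
      (alphaC f u ρ t * (f z * Real.exp (2 * u z t)))) =
      alphaC f u ρ t * ballInt fun z => vel u (flowDom T) z t * (f z * Real.exp (2 * u z t)) := by
    rw [← ballInt_const_mul]
    exact ballInt_congr fun z _ => by ring
  rw [e, e']
  simp only [Pi.div_apply, alphaC]
  field_simp
  ring

lemma IsFlow.hasDerivAt_entropy_length (hj : ContinuousOn j bdry) (hjpos : ∀ z ∈ bdry, 0 < j z)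
    {t ρ' : ℝ} (ht : t ∈ flowDom T) (h0 : 0 < t) (hρ : HasDerivAt ρ ρ' t) :
    HasDerivAt (fun t => 2 * (π - ρ t) * Real.log (betaC j u ρ t))
      (-2 * ρ' * Real.log (betaC j u ρ t) - 2 * ρ' -
        circInt fun z => vel u (flowDom T) z t * (betaC j u ρ t * (j z * Real.exp (u z t)))) t := by
  have hJ := (h.circInt_weight_pos hT hj hjpos ht).ne'
  have hβ := (h.beta_pos hT hj hjpos ht).ne'
  have hρ0 : π - ρ t ≠ 0 := (sub_pos.2 (h.2.2.1 t ht).2).ne'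
  have hd := ((isRate_exp_bdry hT h.1).weight hj).hasDerivAt_circInt ht h0
  have hρ2 := (hρ.const_sub π).const_mul 2
  refine (hρ2.mul ((hρ2.div hd hJ).log hβ)).congr_deriv ?_
  have e : circInt (fun z => j z * (vel u (flowDom T) z t * Real.exp (u z t))) =
      circInt fun z => vel u (flowDom T) z t * (j z * Real.exp (u z t)) :=
    circInt_congr fun z _ => by ring
  have e' : circInt (fun z => vel u (flowDom T) z t * (betaC j u ρ t * (j z * Real.exp (u z t)))) =
      betaC j u ρ t * circInt fun z => vel u (flowDom T) z t * (j z * Real.exp (u z t)) := by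
    rw [← circInt_const_mul]
    exact circInt_congr fun z _ => by ring
  rw [e, e']
  simp only [Pi.div_apply, betaC]
  field_simp
  ring

variable (hf : ContinuousOn f cdisc) (hfpos : ∀ z ∈ cdisc, 0 < f z)
  (hj : ContinuousOn j bdry) (hjpos : ∀ z ∈ bdry, 0 < j z)

include hf hfpos hj hjpos

lemma IsFlow.hasDerivAt_energy {t : ℝ} (ht : t ∈ flowDom T) (h0 : 0 < t) :
    HasDerivAt (flowEnergy f j T u ρ)
      (-(Real.log (betaC j u ρ t ^ 2 / alphaC f u ρ t) ^ 2 +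
        ballInt (fun z => vel u (flowDom T) z t ^ 2 * Real.exp (2 * u z t)) +
        circInt fun z => vel u (flowDom T) z t ^ 2 * Real.exp (u z t))) t := by
  have hρ := h.hasDerivAt_rho ht h0
  refine ((((h.hasDerivAt_confEnergy hT ht h0).add
    (h.hasDerivAt_entropy_area hT hf hfpos ht h0 hρ)).add
    (h.hasDerivAt_entropy_length hT hj hjpos ht h0 hρ)).add hρ).congr_deriv ?_
  have hlog : Real.log (betaC j u ρ t ^ 2 / alphaC f u ρ t) =
      2 * Real.log (betaC j u ρ t) - Real.log (alphaC f u ρ t) := by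
    rw [Real.log_div (pow_ne_zero 2 (h.beta_pos hT hj hjpos ht).ne')
      (h.alpha_pos hT hf hfpos ht).ne', Real.log_pow]
    norm_num
  have hdiv := hasDiv_slice hT h.1 ht
  have he := (isRate_exp_two hT h.1).continuousOn_slice ht
  have he' := (isRate_exp_bdry hT h.1).continuousOn_slice ht
  have hv := (isGrad_vel hT h.1 ht).cont
  have hv' := hv.mono bdry_subset_cdisc
  have hc1 : ContinuousOn (fun z => vel u (flowDom T) z t *
      (alphaC f u ρ t * (f z * Real.exp (2 * u z t)))) cdisc :=
    hv.mul (continuousOn_const.mul (hf.mul he))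
  have hc2 : ContinuousOn (fun z => vel u (flowDom T) z t * spLap u (flowDom T) z t) cdisc :=
    hv.mul hdiv.contDiv
  have hc3 : ContinuousOn (fun z => vel u (flowDom T) z t *
      (betaC j u ρ t * (j z * Real.exp (u z t)))) bdry :=
    hv'.mul (continuousOn_const.mul (hj.mul he'))
  have hc4 : ContinuousOn (fun z => vel u (flowDom T) z t *
      (dot z (spGrad u (flowDom T) z t) + 1)) bdry :=
    hv'.mul (((continuousOn_id.dot' hdiv.cont).mono bdry_subset_cdisc).add continuousOn_const)
  have e1 : ballInt (fun z => vel u (flowDom T) z t ^ 2 * Real.exp (2 * u z t)) =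
      ballInt (fun z => vel u (flowDom T) z t * (alphaC f u ρ t * (f z * Real.exp (2 * u z t)))) +
        ballInt fun z => vel u (flowDom T) z t * spLap u (flowDom T) z t := by
    rw [← ballInt_add hc1 hc2]
    exact ballInt_congr fun z hz => by rw [pow_two, mul_assoc, h.interior_eq hT ht h0 hz, mul_add]
  have e2 : circInt (fun z => vel u (flowDom T) z t ^ 2 * Real.exp (u z t)) =
      circInt (fun z => vel u (flowDom T) z t * (betaC j u ρ t * (j z * Real.exp (u z t)))) -
        circInt fun z => vel u (flowDom T) z t * (dot z (spGrad u (flowDom T) z t) + 1) := by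
    rw [← circInt_sub hc3 hc4]
    exact circInt_congr fun z hz => by rw [pow_two, mul_assoc, h.bdry_eq ht h0 hz]; ring
  rw [e1, e2, hlog]
  ring

omit hf hfpos hj hjpos in
lemma IsFlow.continuousOn_mass {t : ℝ} (ht : t ∈ flowDom T) :
    ContinuousOn (flowMass u) (Icc 0 t) :=
  (((isRate_exp_two hT h.1).continuousOn_ballInt_Icc (Icc_subset_flowDom hT ht)).div_const 2).add
    ((isRate_exp_bdry hT h.1).continuousOn_circInt_Icc (Icc_subset_flowDom hT ht))

lemma IsFlow.continuousOn_energy {t : ℝ} (ht : t ∈ flowDom T) :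
    ContinuousOn (flowEnergy f j T u ρ) (Icc 0 t) := by
  have hsub := Icc_subset_flowDom hT ht
  have hρ := h.2.1.continuousOn.mono hsub
  have h1 : ContinuousOn (fun t => confEnergy (fun z => u z t) fun z => spGrad u (flowDom T) z t)
      (Icc 0 t) :=
    (((isRate_dirich hT h.1).continuousOn_ballInt_Icc hsub).div_const 2).add
      (((isRate_flow hT h.1).mono bdry_subset_cdisc).continuousOn_circInt_Icc hsub)
  have h2 : ContinuousOn (fun t => alphaC f u ρ t) (Icc 0 t) :=
    (continuousOn_const.mul hρ).div
      (((isRate_exp_two hT h.1).weight hf).continuousOn_ballInt_Icc hsub)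
      fun s hs => (h.ballInt_weight_pos hT hf hfpos (hsub hs)).ne'
  have h3 : ContinuousOn (fun t => betaC j u ρ t) (Icc 0 t) :=
    (continuousOn_const.mul (continuousOn_const.sub hρ)).div
      (((isRate_exp_bdry hT h.1).weight hj).continuousOn_circInt_Icc hsub)
      fun s hs => (h.circInt_weight_pos hT hj hjpos (hsub hs)).ne'
  exact ((h1.add (hρ.mul (h2.log fun s hs => (h.alpha_pos hT hf hfpos (hsub hs)).ne'))).add
    ((continuousOn_const.mul (continuousOn_const.sub hρ)).mul
      (h3.log fun s hs => (h.beta_pos hT hj hjpos (hsub hs)).ne'))).add hρ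

lemma IsFlow.mass_eq {t : ℝ} (ht : t ∈ flowDom T) : flowMass u t = flowMass u 0 := by
  have hsub := Icc_subset_flowDom hT ht
  have hd : ∀ s ∈ interior (Icc 0 t), _ := fun s hs => by
    rw [interior_Icc] at hs
    exact h.hasDerivAt_mass hT hf hfpos hj hjpos (hsub (Ioo_subset_Icc_self hs)) hs.1
  have hc := h.continuousOn_mass hT ht
  have hdiff : DifferentiableOn ℝ (flowMass u) (interior (Icc 0 t)) :=
    fun s hs => (hd s hs).differentiableAt.differentiableWithinAt
  exact le_antisymm
    (antitoneOn_of_deriv_nonpos (convex_Icc 0 t) hc hdiff (fun s hs => (hd s hs).deriv.le)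
      ⟨le_rfl, ht.1⟩ ⟨ht.1, le_rfl⟩ ht.1)
    (monotoneOn_of_deriv_nonneg (convex_Icc 0 t) hc hdiff (fun s hs => (hd s hs).deriv.ge)
      ⟨le_rfl, ht.1⟩ ⟨ht.1, le_rfl⟩ ht.1)

lemma IsFlow.energy_le {t : ℝ} (ht : t ∈ flowDom T) :
    flowEnergy f j T u ρ t ≤ flowEnergy f j T u ρ 0 := by
  have hsub := Icc_subset_flowDom hT ht
  have hd : ∀ s ∈ interior (Icc 0 t), _ := fun s hs => by
    rw [interior_Icc] at hs
    exact h.hasDerivAt_energy hT hf hfpos hj hjpos (hsub (Ioo_subset_Icc_self hs)) hs.1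
  refine antitoneOn_of_deriv_nonpos (convex_Icc 0 t)
    (h.continuousOn_energy hT hf hfpos hj hjpos ht)
    (fun s hs => (hd s hs).differentiableAt.differentiableWithinAt) (fun s hs => ?_)
    ⟨le_rfl, ht.1⟩ ⟨ht.1, le_rfl⟩ ht.1
  rw [(hd s hs).deriv, neg_nonpos]
  exact add_nonneg (add_nonneg (sq_nonneg _) (ballInt_nonneg fun z _ => by positivity))
    (circInt_nonneg fun z _ => by positivity)

end FlowEnergy

lemma contDiff_bpt : ContDiff ℝ (⊤ : ℕ∞) bpt :=
  (Complex.ofRealCLM.contDiff.mul contDiff_const).cexp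

/-- Restricting a smooth function on the disc to the circle gives a twice continuously
differentiable function of the angle. -/
lemma exists_bpt_derivs {w : ℂ → ℝ} (hw : ContDiffOn ℝ (⊤ : ℕ∞) w cdisc) :
    ∃ φ' φ'' : ℝ → ℝ, (∀ θ, HasDerivAt (fun θ => w (bpt θ)) (φ' θ) θ) ∧
      (∀ θ, HasDerivAt φ' (φ'' θ) θ) ∧ Continuous φ'' := by
  have h : ContDiff ℝ (⊤ : ℕ∞) fun θ => w (bpt θ) :=
    hw.comp_contDiff contDiff_bpt bpt_mem_cdisc
  have h1 : ContDiff ℝ (⊤ : ℕ∞) (deriv fun θ => w (bpt θ)) := h.iterate_deriv 1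
  have h2 : ContDiff ℝ (⊤ : ℕ∞) (deriv (deriv fun θ => w (bpt θ))) := h.iterate_deriv 2
  exact ⟨_, _, fun θ => (h.differentiable (by simp) θ).hasDerivAt,
    fun θ => (h1.differentiable (by simp) θ).hasDerivAt, h2.continuous⟩

/-- A continuous function that cannot decrease while below `ε` stays above `ε`. -/
lemma le_of_deriv_nonneg_below {y y' : ℝ → ℝ} {t ε : ℝ} (ht : 0 ≤ t)
    (hc : ContinuousOn y (Icc 0 t)) (hd : ∀ s ∈ Ioo 0 t, HasDerivAt y (y' s) s)
    (hy' : ∀ s ∈ Ioo 0 t, y s < ε → 0 ≤ y' s) (h0 : ε ≤ y 0) : ε ≤ y t := by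
  have hS : IsCompact (Icc 0 t ∩ y ⁻¹' Ici ε) :=
    isCompact_Icc.of_isClosed_subset (hc.preimage_isClosed_of_isClosed isClosed_Icc isClosed_Ici)
      inter_subset_left
  obtain ⟨s, hs, hmax⟩ := hS.exists_isGreatest ⟨0, ⟨le_rfl, ht⟩, h0⟩
  have hmono : MonotoneOn y (Icc s t) := by
    refine monotoneOn_of_deriv_nonneg (convex_Icc s t) (hc.mono (Icc_subset_Icc_left hs.1.1))
      (fun r hr => ?_) (fun r hr => ?_) <;> rw [interior_Icc] at hr
    · exact (hd r ⟨hs.1.1.trans_lt hr.1, hr.2⟩).differentiableAt.differentiableWithinAt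
    · have hr' : r ∈ Ioo 0 t := ⟨hs.1.1.trans_lt hr.1, hr.2⟩
      rw [(hd r hr').deriv]
      refine hy' r hr' (not_le.1 fun hle => ?_)
      exact hr.1.not_ge (hmax ⟨Ioo_subset_Icc_self hr', hle⟩)
  exact le_trans hs.2 (hmono ⟨le_rfl, hs.1.2⟩ ⟨hs.1.2, le_rfl⟩ hs.1.2)

lemma sub_le_mul_log_div {a b : ℝ} (ha : 0 < a) (hb : 0 < b) : a - b ≤ a * Real.log (a / b) := by
  have h := mul_le_mul_of_nonneg_left (Real.one_sub_inv_le_log_of_pos (div_pos ha hb)) ha.le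
  rwa [inv_div, mul_sub, mul_one, mul_div_cancel₀ _ ha.ne'] at h

lemma IsCompact.exists_pos_bounds {K : Set ℂ} (hK : IsCompact K) (hne : K.Nonempty) {w : ℂ → ℝ}
    (hw : ContinuousOn w K) (hpos : ∀ z ∈ K, 0 < w z) :
    ∃ a b, 0 < a ∧ 0 < b ∧ ∀ z ∈ K, a ≤ w z ∧ w z ≤ b := by
  obtain ⟨x, hx, hmin⟩ := hK.exists_isMinOn hne hw
  obtain ⟨y, hy, hmax⟩ := hK.exists_isMaxOn hne hw
  exact ⟨w x, w y, hpos x hx, hpos y hy, fun z hz => ⟨hmin hz, hmax hz⟩⟩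

section FlowBounds

variable {f j : ℂ → ℝ} {T : ℝ≥0∞} {u : ℂ → ℝ → ℝ} {ρ : ℝ → ℝ}

/-- Two-sided bounds on the weighted area and length along the flow. -/
def WeightBounds (f j : ℂ → ℝ) (T : ℝ≥0∞) (u : ℂ → ℝ → ℝ) (Fl Fu Jl Ju : ℝ) : Prop :=
  ∀ t ∈ flowDom T, (ballInt fun z => f z * Real.exp (2 * u z t)) ∈ Icc Fl Fu ∧
    (circInt fun z => j z * Real.exp (u z t)) ∈ Icc Jl Ju

lemma exists_rho_ge {Fl Fu Jl Ju ρ₀ : ℝ} (hFl : 0 < Fl) (hFu : 0 < Fu) (hJl : 0 < Jl)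
    (hJu : 0 < Ju) (hρ₀ : ρ₀ ∈ Ioo 0 π) :
    ∃ ε > 0, ∀ (f j : ℂ → ℝ) (T : ℝ≥0∞) (u : ℂ → ℝ → ℝ) (ρ : ℝ → ℝ), 0 < T → IsFlow f j T u ρ →
      ρ 0 = ρ₀ → WeightBounds f j T u Fl Fu Jl Ju → ∀ t ∈ flowDom T, ε ≤ ρ t ∧ ε ≤ π - ρ t := by
  have hπ := Real.pi_pos
  have hρ₁ := sub_pos.2 hρ₀.2
  have hρ₂ := hρ₀.1
  obtain ⟨ε₁, hε₁⟩ : ∃ ε₁, ε₁ = (π / Ju) ^ 2 * Fl / 2 := ⟨_, rfl⟩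
  obtain ⟨ε₂, hε₂⟩ : ∃ ε₂, ε₂ = √(π / Fu) * Jl / 2 := ⟨_, rfl⟩
  have hε₁0 : 0 < ε₁ := by rw [hε₁]; positivity
  have hε₂0 : 0 < ε₂ := by rw [hε₂]; positivity
  obtain ⟨ε, hε, hεε₁, hεε₂, hερ₀, hερ₁, hεπ⟩ : ∃ ε > 0, ε ≤ ε₁ ∧ ε ≤ ε₂ ∧ ε ≤ ρ₀ ∧ ε ≤ π - ρ₀ ∧
      ε ≤ π / 2 := by
    refine ⟨min (min ε₁ ε₂) (min (min ρ₀ (π - ρ₀)) (π / 2)), by positivity, ?_, ?_, ?_, ?_, ?_⟩ <;>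
      simp
  refine ⟨ε, hε, fun f j T u ρ hT h h0 hw t ht => ?_⟩
  have hsub := Icc_subset_flowDom hT ht
  have hρc := h.2.1.continuousOn.mono hsub
  have hd : ∀ s ∈ Ioo 0 t, _ := fun s hs =>
    h.hasDerivAt_rho (hsub (Ioo_subset_Icc_self hs)) hs.1
  constructor
  · refine le_of_deriv_nonneg_below ht.1 hρc hd (fun s hs hlt => ?_) (h0 ▸ hερ₀)
    have hs' := hsub (Ioo_subset_Icc_self hs)
    obtain ⟨⟨hF, -⟩, ⟨hJ, hJ'⟩⟩ := hw s hs'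
    have hρs := h.2.2.1 s hs'
    have hα0 : 0 < alphaC f u ρ s := div_pos (by linarith [hρs.1]) (hFl.trans_le hF)
    have hα : alphaC f u ρ s ≤ (π / Ju) ^ 2 := by
      rw [alphaC, div_le_iff₀ (hFl.trans_le hF)]
      calc 2 * ρ s ≤ 2 * ε₁ := by linarith
        _ = (π / Ju) ^ 2 * Fl := by rw [hε₁]; ring
        _ ≤ _ := by gcongr
    have hβ : π / Ju ≤ betaC j u ρ s := by
      have := hJl.trans_le hJ
      rw [betaC]
      gcongr <;> linarith [hρs.1, hρs.2]
    refine Real.log_nonneg ((one_le_div hα0).2 (hα.trans ?_))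
    gcongr
  · refine le_of_deriv_nonneg_below (y := fun s => π - ρ s) ht.1 (continuousOn_const.sub hρc)
      (fun s hs => (hd s hs).const_sub π) (fun s hs hlt => ?_) (h0 ▸ hερ₁)
    have hs' := hsub (Ioo_subset_Icc_self hs)
    obtain ⟨⟨hF, hF'⟩, ⟨hJ, -⟩⟩ := hw s hs'
    have hρs := h.2.2.1 s hs'
    have hα0 : 0 < alphaC f u ρ s := div_pos (by linarith [hρs.1]) (hFl.trans_le hF)
    have hβ0 : 0 < betaC j u ρ s := div_pos (by linarith [hρs.2]) (hJl.trans_le hJ)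
    have hβ : betaC j u ρ s ≤ √(π / Fu) := by
      rw [betaC, div_le_iff₀ (hJl.trans_le hJ)]
      calc 2 * (π - ρ s) ≤ 2 * ε₂ := by linarith
        _ = √(π / Fu) * Jl := by rw [hε₂]; ring
        _ ≤ _ := by gcongr
    have hα : π / Fu ≤ alphaC f u ρ s := by
      have := hFl.trans_le hF
      rw [alphaC]
      gcongr <;> linarith [hρs.1, hρs.2]
    refine neg_nonneg.2 (Real.log_nonpos (by positivity) ((div_le_one hα0).2 (le_trans ?_ hα)))
    rw [← Real.sq_sqrt (show 0 ≤ π / Fu by positivity)]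
    gcongr

variable (hT : 0 < T) (h : IsFlow f j T u ρ)
include hT h

omit hT h in
lemma area_le_mass (u : ℂ → ℝ → ℝ) (t : ℝ) :
    ballInt (fun z => Real.exp (2 * u z t)) ≤ 2 * flowMass u t := by
  have : 0 ≤ circInt fun z => Real.exp (u z t) := circInt_nonneg fun z _ => (Real.exp_pos _).le
  rw [flowMass]
  linarith

omit hT h in
lemma length_le_mass (u : ℂ → ℝ → ℝ) (t : ℝ) :
    circInt (fun z => Real.exp (u z t)) ≤ flowMass u t := by
  have : 0 ≤ ballInt fun z => Real.exp (2 * u z t) := ballInt_nonneg fun z _ => (Real.exp_pos _).le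
  rw [flowMass]
  linarith

lemma IsFlow.ballInt_weight_mem (hf : ContinuousOn f cdisc) {a b t : ℝ}
    (hab : ∀ z ∈ cdisc, a ≤ f z ∧ f z ≤ b) (ht : t ∈ flowDom T) :
    (ballInt fun z => f z * Real.exp (2 * u z t)) ∈
      Icc (a * ballInt fun z => Real.exp (2 * u z t)) (b * ballInt fun z => Real.exp (2 * u z t)) := by
  have he := (isRate_exp_two hT h.1).continuousOn_slice ht
  rw [← ballInt_const_mul, ← ballInt_const_mul]
  exact ⟨ballInt_mono (continuousOn_const.mul he) (hf.mul he) fun z hz =>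
      mul_le_mul_of_nonneg_right (hab z (odisc_subset_cdisc hz)).1 (Real.exp_pos _).le,
    ballInt_mono (hf.mul he) (continuousOn_const.mul he) fun z hz =>
      mul_le_mul_of_nonneg_right (hab z (odisc_subset_cdisc hz)).2 (Real.exp_pos _).le⟩

lemma IsFlow.circInt_weight_mem (hj : ContinuousOn j bdry) {a b t : ℝ}
    (hab : ∀ z ∈ bdry, a ≤ j z ∧ j z ≤ b) (ht : t ∈ flowDom T) :
    (circInt fun z => j z * Real.exp (u z t)) ∈
      Icc (a * circInt fun z => Real.exp (u z t)) (b * circInt fun z => Real.exp (u z t)) := by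
  have he := (isRate_exp_bdry hT h.1).continuousOn_slice ht
  rw [← circInt_const_mul, ← circInt_const_mul]
  exact ⟨circInt_mono (continuousOn_const.mul he) (hj.mul he) fun z hz =>
      mul_le_mul_of_nonneg_right (hab z hz).1 (Real.exp_pos _).le,
    circInt_mono (hj.mul he) (continuousOn_const.mul he) fun z hz =>
      mul_le_mul_of_nonneg_right (hab z hz).2 (Real.exp_pos _).le⟩

lemma IsFlow.confEnergy_le (hf : ContinuousOn f cdisc) (hfpos : ∀ z ∈ cdisc, 0 < f z)
    (hj : ContinuousOn j bdry) (hjpos : ∀ z ∈ bdry, 0 < j z) {t Fu Ju : ℝ} (ht : t ∈ flowDom T)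
    (hF : ballInt (fun z => f z * Real.exp (2 * u z t)) ≤ Fu)
    (hJ : circInt (fun z => j z * Real.exp (u z t)) ≤ Ju) :
    confEnergy (fun z => u z t) (fun z => spGrad u (flowDom T) z t) ≤
      flowEnergy f j T u ρ 0 + Fu / 2 + Ju := by
  have hle := h.energy_le hT hf hfpos hj hjpos ht
  have hρ := h.2.2.1 t ht
  have h1 := sub_le_mul_log_div (mul_pos two_pos hρ.1) (h.ballInt_weight_pos hT hf hfpos ht)
  have h2 := sub_le_mul_log_div (mul_pos two_pos (sub_pos.2 hρ.2))
    (h.circInt_weight_pos hT hj hjpos ht)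
  rw [← alphaC] at h1
  rw [← betaC] at h2
  rw [flowEnergy] at hle
  linarith [hρ.1, hρ.2]

omit h in
lemma flowEnergy_zero_congr {u₀ : ℂ → ℝ} {ρ₀ : ℝ}
    (hu : ContDiffOn ℝ (⊤ : ℕ∞) (fun p : ℂ × ℝ => u p.1 p.2) (cdisc ×ˢ flowDom T))
    (h0 : ∀ z ∈ cdisc, u z 0 = u₀ z) (hρ : ρ 0 = ρ₀) :
    flowEnergy f j T u ρ 0 =
      confEnergy u₀ (fun z => ⟨fderivWithin ℝ u₀ cdisc z 1, fderivWithin ℝ u₀ cdisc z Complex.I⟩) +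
      ρ₀ * Real.log (2 * ρ₀ / ballInt fun z => f z * Real.exp (2 * u₀ z)) +
      2 * (π - ρ₀) * Real.log (2 * (π - ρ₀) / circInt fun z => j z * Real.exp (u₀ z)) + ρ₀ := by
  have e1 : ballInt (fun z => f z * Real.exp (2 * u z 0)) =
      ballInt fun z => f z * Real.exp (2 * u₀ z) :=
    ballInt_congr fun z hz => by rw [h0 z (odisc_subset_cdisc hz)]
  have e2 : circInt (fun z => j z * Real.exp (u z 0)) = circInt fun z => j z * Real.exp (u₀ z) :=
    circInt_congr fun z hz => by rw [h0 z (bdry_subset_cdisc hz)]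
  have e3 : circInt (fun z => u z 0) = circInt u₀ :=
    circInt_congr fun z hz => h0 z (bdry_subset_cdisc hz)
  have e4 : ∀ z ∈ cdisc, spGrad u (flowDom T) z 0 =
      ⟨fderivWithin ℝ u₀ cdisc z 1, fderivWithin ℝ u₀ cdisc z Complex.I⟩ := fun z hz => by
    have := (hasFDerivWithinAt_slice hu hz (zero_mem_flowDom hT)).fderivWithin
      (uniqueDiffOn_cdisc z hz)
    rw [fderivWithin_congr h0 (h0 z hz)] at this
    rw [this]
    simp [dot]
  have e5 : dirich (fun z => spGrad u (flowDom T) z 0) = dirich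
      (fun z => ⟨fderivWithin ℝ u₀ cdisc z 1, fderivWithin ℝ u₀ cdisc z Complex.I⟩) :=
    ballInt_congr fun z hz => by simp only [e4 z (odisc_subset_cdisc hz)]
  simp only [flowEnergy, confEnergy, alphaC, betaC, e1, e2, e3, e5, hρ]

omit hT h in
lemma flowMass_zero_congr {u₀ : ℂ → ℝ} (h0 : ∀ z ∈ cdisc, u z 0 = u₀ z) :
    flowMass u 0 = ballInt (fun z => Real.exp (2 * u₀ z)) / 2 + circInt fun z => Real.exp (u₀ z) := by
  rw [flowMass, ballInt_congr fun z hz => by rw [h0 z (odisc_subset_cdisc hz)],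
    circInt_congr fun z hz => by rw [h0 z (bdry_subset_cdisc hz)]]

end FlowBounds

/-- The weighted area and length stay bounded above and below by constants depending only on the
data. -/
lemma exists_weightBounds {f j u₀ : ℂ → ℝ} (hf : ContinuousOn f cdisc)
    (hfpos : ∀ z ∈ cdisc, 0 < f z) (hj : ContinuousOn j bdry) (hjpos : ∀ z ∈ bdry, 0 < j z)
    (hu₀ : ContinuousOn u₀ cdisc) (ρ₀ : ℝ) :
    ∃ Fl > 0, ∃ Fu > 0, ∃ Jl > 0, ∃ Ju > 0, ∀ (T : ℝ≥0∞) (u : ℂ → ℝ → ℝ) (ρ : ℝ → ℝ), 0 < T →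
      IsFlow f j T u ρ → (∀ z ∈ cdisc, u z 0 = u₀ z) → ρ 0 = ρ₀ →
      WeightBounds f j T u Fl Fu Jl Ju := by
  obtain ⟨a, b, ha, hb, hab⟩ := isCompact_cdisc.exists_pos_bounds ⟨0, by simp [mem_cdisc]⟩ hf hfpos
  obtain ⟨p, q, hp, hq, hpq⟩ := (isCompact_sphere (0 : ℂ) 1).exists_pos_bounds
    ⟨bpt 0, bpt_mem_bdry 0⟩ hj hjpos
  obtain ⟨m, hm⟩ : ∃ m, m = ballInt (fun z => Real.exp (2 * u₀ z)) / 2 +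
    circInt fun z => Real.exp (u₀ z) := ⟨_, rfl⟩
  have hm0 : 0 < m := by
    rw [hm]
    have h1 : 0 ≤ ballInt fun z => Real.exp (2 * u₀ z) :=
      ballInt_nonneg fun z _ => (Real.exp_pos _).le
    have h2 : 0 < circInt fun z => Real.exp (u₀ z) :=
      circInt_pos (hu₀.mono bdry_subset_cdisc).rexp fun z _ => Real.exp_pos _
    linarith
  obtain ⟨E, hE⟩ : ∃ E, E =
      confEnergy u₀ (fun z => ⟨fderivWithin ℝ u₀ cdisc z 1, fderivWithin ℝ u₀ cdisc z Complex.I⟩) +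
      ρ₀ * Real.log (2 * ρ₀ / ballInt fun z => f z * Real.exp (2 * u₀ z)) +
      2 * (π - ρ₀) * Real.log (2 * (π - ρ₀) / circInt fun z => j z * Real.exp (u₀ z)) + ρ₀ :=
    ⟨_, rfl⟩
  obtain ⟨c, hc, hge⟩ := exists_area_length_ge (E + b * (2 * m) / 2 + q * m) m hm0
  refine ⟨a * c, by positivity, b * (2 * m), by positivity, p * c, by positivity, q * m,
    by positivity, fun T u ρ hT h h0 hρ t ht => ?_⟩
  have hmass : flowMass u t = m := by
    rw [h.mass_eq hT hf hfpos hj hjpos ht, flowMass_zero_congr h0, hm]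
  have hA := area_le_mass u t
  have hL := length_le_mass u t
  rw [hmass] at hA hL
  have hF := h.ballInt_weight_mem hT hf hab ht
  have hJ := h.circInt_weight_mem hT hj hpq ht
  have hFu := hF.2.trans (mul_le_mul_of_nonneg_left hA hb.le)
  have hJu := hJ.2.trans (mul_le_mul_of_nonneg_left hL hq.le)
  have hen := h.confEnergy_le hT hf hfpos hj hjpos ht hFu hJu
  rw [flowEnergy_zero_congr hT h.1 h0 hρ, ← hE] at hen
  have hut : ContDiffOn ℝ (⊤ : ℕ∞) (fun z => u z t) cdisc :=
    h.1.comp (f := fun z => (z, t)) (by fun_prop) fun _ hz => ⟨hz, ht⟩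
  obtain ⟨φ', φ'', hφ', hφ'', hφc⟩ := exists_bpt_derivs hut
  obtain ⟨h1, h2⟩ := hge _ _ φ' φ'' (isGrad_slice hT h.1 ht) hφ' hφ'' hφc hen hmass
  exact ⟨⟨(mul_le_mul_of_nonneg_left h1 ha.le).trans hF.1, hFu⟩,
    ⟨(mul_le_mul_of_nonneg_left h2 hp.le).trans hJ.1, hJu⟩⟩

/-- Uniform two-sided bounds on the coefficients `α(t)` and `β(t)` along the flow,
independent of `T`. -/
theorem flow_alpha_beta_bounds (f j : ℂ → ℝ)
    (hf : ContDiffOn ℝ (⊤ : ℕ∞) f cdisc) (hfpos : ∀ z ∈ cdisc, 0 < f z)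
    (hj : ContDiffOn ℝ (⊤ : ℕ∞) j bdry) (hjpos : ∀ z ∈ bdry, 0 < j z)
    (u₀ : ℂ → ℝ) (hu₀ : ContDiffOn ℝ (⊤ : ℕ∞) u₀ cdisc)
    (ρ₀ : ℝ) (hρ₀ : ρ₀ ∈ Set.Ioo 0 Real.pi) :
    ∃ α₀ α₁ β₀ β₁ : ℝ, 0 < α₀ ∧ α₀ ≤ α₁ ∧ 0 < β₀ ∧ β₀ ≤ β₁ ∧
      ∀ (T : ℝ≥0∞), 0 < T → ∀ (u : ℂ → ℝ → ℝ) (ρ : ℝ → ℝ), IsFlow f j T u ρ →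
        (∀ z ∈ cdisc, u z 0 = u₀ z) → ρ 0 = ρ₀ →
        ∀ t : ℝ, 0 ≤ t → ENNReal.ofReal t < T →
          (α₀ ≤ alphaC f u ρ t ∧ alphaC f u ρ t ≤ α₁) ∧
          (β₀ ≤ betaC j u ρ t ∧ betaC j u ρ t ≤ β₁) := by
  obtain ⟨Fl, hFl, Fu, hFu, Jl, hJl, Ju, hJu, hbd⟩ := exists_weightBounds hf.continuousOn hfpos
    hj.continuousOn hjpos hu₀.continuousOn ρ₀
  obtain ⟨ε, hε, hρ⟩ := exists_rho_ge hFl hFu hJl hJu hρ₀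
  refine ⟨2 * ε / Fu, max (2 * ε / Fu) (2 * π / Fl), 2 * ε / Ju, max (2 * ε / Ju) (2 * π / Jl),
    by positivity, le_max_left _ _, by positivity, le_max_left _ _,
    fun T hT u ρ h h0 hρ0 t ht htT => ?_⟩
  have ht' : t ∈ flowDom T := ⟨ht, htT⟩
  have hw := hbd T u ρ hT h h0 hρ0
  obtain ⟨⟨hF, hF'⟩, ⟨hJ, hJ'⟩⟩ := hw t ht'
  obtain ⟨h1, h2⟩ := hρ f j T u ρ hT h hρ0 hw t ht'
  have hF0 := hFl.trans_le hF
  have hJ0 := hJl.trans_le hJ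
  have hp := Real.pi_pos
  refine ⟨⟨?_, le_max_of_le_right ?_⟩, ?_, le_max_of_le_right ?_⟩
  · exact div_le_div₀ (by linarith) (by linarith) hF0 hF'
  · exact div_le_div₀ (by linarith) (by linarith) hFl hF
  · exact div_le_div₀ (by linarith) (by linarith) hJ0 hJ'
  · exact div_le_div₀ (by linarith) (by linarith) hJl hJ
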